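/- arXiv:math/0609091 — 6 statements merged into one kernel-verified Lean document; each statement's English description precedes it below -/
import Mathlib

section
/- Let X be a topological space and κ a regular uncountable cardinal with ŝ(X) ≤ κ ≤ Δ(X) (X has no discrete subspace of size κ and every nonempty open set has size at least κ). Then X is κ-resolvable. -/
universe u

open Cardinal Set

/-- A space is `κ`-resolvable iff it has `κ` pairwise disjoint dense subsets. -/
def Resolvable (X : Type u) [TopologicalSpace X] (κ : Cardinal.{u}) : Prop :=
  ∃ (ι : Type u) (D : ι → Set X), #ι = κ ∧ (∀ i, Dense (D i)) ∧
    Pairwise (Function.onFun Disjoint D)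

/-- `L` is left-separated: it has a well-ordering all of whose initial segments
are closed in the subspace `L`. -/
def LeftSeparated {X : Type u} [TopologicalSpace X] (L : Set X) : Prop :=
  ∃ r : L → L → Prop, IsWellOrder L r ∧ ∀ x : L, IsClosed {y : L | r y x}

/-- `R` is right-separated: it has a well-ordering all of whose initial segments
are open in the subspace `R`. -/
def RightSeparated {X : Type u} [TopologicalSpace X] (R : Set X) : Prop :=
  ∃ r : R → R → Prop, IsWellOrder R r ∧ ∀ x : R, IsOpen {y : R | r y x}

/-- The dispersion character `Δ(X)`: the minimal cardinality of a nonempty open set. -/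
noncomputable def dispersion (X : Type u) [TopologicalSpace X] : Cardinal.{u} :=
  sInf {c | ∃ G : Set X, IsOpen G ∧ G.Nonempty ∧ #G = c}

namespace Res
variable {κ : Cardinal.{u}} {α β : Type u}

lemma sm_mono {s t : Set α} (h : s ⊆ t) (ht : #t < κ) : #s < κ :=
  (Cardinal.mk_le_mk_of_subset h).trans_lt ht

lemma sm_union (hreg : κ.IsRegular) {s t : Set α} (hs : #s < κ) (ht : #t < κ) :
    #(s ∪ t : Set α) < κ :=
  (Cardinal.mk_union_le s t).trans_lt (Cardinal.add_lt_of_lt hreg.aleph0_le hs ht)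

lemma sm_biUnion (hreg : κ.IsRegular) {s : Set α} {t : α → Set β} (hs : #s < κ)
    (ht : ∀ a ∈ s, #(t a) < κ) : #(⋃ a ∈ s, t a : Set β) < κ :=
  (Cardinal.card_biUnion_lt_iff_forall_of_isRegular hreg hs).2 ht

lemma sm_image {s : Set α} (f : α → β) (hs : #s < κ) : #(f '' s) < κ :=
  Cardinal.mk_image_le.trans_lt hs

/-- a large set has an element outside a small set -/
lemma exists_out {s t : Set α} (hs : κ ≤ #s) (ht : #t < κ) : ∃ a ∈ s, a ∉ t := by
  by_contra h
  push Not at h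
  exact absurd (sm_mono h ht) (not_lt.2 hs)

lemma big_diff (hreg : κ.IsRegular) {s t : Set α} (hs : κ ≤ #s) (ht : #t < κ) :
    κ ≤ #(s \ t : Set α) := by
  by_contra h
  push Not at h
  have := sm_mono (s := s) (by intro x hx; by_cases hxt : x ∈ t <;> simp_all) (sm_union hreg h ht)
  exact absurd this (not_lt.2 hs)

variable {ι : Type u} [LinearOrder ι] [WellFoundedLT ι]

lemma sel (hI : ∀ i : ι, #(Iio i) < κ) (P : Set β → β → Prop)
    (hP : ∀ S : Set β, #S < κ → ∃ b, P S b) : ∃ h : ι → β, ∀ a, P (h '' Iio a) (h a) := by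
  classical
  have hne : Nonempty β ∨ IsEmpty ι := by
    by_cases h : Nonempty ι
    · obtain ⟨i⟩ := h
      obtain ⟨b, -⟩ := hP ∅ (by simpa using zero_le.trans_lt (hI i))
      exact Or.inl ⟨b⟩
    · exact Or.inr (not_nonempty_iff.1 h)
  rcases hne with hne | hne
  swap
  · exact ⟨fun i => (hne.false i).elim, fun i => (hne.false i).elim⟩
  let g : Set β → β := fun S => if h : ∃ b, P S b then h.choose else Classical.choice hne
  have hg : ∀ S : Set β, #S < κ → P S (g S) := by
    intro S hS
    have h := hP S hS
    simp only [g, dif_pos h]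
    exact h.choose_spec
  let F : (a : ι) → ((b : ι) → b < a → β) → β := fun a f => g {y | ∃ b, ∃ h : b < a, f b h = y}
  let h : ι → β := (wellFounded_lt (α := ι)).fix F
  have hh : ∀ a, h a = g (h '' Iio a) := by
    intro a
    have := (wellFounded_lt (α := ι)).fix_eq F a
    change h a = g {y | ∃ b, ∃ _ : b < a, h b = y} at this
    rw [this]
    congr 1
    ext y
    simp
  refine ⟨h, fun a => ?_⟩
  have := hg (h '' Iio a) (sm_image h (hI a))
  rwa [← hh] at this

lemma glue {X : Type u} [TopologicalSpace X] (hι : #ι = κ) [Nonempty ι]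
    (H : ∀ G : Set X, IsOpen G → G.Nonempty → ∃ D : ι → Set X, (∀ a, D a ⊆ G) ∧
      Pairwise (Function.onFun Disjoint D) ∧ (∀ a b, D b ⊆ closure (D a)) ∧ ∃ a, (D a).Nonempty) :
    Resolvable X κ := by
  obtain ⟨D, hD⟩ := zorn_le₀ {D : ι → Set X | Pairwise (Function.onFun Disjoint D) ∧
      ∀ a b, D b ⊆ closure (D a)} (by
    intro c hc hch
    refine ⟨fun a => ⋃ D ∈ c, D a, ⟨?_, ?_⟩, ?_⟩
    · intro a b hab
      simp only [Function.onFun, Set.disjoint_left, mem_iUnion, not_exists]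
      rintro x ⟨D, hD, hx⟩ D' hD' hx'
      rcases hch.total hD hD' with h | h
      · exact Set.disjoint_left.1 ((hc hD').1 hab) (h a hx) hx'
      · exact Set.disjoint_left.1 ((hc hD).1 hab) hx (h b hx')
    · intro a b
      refine iUnion₂_subset fun D hD => ((hc hD).2 a b).trans (closure_mono ?_)
      exact subset_biUnion_of_mem (u := fun D : ι → Set X => D a) hD
    · intro D hD a
      exact subset_biUnion_of_mem (u := fun D : ι → Set X => D a) hD)
  refine ⟨ι, D, hι, ?_, hD.prop.1⟩
  intro a0
  by_contra hnd
  have hne : ((closure (D a0))ᶜ).Nonempty := by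
    rw [Set.nonempty_compl]
    rwa [dense_iff_closure_eq] at hnd
  obtain ⟨D', h1, h2, h3, a, ha⟩ := H _ isClosed_closure.isOpen_compl hne
  have hdis : ∀ a b, Disjoint (D a) (D' b) := by
    intro a b
    rw [Set.disjoint_left]
    intro x hx hx'
    exact h1 b hx' (hD.prop.2 a0 a hx)
  have hle := hD.le_of_ge (y := fun a => D a ∪ D' a) ⟨?_, ?_⟩ (fun a => subset_union_left)
  · obtain ⟨x, hx⟩ := ha
    exact Set.disjoint_left.1 (hdis a a) (hle a (Or.inr hx)) hx
  · intro a b hab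
    have e1 := hD.prop.1 hab
    have e2 := h2 hab
    simp only [Function.onFun] at *
    rw [Set.disjoint_union_left, Set.disjoint_union_right, Set.disjoint_union_right]
    exact ⟨⟨e1, hdis _ _⟩, (hdis _ _).symm, e2⟩
  · intro a b
    rw [closure_union]
    exact Set.union_subset_union (hD.prop.2 a b) (h3 a b)

lemma case1 {X : Type u} [TopologicalSpace X] (hreg : κ.IsRegular)
    (hI : ∀ i : ι, #(Iio i) < κ) [Nonempty ι]
    (hΔ : ∀ G : Set X, IsOpen G → G.Nonempty → κ ≤ #G) (G : Set X) (hG : IsOpen G)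
    (hGne : G.Nonempty)
    (H : ∀ E : Set X, #E < κ → ∃ S : Set X, S ⊆ G \ E ∧ #S < κ ∧ G \ E ⊆ closure S) :
    ∃ D : ι → Set X, (∀ a, D a ⊆ G) ∧
      Pairwise (Function.onFun Disjoint D) ∧ (∀ a b, D b ⊆ closure (D a)) ∧ ∃ a, (D a).Nonempty := by
  obtain ⟨h, hh⟩ := sel (ι := ι) (β := {D : Set X // #D < κ}) hI
    (fun S D => D.1 ⊆ G ∧ (∀ D' ∈ S, Disjoint D'.1 D.1) ∧ G ⊆ closure D.1) (by
      intro S hS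
      have hE : #(⋃ D ∈ S, D.1 : Set X) < κ := sm_biUnion hreg hS (fun D _ => D.2)
      obtain ⟨T, hT1, hT2, hT3⟩ := H _ hE
      refine ⟨⟨T, hT2⟩, fun x hx => (hT1 hx).1, ?_, ?_⟩
      · intro D hD
        rw [Set.disjoint_left]
        intro x hx hx'
        exact (hT1 hx').2 (mem_biUnion hD hx)
      · intro x hx
        by_contra hxc
        have h1 := hΔ (G ∩ (closure T)ᶜ) (hG.inter isClosed_closure.isOpen_compl) ⟨x, hx, hxc⟩
        obtain ⟨y, hy, hy'⟩ := exists_out h1 hE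
        exact hy.2 (hT3 ⟨hy.1, hy'⟩))
  refine ⟨fun a => (h a).1, fun a => (hh a).1, ?_, fun a b => (hh b).1.trans (hh a).2.2, ?_⟩
  · intro a b hab
    rcases lt_or_gt_of_ne hab with hl | hl
    · exact (hh b).2.1 _ ⟨a, hl, rfl⟩
    · exact ((hh a).2.1 _ ⟨b, hl, rfl⟩).symm
  · obtain ⟨i⟩ := (inferInstance : Nonempty ι)
    refine ⟨i, ?_⟩
    obtain ⟨x, hx⟩ := hGne
    exact closure_nonempty_iff.1 ⟨x, (hh i).2.2 hx⟩

/-- complete accumulation of `x i` by the points indexed by `A` -/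
def CAcc {X : Type u} [TopologicalSpace X] (κ : Cardinal.{u}) (x : ι → X) (i : ι) (A : Set ι) :
    Prop :=
  ∀ U : Set X, IsOpen U → x i ∈ U → κ ≤ #({j | j ∈ A ∧ x j ∈ U} : Set ι)

lemma left_inj {X : Type u} [TopologicalSpace X] {x : ι → X}
    (hx : ∀ a, x a ∉ closure (x '' Iio a)) : Function.Injective x := by
  intro a b hab
  by_contra hne
  rcases lt_or_gt_of_ne hne with hl | hl
  · exact hx b (subset_closure ⟨a, hl, hab⟩)
  · exact hx a (subset_closure ⟨b, hl, hab.symm⟩)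

lemma hl {X : Type u} [TopologicalSpace X] (hreg : κ.IsRegular) (hι : #ι = κ)
    (hI : ∀ i : ι, #(Iio i) < κ)
    (hs : ∀ D : Set X, DiscreteTopology ↥D → #D ≠ κ)
    (x : ι → X) (hx : ∀ a, x a ∉ closure (x '' Iio a)) (A : Set ι) (hA : κ ≤ #A) :
    ∃ i ∈ A, CAcc κ x i A := by
  by_contra hcon
  simp only [CAcc] at hcon
  push Not at hcon
  choose! U hU1 hU2 hU3 using hcon
  have hIic : ∀ i : ι, #(Iic i) < κ := by
    intro i
    rw [← Iio_union_right]
    refine sm_union hreg (hI i) ?_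
    rw [Cardinal.mk_singleton]
    exact Cardinal.one_lt_aleph0.trans_le hreg.aleph0_le
  obtain ⟨h, hh⟩ := sel (ι := ι) (β := ι) hI
    (fun S b => b ∈ A ∧ ∀ c ∈ S, c ∈ A → (c < b ∧ x b ∉ U c)) (by
      intro S hS
      have hE : #(⋃ c ∈ S ∩ A, ({j | j ∈ A ∧ x j ∈ U c} ∪ Iic c) : Set ι) < κ :=
        sm_biUnion hreg (sm_mono inter_subset_left hS)
          (fun c hc => sm_union hreg (hU3 c hc.2) (hIic c))
      obtain ⟨b, hb, hb'⟩ := exists_out hA hE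
      simp only [mem_iUnion, not_exists] at hb'
      refine ⟨b, hb, fun c hc hcA => ?_⟩
      have := hb' c ⟨hc, hcA⟩
      simp only [mem_union, mem_setOf_eq, mem_Iic, not_or, not_le] at this
      exact ⟨this.2, fun hq => this.1 ⟨hb, hq⟩⟩)
  have hmem : ∀ a, h a ∈ A := fun a => (hh a).1
  have hlt : ∀ a b, b < a → h b < h a ∧ x (h a) ∉ U (h b) := fun a b hab =>
    (hh a).2 (h b) ⟨b, hab, rfl⟩ (hmem b)
  have hmono : StrictMono h := fun b a hab => (hlt a b hab).1
  have hinj : Function.Injective (x ∘ h) := (left_inj hx).comp hmono.injective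
  refine hs (range (x ∘ h)) ?_ ?_
  · rw [discreteTopology_subtype_iff']
    rintro _ ⟨a, rfl⟩
    refine ⟨U (h a) ∩ (closure (x '' Iio (h a)))ᶜ,
      (hU1 _ (hmem a)).inter isClosed_closure.isOpen_compl, ?_⟩
    ext y
    constructor
    · rintro ⟨⟨hy1, hy2⟩, b, rfl⟩
      rcases lt_trichotomy a b with hl | hl | hl
      · exact absurd hy1 (hlt b a hl).2
      · rw [hl]; rfl
      · exact (hy2 (subset_closure ⟨h b, hmono hl, rfl⟩)).elim
    · rintro rfl
      exact ⟨⟨hU2 _ (hmem a), hx _⟩, a, rfl⟩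
  · rw [Cardinal.mk_range_eq _ hinj, hι]

section two
variable {X : Type u} [TopologicalSpace X] {x : ι → X} {p : ι → ι}

/-- bad points of `N` -/
def Bad (κ : Cardinal.{u}) (x : ι → X) (p : ι → ι) (N : Set ι) : Set ι :=
  {j | j ∈ N ∧ ¬ ∃ Y ⊆ N, InjOn p Y ∧ CAcc κ x j Y}

lemma CAcc.mono {i : ι} {A B : Set ι} (h : CAcc κ x i A) (hAB : A ⊆ B) : CAcc κ x i B :=
  fun U hU hi => (h U hU hi).trans
    (Cardinal.mk_le_mk_of_subset fun _ hj => ⟨hAB hj.1, hj.2⟩)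

lemma bad_small (HL : ∀ A : Set ι, κ ≤ #A → ∃ i ∈ A, CAcc κ x i A) (N : Set ι) :
    #(p '' Bad κ x p N) < κ := by
  by_contra hcon
  push Not at hcon
  obtain ⟨Y, hY1, hY2, hY3⟩ := (surjOn_image p (Bad κ x p N)).exists_subset_injOn_image_eq
  rw [← hY3] at hcon
  obtain ⟨i, hi, hacc⟩ := HL Y (hcon.trans Cardinal.mk_image_le)
  exact (hY1 hi).2 ⟨Y, fun j hj => (hY1 hj).1, hY2, hacc⟩

lemma step (hreg : κ.IsRegular) (hI : ∀ i : ι, #(Iio i) < κ)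
    (HL : ∀ A : Set ι, κ ≤ #A → ∃ i ∈ A, CAcc κ x i A) (hIic : ∀ i : ι, #(Iic i) < κ)
    (T : Set ι) (hT : ∀ j ∈ T, CAcc κ x j (T ∩ p ⁻¹' {p j}))
    (T' : Set ι) (hT' : T' = {j | j ∈ T ∧ p j ∉ p '' Bad κ x p T})
    (D' : Set ι) (hD' : ∀ i, #(D' ∩ p ⁻¹' {i} : Set ι) < κ) :
    ∃ D : Set ι, (∀ i, #(D ∩ p ⁻¹' {i} : Set ι) < κ) ∧ D ⊆ T' ∧ Disjoint D D' ∧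
      ∀ t ∈ T', ∀ U : Set X, IsOpen U → x t ∈ U → ∃ k ∈ D, x k ∈ U := by
  classical
  set N := T' \ D' with hN
  set E := {j | j ∈ N ∧ p j ∉ p '' Bad κ x p N} with hE
  have hY : ∀ j ∈ E, ∃ Y ⊆ N, InjOn p Y ∧ CAcc κ x j Y := by
    intro j hj
    by_contra hc
    exact hj.2 ⟨j, ⟨hj.1, hc⟩, rfl⟩
  choose! Y hY1 hY2 hY3 using hY
  refine ⟨⋃ j ∈ E, {k | k ∈ Y j ∧ j < p k}, ?_, ?_, ?_, ?_⟩
  · intro i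
    refine sm_mono (t := ⋃ j ∈ Iio i ∩ E, (Y j ∩ p ⁻¹' {i})) ?_ (sm_biUnion hreg
      (sm_mono inter_subset_left (hI i)) ?_)
    · rintro k ⟨hk, hki⟩
      simp only [mem_iUnion, mem_preimage, mem_singleton_iff] at hk hki ⊢
      obtain ⟨j, hj, hk1, hk2⟩ := hk
      exact ⟨j, ⟨hki ▸ hk2, hj⟩, hk1, hki⟩
    · rintro j ⟨-, hj⟩
      have : (Y j ∩ p ⁻¹' {i}).Subsingleton := by
        rintro a ⟨ha, ha'⟩ b ⟨hb, hb'⟩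
        exact hY2 j hj ha hb (ha'.trans hb'.symm)
      exact (Cardinal.mk_le_one_iff_set_subsingleton.2 this).trans_lt
        (Cardinal.one_lt_aleph0.trans_le hreg.aleph0_le)
  · refine iUnion₂_subset fun j hj k hk => (hY1 j hj hk.1).1
  · rw [Set.disjoint_left]
    intro k hk
    simp only [mem_iUnion] at hk
    obtain ⟨j, hj, hk1, hk2⟩ := hk
    exact (hY1 j hj hk1).2
  · intro t ht U hU htU
    have htt := ht
    rw [hT'] at htt
    have : ∃ Y ⊆ T, InjOn p Y ∧ CAcc κ x t Y := by
      by_contra hc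
      exact htt.2 ⟨t, ⟨htt.1, hc⟩, rfl⟩
    obtain ⟨Z, hZT, hZp, hZ⟩ := this
    have h1 := hZ U hU htU
    rw [← Cardinal.mk_image_eq_of_injOn (f := p) _ (hZp.mono fun j hj => hj.1)] at h1
    obtain ⟨_, ⟨k, ⟨hkZ, hkU⟩, rfl⟩, hk⟩ := exists_out h1
      (sm_union hreg (bad_small (p := p) HL T) (bad_small (p := p) HL N))
    have h2 := hT k (hZT hkZ) U hU hkU
    obtain ⟨l, ⟨⟨hlT, hlp⟩, hlU⟩, hlD⟩ := exists_out h2 (hD' (p k))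
    have hlp' : p l = p k := hlp
    have hlE : l ∈ E := by
      refine ⟨⟨?_, fun hd => hlD ⟨hd, hlp⟩⟩, ?_⟩
      · rw [hT']
        exact ⟨hlT, by rw [hlp']; exact fun hb => hk (Or.inl hb)⟩
      · rw [hlp']; exact fun hb => hk (Or.inr hb)
    have h3 := hY3 l hlE U hU hlU
    rw [← Cardinal.mk_image_eq_of_injOn (f := p) _ ((hY2 l hlE).mono fun j hj => hj.1)] at h3
    obtain ⟨_, ⟨k', ⟨hk1, hk2⟩, rfl⟩, hk3⟩ := exists_out h3 (hIic l)
    exact ⟨k', mem_biUnion hlE ⟨hk1, not_le.1 hk3⟩, hk2⟩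

end two

lemma case2 {X : Type u} [TopologicalSpace X] (hreg : κ.IsRegular) (hι : #ι = κ)
    (hI : ∀ i : ι, #(Iio i) < κ) [Nonempty ι]
    (hs : ∀ D : Set X, DiscreteTopology ↥D → #D ≠ κ) (G : Set X) (Y : Set X) (hYG : Y ⊆ G)
    (H : ∀ S : Set X, S ⊆ Y → #S < κ → ¬ Y ⊆ closure S) :
    ∃ D : ι → Set X, (∀ a, D a ⊆ G) ∧
      Pairwise (Function.onFun Disjoint D) ∧ (∀ a b, D b ⊆ closure (D a)) ∧ ∃ a, (D a).Nonempty := by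
  obtain ⟨y, hy⟩ := sel (ι := ι) (β := Y) hI
    (fun S b => b.1 ∉ closure (Subtype.val '' S)) (by
      intro S hS
      have := H (Subtype.val '' S) (by rintro _ ⟨z, -, rfl⟩; exact z.2) (sm_image _ hS)
      rw [Set.not_subset] at this
      obtain ⟨b, hb, hb'⟩ := this
      exact ⟨⟨b, hb⟩, hb'⟩)
  set x : ι → X := fun a => (y a).1 with hxdef
  have hx : ∀ a, x a ∉ closure (x '' Iio a) := by
    intro a
    have := hy a
    rwa [image_image] at this
  have hxG : ∀ a, x a ∈ G := fun a => hYG (y a).2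
  have hinj := left_inj hx
  have HL := hl hreg hι hI hs x hx
  have hIic : ∀ i : ι, #(Iic i) < κ := by
    intro i
    rw [← Iio_union_right]
    refine sm_union hreg (hI i) ?_
    rw [Cardinal.mk_singleton]
    exact Cardinal.one_lt_aleph0.trans_le hreg.aleph0_le
  -- a function with large fibers
  obtain ⟨p, hp⟩ : ∃ p : ι → ι, ∀ i, κ ≤ #(p ⁻¹' {i}) := by
    have he : #(ι × ι) = #ι := by
      rw [Cardinal.mk_prod, Cardinal.lift_id, hι, Cardinal.mul_eq_self hreg.aleph0_le]
    obtain ⟨e⟩ := Cardinal.eq.1 he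
    refine ⟨fun j => (e.symm j).1, fun i => ?_⟩
    rw [← hι]
    refine Cardinal.mk_le_of_injective (f := fun j => ⟨e (i, j), by simp⟩) ?_
    intro a b hab
    simpa using hab
  set T : Set ι := {j | CAcc κ x j (p ⁻¹' {p j})} with hTdef
  have hTs : ∀ i, #(p ⁻¹' {i} \ T : Set ι) < κ := by
    intro i
    by_contra hc
    push Not at hc
    obtain ⟨j, hj, hacc⟩ := HL _ hc
    apply hj.2
    have hji : p j = i := hj.1
    change CAcc κ x j (p ⁻¹' {p j})
    rw [hji]
    exact hacc.mono diff_subset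
  have hT : ∀ j ∈ T, CAcc κ x j (T ∩ p ⁻¹' {p j}) := by
    intro j hj U hU hjU
    have h1 := big_diff hreg (hj U hU hjU) (hTs (p j))
    refine h1.trans (Cardinal.mk_le_mk_of_subset ?_)
    rintro k ⟨⟨hk1, hk2⟩, hk3⟩
    refine ⟨⟨?_, hk1⟩, hk2⟩
    by_contra hkT
    exact hk3 ⟨hk1, hkT⟩
  set T' : Set ι := {j | j ∈ T ∧ p j ∉ p '' Bad κ x p T} with hT'
  have hT'ne : T'.Nonempty := by
    obtain ⟨i, -, hi⟩ := exists_out (s := (univ : Set ι)) (by rw [Cardinal.mk_univ, hι])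
      (bad_small (p := p) HL T)
    obtain ⟨j, hj, hjT⟩ := exists_out (hp i) (hTs i)
    have hji : p j = i := hj
    refine ⟨j, ?_, by rwa [hji]⟩
    by_contra hc
    exact hjT ⟨hj, hc⟩
  obtain ⟨h, hh⟩ := sel (ι := ι) (β := {D : Set ι // ∀ i, #(D ∩ p ⁻¹' {i} : Set ι) < κ}) hI
    (fun S D => D.1 ⊆ T' ∧ (∀ D' ∈ S, Disjoint D.1 D'.1) ∧
      ∀ t ∈ T', ∀ U : Set X, IsOpen U → x t ∈ U → ∃ k ∈ D.1, x k ∈ U) (by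
      intro S hS
      obtain ⟨D, h1, h2, h3, h4⟩ := step hreg hI HL hIic T hT T' hT' (⋃ D ∈ S, D.1) (by
        intro i
        refine sm_mono (t := ⋃ D ∈ S, (D.1 ∩ p ⁻¹' {i})) ?_ (sm_biUnion hreg hS fun D _ => D.2 i)
        rintro k ⟨hk, hki⟩
        simp only [mem_iUnion] at hk ⊢
        obtain ⟨D, hD, hk⟩ := hk
        exact ⟨D, hD, hk, hki⟩)
      refine ⟨⟨D, h1⟩, h2, ?_, h4⟩
      intro D' hD'
      exact h3.mono_right (subset_biUnion_of_mem
        (u := fun D : {D : Set ι // ∀ i, #(D ∩ p ⁻¹' {i} : Set ι) < κ} => D.1) hD'))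
  refine ⟨fun a => x '' (h a).1, ?_, ?_, ?_, ?_⟩
  · rintro a _ ⟨j, -, rfl⟩
    exact hxG j
  · intro a b hab
    simp only [Function.onFun]
    rw [Set.disjoint_image_iff hinj]
    rcases lt_or_gt_of_ne hab with hl | hl
    · exact ((hh b).2.1 _ ⟨a, hl, rfl⟩).symm
    · exact (hh a).2.1 _ ⟨b, hl, rfl⟩
  · rintro a b _ ⟨j, hj, rfl⟩
    rw [mem_closure_iff]
    intro U hU hjU
    obtain ⟨k, hk, hkU⟩ := (hh a).2.2 j ((hh b).1 hj) U hU hjU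
    exact ⟨x k, hkU, k, hk, rfl⟩
  · obtain ⟨i⟩ := (inferInstance : Nonempty ι)
    obtain ⟨t, ht⟩ := hT'ne
    obtain ⟨k, hk, -⟩ := (hh i).2.2 t ht univ isOpen_univ (mem_univ _)
    exact ⟨i, x k, k, hk, rfl⟩

end Res

/-- If `κ` is regular uncountable, `X` has no discrete subspace of size `κ` and
every nonempty open set has size at least `κ`, then `X` is `κ`-resolvable. -/
theorem stmt7 {X : Type u} [TopologicalSpace X] (κ : Cardinal.{u})
    (hκ : ℵ₀ < κ) (hreg : κ.IsRegular)
    (hs : ∀ D : Set X, DiscreteTopology ↥D → #D ≠ κ)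
    (hΔ : ∀ G : Set X, IsOpen G → G.Nonempty → κ ≤ #G) :
    Resolvable X κ := by

  have hι : #κ.ord.ToType = κ := Cardinal.mk_ord_toType κ
  have hI : ∀ i : κ.ord.ToType, #(Iio i) < κ := fun i => Cardinal.mk_Iio_toType_ord_lt i
  have hne : Nonempty κ.ord.ToType := by
    rw [← Cardinal.mk_ne_zero_iff, hι]
    exact hreg.pos.ne'
  refine Res.glue hι ?_
  intro G hG hGne
  by_cases hc : ∀ E : Set X, #E < κ → ∃ S : Set X, S ⊆ G \ E ∧ #S < κ ∧ G \ E ⊆ closure S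
  · exact Res.case1 hreg hI hΔ G hG hGne hc
  · push Not at hc
    obtain ⟨E, -, hE⟩ := hc
    exact Res.case2 hreg hι hI hs G (G \ E) diff_subset hE
end

section
/- Every topological space X with countable spread (every discrete subspace is countable) and uncountable dispersion character Δ(X) > ω is maximally resolvable, i.e., Δ(X)-resolvable. -/
universe u

open Cardinal Set

namespace Spread

theorem exists_rec {K β : Type u} [LinearOrder K] [WellFoundedLT K] (T : Set β)
    (Q : K → Set β → β → Prop)
    (h : ∀ (k : K) (C : Set β), C ⊆ T → #C ≤ #(Iio k) → ∃ y ∈ T, Q k C y) :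
    ∃ f : K → β, ∀ k, f k ∈ T ∧ Q k (f '' Iio k) (f k) := by
  classical
  rcases isEmpty_or_nonempty K with hK | ⟨⟨k0⟩⟩
  · exact ⟨fun k => (hK.false k).elim, fun k => (hK.false k).elim⟩
  obtain ⟨y0, -, -⟩ := h k0 ∅ (by simp) (by simp)
  have : Nonempty β := ⟨y0⟩
  let F : (k : K) → ((j : K) → j < k → β) → β := fun k ih =>
    Classical.epsilon fun y => y ∈ T ∧ Q k {z | ∃ j, ∃ hj : j < k, ih j hj = z} y
  let f : K → β := WellFoundedLT.fix F
  have hf : ∀ k, f k = Classical.epsilon fun y => y ∈ T ∧ Q k (f '' Iio k) y := by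
    intro k
    have h1 : f k = F k (fun y _ => f y) := WellFoundedLT.fix_eq F k
    have h2 : {z | ∃ j, ∃ _ : j < k, f j = z} = f '' Iio k := by
      ext z; simp
    rw [h1]
    simp only [F]
    rw [h2]
  refine ⟨f, fun k => ?_⟩
  induction k using WellFoundedLT.induction with
  | ind k ih =>
    have hC : f '' Iio k ⊆ T := by
      rintro _ ⟨j, hj, rfl⟩; exact (ih j hj).1
    obtain ⟨y, hy, hy'⟩ := h k _ hC mk_image_le
    rw [hf k]
    exact Classical.epsilon_spec (p := fun y => y ∈ T ∧ Q k (f '' Iio k) y) ⟨y, hy, hy'⟩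

/-- Disjoint refinement. -/
theorem refine_disjoint {X J : Type u} {μ κ : Cardinal.{u}} (hκ : ℵ₀ ≤ κ) (hμ : κ < μ)
    (hJ : #J ≤ μ) (P : J → Set X → Prop)
    (h : ∀ j, ∀ S : Set X, #S < μ → ∃ A, P j A ∧ Disjoint A S ∧ #A ≤ κ) :
    ∃ A : J → Set X, (∀ j, P j (A j) ∧ #(A j) ≤ κ) ∧ Pairwise (Function.onFun Disjoint A) := by
  classical
  rcases isEmpty_or_nonempty J with hE | hN
  · exact ⟨fun _ => ∅, fun j => (hE.false j).elim, fun j => (hE.false j).elim⟩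
  have hinj : Nonempty (J ↪ μ.ord.ToType) := by
    rw [← Cardinal.le_def, mk_ord_toType]; exact hJ
  obtain ⟨e⟩ := hinj
  let s := Function.invFun e
  have hs : ∀ j, s (e j) = j := Function.leftInverse_invFun e.injective
  obtain ⟨f, hf⟩ := exists_rec (K := μ.ord.ToType) {A : Set X | #A ≤ κ}
    (fun k C y => P (s k) y ∧ Disjoint y (⋃₀ C)) (by
      intro k C hC hk
      have h1 : #(⋃₀ C) < μ := by
        refine lt_of_le_of_lt (mk_sUnion_le C) ?_
        refine mul_lt_of_lt (hκ.trans hμ.le) (hk.trans_lt (mk_Iio_toType_ord_lt k)) ?_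
        refine lt_of_le_of_lt ?_ hμ
        exact ciSup_le' fun A => hC A.2
      obtain ⟨A, hA, hd, hc⟩ := h (s k) _ h1
      exact ⟨A, hc, hA, hd⟩)
  have key : ∀ a b, a < b → Disjoint (f a) (f b) := by
    intro a b hab
    have := (hf b).2.2
    have h2 : f a ⊆ ⋃₀ (f '' Iio b) := subset_sUnion_of_mem ⟨a, hab, rfl⟩
    exact (this.mono_right h2).symm
  refine ⟨fun j => f (e j), fun j => ⟨by simpa [hs] using (hf (e j)).2.1, (hf (e j)).1⟩, ?_⟩
  intro i j hij
  have : e i ≠ e j := fun h => hij (e.injective h)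
  rcases lt_or_gt_of_ne this with h | h
  · exact key _ _ h
  · exact (key _ _ h).symm

abbrev W1 : Type u := (ℵ₁ : Cardinal.{u}).ord.ToType

theorem W1_Iio (a : W1.{u}) : (Iio a).Countable := by
  rw [← le_aleph0_iff_set_countable]
  have := (mk_Iio_toType_ord_lt a).trans_eq succ_aleph0.symm
  exact Order.lt_succ_iff.1 this

theorem W1_unc : ¬ (univ : Set W1.{u}).Countable := by
  rw [← le_aleph0_iff_set_countable, mk_univ, mk_ord_toType, not_le]
  exact aleph0_lt_aleph_one

section
variable {X : Type u} [TopologicalSpace X]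

theorem no_disc (hs : ∀ D : Set X, DiscreteTopology ↥D → D.Countable) (f : W1.{u} → X)
    (h1 : ∀ a, f a ∉ closure (f '' Iio a)) (h2 : ∀ a, f a ∉ closure (f '' Ioi a)) : False := by
  have hinj : Function.Injective f := by
    intro a b hab
    by_contra hne
    rcases lt_or_gt_of_ne hne with h | h
    · exact h1 b (hab ▸ subset_closure ⟨a, h, rfl⟩)
    · exact h1 a (hab ▸ subset_closure ⟨b, h, rfl⟩)
  have hd : DiscreteTopology (range f) := by
    rw [discreteTopology_subtype_iff']
    rintro _ ⟨a, rfl⟩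
    refine ⟨(closure (f '' Iio a))ᶜ ∩ (closure (f '' Ioi a))ᶜ,
      isClosed_closure.isOpen_compl.inter isClosed_closure.isOpen_compl, ?_⟩
    ext y
    constructor
    · rintro ⟨⟨hy1, hy2⟩, b, rfl⟩
      rcases lt_trichotomy b a with h | h | h
      · exact (hy1 (subset_closure ⟨b, h, rfl⟩)).elim
      · rw [h]; rfl
      · exact (hy2 (subset_closure ⟨b, h, rfl⟩)).elim
    · rintro rfl
      exact ⟨⟨h1 a, h2 a⟩, a, rfl⟩
  have := hs _ hd
  rw [← image_univ] at this
  exact W1_unc ((countable_of_injective_of_countable_image hinj.injOn this))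

/-- `Y` has a disjoint `ι`-indexed family of dense subsets. -/
def Rs (ι : Type u) (Y : Set X) : Prop :=
  ∃ D : ι → Set X, (∀ i, D i ⊆ Y ∧ Y ⊆ closure (D i)) ∧ Pairwise (Function.onFun Disjoint D)

theorem Rs.mono {ι κ : Type u} {Y : Set X} (h : Rs ι Y) (hc : #κ ≤ #ι) : Rs κ Y := by
  obtain ⟨D, hD, hd⟩ := h
  obtain ⟨e⟩ := hc
  exact ⟨fun k => D (e k), fun k => hD _, fun i j hij => hd fun h => hij (e.injective h)⟩

theorem Rs.dense {ι : Type u} {Y Z : Set X} (h : Rs ι Y) (h1 : Y ⊆ Z) (h2 : Z ⊆ closure Y) :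
    Rs ι Z := by
  obtain ⟨D, hD, hd⟩ := h
  exact ⟨D, fun i => ⟨(hD i).1.trans h1, h2.trans (closure_minimal (hD i).2 isClosed_closure)⟩, hd⟩

theorem Rs.open_inter {ι : Type u} {Y V : Set X} (h : Rs ι Y) (hV : IsOpen V) :
    Rs ι (V ∩ Y) := by
  obtain ⟨D, hD, hd⟩ := h
  refine ⟨fun i => V ∩ D i, fun i => ⟨inter_subset_inter_right _ (hD i).1, ?_⟩, ?_⟩
  · exact (inter_subset_inter_right _ (hD i).2).trans hV.inter_closure
  · intro i j hij
    exact (hd hij).mono inter_subset_right inter_subset_right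

theorem Rs.union {ι A : Type u} {Y : A → Set X} (h : ∀ a, Rs ι (Y a))
    (hY : Pairwise (Function.onFun Disjoint Y)) : Rs ι (⋃ a, Y a) := by
  choose D hD hd using h
  refine ⟨fun i => ⋃ a, D a i, fun i => ⟨iUnion_mono fun a => (hD a i).1, ?_⟩, ?_⟩
  · exact iUnion_subset fun a => ((hD a i).2).trans (closure_mono (subset_iUnion (fun a => D a i) a))
  · intro i j hij
    simp only [Function.onFun, disjoint_iUnion_left, disjoint_iUnion_right]
    intro a b
    by_cases hab : a = b
    · subst hab; exact hd _ hij
    · exact (hY fun h => hab h.symm).mono (hD _ _).1 (hD _ _).1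

theorem patch (C : Set X → Prop)
    (h1 : ∀ (A : Type u) (Y : A → Set X), (∀ a, C (Y a)) →
      Pairwise (Function.onFun Disjoint Y) → C (⋃ a, Y a))
    (h2 : ∀ Y Z, C Y → Y ⊆ Z → Z ⊆ closure Y → C Z) (Y : Set X)
    (h3 : ∀ V, IsOpen V → (V ∩ Y).Nonempty → ∃ Z ⊆ V ∩ Y, Z.Nonempty ∧ C Z) : C Y := by
  obtain ⟨M, hM⟩ := zorn_subset {S : Set (Set X) | S.PairwiseDisjoint id ∧
      ∀ Z ∈ S, Z ⊆ Y ∧ C Z} (by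
    intro c hc hch
    refine ⟨⋃₀ c, ⟨?_, ?_⟩, fun s hs => subset_sUnion_of_mem hs⟩
    · exact (pairwiseDisjoint_sUnion hch.directedOn).2 fun s hs => (hc hs).1
    · rintro Z ⟨s, hs, hZ⟩
      exact (hc hs).2 Z hZ)
  have hMp := hM.prop
  have hU : C (⋃ a : M, (a : Set X)) := h1 M (fun a => a) (fun a => (hMp.2 a a.2).2) (by
    intro a b hab
    exact hMp.1 a.2 b.2 (fun h => hab (Subtype.ext h)))
  refine h2 _ Y hU (iUnion_subset fun a => (hMp.2 a a.2).1) ?_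
  intro y hy
  by_contra hcl
  obtain ⟨Z, hZs, hZn, hZ⟩ := h3 (closure (⋃ a : M, (a : Set X)))ᶜ
    isClosed_closure.isOpen_compl ⟨y, hcl, hy⟩
  have hdisj : ∀ B ∈ M, Disjoint Z B := by
    intro B hB
    rw [Set.disjoint_left]
    intro z hz hzB
    exact (hZs hz).1 (subset_closure (mem_iUnion.2 ⟨⟨B, hB⟩, hzB⟩))
  have hmem : insert Z M ∈ {S : Set (Set X) | S.PairwiseDisjoint id ∧
      ∀ Z ∈ S, Z ⊆ Y ∧ C Z} := by
    refine ⟨hMp.1.insert fun B hB _ => hdisj B hB, ?_⟩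
    rintro B (rfl | hB)
    · exact ⟨fun z hz => (hZs hz).2, hZ⟩
    · exact hMp.2 B hB
  have hZM : Z ∈ M := hM.le_of_ge hmem (subset_insert _ _) (mem_insert _ _)
  have := hdisj Z hZM
  rw [disjoint_self] at this
  exact hZn.ne_empty this

theorem Rs.patch {ι : Type u} (Y : Set X)
    (h3 : ∀ V, IsOpen V → (V ∩ Y).Nonempty → ∃ Z ⊆ V ∩ Y, Z.Nonempty ∧ Rs ι Z) : Rs ι Y :=
  Spread.patch (Rs ι) (fun _ _ h hd => Rs.union h hd) (fun _ _ h a b => h.dense a b) Y h3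

/-- countable sums of smaller cardinals stay small -/
def Cfw (μ : Cardinal.{u}) : Prop :=
  ∀ c : ℕ → Cardinal.{u}, (∀ n, c n < μ) → Cardinal.sum c < μ

theorem Cfw.biUnion {μ : Cardinal.{u}} (h : Cfw μ) (h0 : 0 < μ) {X : Type u} {C : Set X}
    (hC : C.Countable) (S : X → Set X) (hS : ∀ x ∈ C, #(S x) < μ) : #(⋃ x ∈ C, S x) < μ := by
  rcases C.eq_empty_or_nonempty with rfl | hne
  · simpa using h0
  obtain ⟨f, rfl⟩ := hC.exists_eq_range hne
  rw [biUnion_range]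
  have := mk_iUnion_le_sum_mk_lift (f := fun n : ℕ => S (f n))
  simp only [lift_id', lift_uzero] at this
  exact this.trans_lt (h _ fun n => hS _ ⟨n, rfl⟩)

theorem method1 (hs : ∀ D : Set X, DiscreteTopology ↥D → D.Countable) {μ : Cardinal.{u}}
    (hμ : ℵ₁ < μ) (hcf : Cfw μ) (hΔ : ∀ G : Set X, IsOpen G → G.Nonempty → μ ≤ #G)
    (ι : Type u) (hι : #ι = μ) (G : Set X) (hG : IsOpen G) (hGn : G.Nonempty) :
    ∃ Z ⊆ G, Z.Nonempty ∧ Rs ι Z := by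
  classical
  have hμ0 : ℵ₀ < μ := aleph0_lt_aleph_one.trans hμ
  let E : Set X := {x | ∃ S : Set X, #S < μ ∧ ∀ A : Set X, #A ≤ ℵ₁ → Disjoint A S → x ∉ closure A}
  by_cases hcase : ∃ G' ⊆ G, IsOpen G' ∧ G'.Nonempty ∧ #(E ∩ G' : Set X) < μ
  · obtain ⟨G', hG'G, hG', hG'n, hE⟩ := hcase
    let B : Set X := G' \ E
    have hgood : ∀ x ∈ B, ∀ S : Set X, #S < μ →
        ∃ A : Set X, (A ⊆ B ∧ x ∈ closure A) ∧ Disjoint A S ∧ #A ≤ ℵ₁ := by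
      intro x hx S hS
      have hx2 := hx.2
      simp only [E, mem_setOf_eq, not_exists, not_and, not_forall, not_not] at hx2
      obtain ⟨A, hA, hd, hcl⟩ := hx2 (S ∪ (E ∩ G'))
        ((mk_union_le _ _).trans_lt (add_lt_of_lt hμ0.le hS hE))
      refine ⟨G' ∩ A, ⟨?_, ?_⟩, ?_, (mk_le_mk_of_subset inter_subset_right).trans hA⟩
      · rintro y ⟨hy1, hy2⟩
        exact ⟨hy1, fun hyE => Set.disjoint_left.1 hd hy2 (Or.inr ⟨hyE, hy1⟩)⟩
      · exact hG'.inter_closure ⟨hx.1, hcl⟩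
      · exact hd.mono inter_subset_right subset_union_left
    have hBn : B.Nonempty := by
      by_contra hne
      rw [not_nonempty_iff_eq_empty, diff_eq_empty] at hne
      have : E ∩ G' = G' := inter_eq_right.2 hne
      rw [this] at hE
      exact absurd (hΔ G' hG' hG'n) (not_le.2 hE)
    have hfam : ∀ x : X, ∃ A : ι → Set X, x ∈ B →
        (∀ j, (A j ⊆ B ∧ x ∈ closure (A j)) ∧ #(A j) ≤ ℵ₁) ∧
        Pairwise (Function.onFun Disjoint A) := by
      intro x
      by_cases hx : x ∈ B
      · obtain ⟨A, hA⟩ := refine_disjoint (J := ι) aleph0_lt_aleph_one.le hμ hι.le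
          (fun _ A => A ⊆ B ∧ x ∈ closure A) (fun _ S hS => hgood x hx S hS)
        exact ⟨A, fun _ => hA⟩
      · exact ⟨fun _ => ∅, fun h => (hx h).elim⟩
    choose A hA using hfam
    obtain ⟨x0, hx0⟩ := hBn
    let step : Set X → Set X := fun Z => Z ∪ ⋃ x ∈ Z, ⋃ j, A x j
    let Zn : ℕ → Set X := fun n => step^[n] {x0}
    have hZs : ∀ n, Zn (n + 1) = step (Zn n) := fun n => Function.iterate_succ_apply' _ _ _
    have hZB : ∀ n, Zn n ⊆ B ∧ #(Zn n) ≤ μ := by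
      intro n
      induction n with
      | zero => exact ⟨by simpa [Zn] using hx0, by simpa [Zn] using hμ0.le.trans' one_le_aleph0⟩
      | succ n ih =>
        rw [hZs]
        refine ⟨union_subset ih.1 (iUnion₂_subset fun x hx => iUnion_subset fun j =>
          ((hA x (ih.1 hx)).1 j).1.1), ?_⟩
        refine (mk_union_le _ _).trans (add_le_of_le hμ0.le ih.2 ?_)
        refine (mk_biUnion_le _ _).trans (mul_le_of_le hμ0.le ih.2 ?_)
        refine ciSup_le' fun x => (mk_iUnion_le _).trans (mul_le_of_le hμ0.le hι.le ?_)
        exact ciSup_le' fun j => (((hA x (ih.1 x.2)).1 j).2).trans hμ.le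
    let Z : Set X := ⋃ n, Zn n
    have hZB' : Z ⊆ B := iUnion_subset fun n => (hZB n).1
    have hZc : #Z ≤ μ := by
      have := mk_iUnion_le_sum_mk_lift (f := Zn)
      simp only [lift_id', lift_uzero] at this
      refine this.trans ((sum_le_sum _ (fun _ => μ) fun n => (hZB n).2).trans ?_)
      rw [sum_const]
      simpa using (mul_le_of_le hμ0.le hμ0.le le_rfl)
    have hZA : ∀ x ∈ Z, ∀ j, A x j ⊆ Z := by
      intro x hx j y hy
      obtain ⟨n, hn⟩ := mem_iUnion.1 hx
      refine mem_iUnion.2 ⟨n + 1, ?_⟩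
      rw [hZs]
      exact Or.inr (mem_iUnion₂.2 ⟨x, hn, mem_iUnion.2 ⟨j, hy⟩⟩)
    obtain ⟨D, hD, hDd⟩ := refine_disjoint (J := Z × ι) aleph0_lt_aleph_one.le hμ
      (by rw [mk_prod, lift_id, lift_id]; exact mul_le_of_le hμ0.le hZc hι.le)
      (fun p A => A ⊆ Z ∧ (p.1 : X) ∈ closure A) (by
        rintro ⟨⟨x, hx⟩, i⟩ S hS
        by_contra hcon
        have hxB := hA x (hZB' hx)
        have : ∀ j, ∃ y, y ∈ A x j ∧ y ∈ S := by
          intro j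
          by_contra hno
          push Not at hno
          exact hcon ⟨A x j, ⟨hZA x hx j, (hxB.1 j).1.2⟩, Set.disjoint_left.2 hno, (hxB.1 j).2⟩
        choose g hg1 hg2 using this
        have hginj : Function.Injective (fun j => (⟨g j, hg2 j⟩ : S)) := by
          intro a b hab
          by_contra hne
          have hab' : g a = g b := congrArg Subtype.val hab
          exact Set.disjoint_left.1 (hxB.2 hne) (hg1 a) (hab' ▸ hg1 b)
        have := mk_le_of_injective hginj
        rw [hι] at this
        exact absurd this (not_le.2 hS))
    refine ⟨Z, hZB'.trans (diff_subset.trans hG'G), ⟨x0, mem_iUnion.2 ⟨0, rfl⟩⟩,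
      fun i => ⋃ z : Z, D (z, i), fun i => ⟨iUnion_subset fun z => (hD (z, i)).1.1, ?_⟩, ?_⟩
    · intro x hx
      exact closure_mono (subset_iUnion (fun z : Z => D (z, i)) ⟨x, hx⟩) (hD (⟨x, hx⟩, i)).1.2
    · intro i j hij
      simp only [Function.onFun, disjoint_iUnion_left, disjoint_iUnion_right]
      intro a b
      exact hDd fun h => hij (congrArg Prod.snd h)
  · push Not at hcase
    have hbad : ∀ x : X, ∃ S : Set X, x ∈ E → #S < μ ∧ ∀ A : Set X, #A ≤ ℵ₁ → Disjoint A S →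
        x ∉ closure A := by
      intro x
      by_cases hx : x ∈ E
      · obtain ⟨S, hS⟩ := hx
        exact ⟨S, fun _ => hS⟩
      · exact ⟨∅, fun h => (hx h).elim⟩
    choose S hS using hbad
    let Y : Set X := E ∩ G
    have hYn : Y.Nonempty := by
      have := hcase G subset_rfl hG hGn
      rw [nonempty_iff_ne_empty]
      intro h0
      rw [show E ∩ G = ∅ from h0] at this
      simp at this
      rw [this] at hμ0
      exact absurd hμ0 (by simp)
    refine ⟨Y, inter_subset_right, hYn, ?_⟩
    obtain ⟨D, hD, hDd⟩ := refine_disjoint (J := ι) le_rfl hμ0 hι.le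
      (fun _ A => A ⊆ Y ∧ Y ⊆ closure A) (by
        intro _ S0 hS0
        by_contra hcon
        have hcon' : ∀ C : Set X, C ⊆ Y \ S0 → C.Countable → ∃ y ∈ Y, y ∉ closure C := by
          intro C hC hCc
          by_contra hno
          push Not at hno
          exact hcon ⟨C, ⟨hC.trans diff_subset, hno⟩,
            Set.disjoint_left.2 fun y hy => (hC hy).2, le_aleph0_iff_set_countable.2 hCc⟩
        obtain ⟨f, hf⟩ := exists_rec (K := W1.{u}) (Y \ S0)
          (fun _ C x => x ∉ closure C ∧ x ∉ ⋃ c ∈ C, S c) (by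
            intro k C hC hk
            have hCc : C.Countable := by
              rw [← le_aleph0_iff_set_countable]
              exact hk.trans (le_aleph0_iff_set_countable.2 (W1_Iio k))
            obtain ⟨y, hy, hycl⟩ := hcon' C hC hCc
            have h1 := hcase (G ∩ (closure C)ᶜ) inter_subset_left
              (hG.inter isClosed_closure.isOpen_compl) ⟨y, hy.2, hycl⟩
            have h2 : #(S0 ∪ ⋃ c ∈ C, S c : Set X) < μ :=
              (mk_union_le _ _).trans_lt (add_lt_of_lt hμ0.le hS0
                (hcf.biUnion (aleph0_pos.trans hμ0) hCc S fun x hx => (hS x (hC hx).1.1).1))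
            have h3 : ¬ (E ∩ (G ∩ (closure C)ᶜ) ⊆ S0 ∪ ⋃ c ∈ C, S c) := fun hsub =>
              absurd (h1.trans (mk_le_mk_of_subset hsub)) (not_le.2 h2)
            obtain ⟨x, hx1, hx2⟩ := not_subset.1 h3
            exact ⟨x, ⟨⟨hx1.1, hx1.2.1⟩, fun h => hx2 (Or.inl h)⟩, hx1.2.2,
              fun h => hx2 (Or.inr h)⟩)
        refine no_disc hs f (fun a => (hf a).2.1) fun a => ?_
        refine (hS (f a) (hf a).1.1.1).2 _ ?_ ?_
        · refine mk_image_le.trans ((mk_set_le _).trans ?_)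
          rw [mk_ord_toType]
        · rw [Set.disjoint_left]
          rintro _ ⟨b, hb, rfl⟩ hmem
          exact (hf b).2.2 (mem_iUnion₂.2 ⟨f a, ⟨a, hb, rfl⟩, hmem⟩))
    exact ⟨D, fun i => (hD i).1, hDd⟩

theorem W1_bdd {S : Set W1.{u}} (hS : S.Countable) : ∃ γ, ∀ a ∈ S, a ≤ γ := by
  by_contra h
  push Not at h
  refine W1_unc ((hS.biUnion fun a _ => W1_Iio a).mono fun γ _ => ?_)
  obtain ⟨a, ha, hlt⟩ := h γ
  exact mem_iUnion₂.2 ⟨a, ha, hlt⟩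

theorem W1_Iic (a : W1.{u}) : (Iic a).Countable := by
  rw [← Iio_insert]
  exact (W1_Iio a).insert a

theorem almost_disjoint : ∃ A : (Order.succ (ℵ₁ : Cardinal.{u})).ord.ToType → Set W1.{u},
    (∀ i, ¬ (A i).Countable) ∧ ∀ i j, i ≠ j → (A i ∩ A j).Countable := by
  classical
  obtain ⟨h, hh⟩ := exists_rec (K := (Order.succ (ℵ₁ : Cardinal.{u})).ord.ToType)
    (univ : Set (W1.{u} → W1.{u}))
    (fun _ C y => ∀ g ∈ C, {a | g a = y a}.Countable) (by
      intro k C _ hk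
      have h1 : #C ≤ #W1.{u} := by
        rw [mk_ord_toType]
        exact Order.lt_succ_iff.1 (hk.trans_lt (mk_Iio_toType_ord_lt k))
      obtain ⟨e⟩ := h1
      have : ∀ a : W1.{u}, ∃ b, b ∉ (fun g : C => g.1 a) '' (e ⁻¹' (Iio a)) := by
        intro a
        by_contra hno
        push Not at hno
        refine W1_unc (Countable.mono (fun b _ => hno b) (Countable.image ?_ _))
        exact (W1_Iio a).preimage e.injective
      choose y hy using this
      refine ⟨y, mem_univ _, fun g hg => (W1_Iic (e ⟨g, hg⟩)).mono ?_⟩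
      intro a ha
      by_contra hlt
      have hlt' : e ⟨g, hg⟩ < a := not_le.1 hlt
      exact hy a ⟨⟨g, hg⟩, hlt', ha⟩)
  have hφ : Nonempty (W1.{u} × W1.{u} ≃ W1.{u}) := by
    rw [← Cardinal.eq, mk_prod, lift_id, mk_ord_toType]
    exact mul_eq_self aleph0_lt_aleph_one.le
  obtain ⟨φ⟩ := hφ
  have hinj : ∀ i, Function.Injective (fun a => φ (a, h i a)) := by
    intro i a b hab
    exact congrArg Prod.fst (φ.injective hab)
  have key : ∀ i j, i < j → (range (fun a => φ (a, h i a)) ∩ range (fun a => φ (a, h j a))).Countable := by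
    intro i j hij
    have := (hh j).2 (h i) ⟨i, hij, rfl⟩
    refine (this.image (fun a => φ (a, h i a))).mono ?_
    rintro _ ⟨⟨a, rfl⟩, ⟨b, hb⟩⟩
    have hb' := φ.injective hb
    simp only [Prod.mk.injEq] at hb'
    obtain ⟨rfl, h2⟩ := hb'
    exact ⟨b, h2.symm, rfl⟩
  refine ⟨fun i => range (fun a => φ (a, h i a)), fun i hc => ?_, fun i j hij => ?_⟩
  · simp only [← image_univ] at hc
    exact W1_unc (countable_of_injective_of_countable_image (hinj i).injOn hc)
  · rcases lt_or_gt_of_ne hij with h | h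
    · exact key i j h
    · rw [inter_comm]; exact key j i h

theorem star_large (hs : ∀ D : Set X, DiscreteTopology ↥D → D.Countable) (f : W1.{u} → X)
    (h1 : ∀ a, f a ∉ closure (f '' Iio a)) (A : Set W1.{u}) :
    (A \ {a | ∀ γ, f a ∈ closure (f '' (A ∩ Ioi γ))}).Countable := by
  by_contra hB
  set B := A \ {a | ∀ γ, f a ∈ closure (f '' (A ∩ Ioi γ))} with hBdef
  have : ∀ a, ∃ γ, a ∈ B → f a ∉ closure (f '' (A ∩ Ioi γ)) := by
    intro a
    by_cases ha : a ∈ B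
    · have := ha.2
      simp only [mem_setOf_eq, not_forall] at this
      obtain ⟨γ, hγ⟩ := this
      exact ⟨γ, fun _ => hγ⟩
    · exact ⟨a, fun h => (ha h).elim⟩
  choose γ hγ using this
  obtain ⟨g, hg⟩ := exists_rec (K := W1.{u}) B (fun _ C y => ∀ c ∈ C, c < y ∧ γ c < y) (by
    intro k C hC hk
    have hCc : C.Countable := by
      rw [← le_aleph0_iff_set_countable]
      exact hk.trans (le_aleph0_iff_set_countable.2 (W1_Iio k))
    obtain ⟨d, hd⟩ := W1_bdd (hCc.union (hCc.image γ))
    have : ¬ B ⊆ Iic d := fun h => hB ((W1_Iic d).mono h)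
    obtain ⟨y, hy, hyd⟩ := not_subset.1 this
    have hyd : d < y := not_le.1 hyd
    exact ⟨y, hy, fun c hc => ⟨(hd c (Or.inl hc)).trans_lt hyd,
      (hd _ (Or.inr ⟨c, hc, rfl⟩)).trans_lt hyd⟩⟩)
  refine no_disc hs (fun a => f (g a)) (fun a hcl => ?_) (fun a hcl => ?_)
  · refine h1 (g a) (closure_mono ?_ hcl)
    rintro _ ⟨b, hb, rfl⟩
    exact ⟨g b, ((hg a).2 _ ⟨b, hb, rfl⟩).1, rfl⟩
  · refine hγ (g a) (hg a).1 (closure_mono ?_ hcl)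
    rintro _ ⟨b, hb, rfl⟩
    exact ⟨g b, ⟨(hg b).1.1, ((hg b).2 _ ⟨a, hb, rfl⟩).2⟩, rfl⟩

theorem method2 (hs : ∀ D : Set X, DiscreteTopology ↥D → D.Countable)
    (hΔ : ∀ G : Set X, IsOpen G → G.Nonempty → ℵ₁ ≤ #G)
    (G : Set X) (hG : IsOpen G) (hGn : G.Nonempty) :
    ∃ Z ⊆ G, Z.Nonempty ∧ Rs W1.{u} Z := by
  classical
  by_cases hcase : ∀ S : Set X, #S < ℵ₁ → ∃ C, (C ⊆ G ∧ G ⊆ closure C) ∧ Disjoint C S ∧ #C ≤ ℵ₀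
  · obtain ⟨D, hD, hDd⟩ := refine_disjoint (J := W1.{u}) le_rfl aleph0_lt_aleph_one
      (mk_ord_toType _).le (fun _ A => A ⊆ G ∧ G ⊆ closure A) (fun _ S hS => hcase S hS)
    exact ⟨G, subset_rfl, hGn, D, fun i => (hD i).1, hDd⟩
  push Not at hcase
  obtain ⟨S, hS, hno⟩ := hcase
  obtain ⟨f, hf⟩ := exists_rec (K := W1.{u}) (G \ S) (fun _ C y => y ∉ closure C) (by
    intro k C hC hk
    have hCc : #C ≤ ℵ₀ := hk.trans (le_aleph0_iff_set_countable.2 (W1_Iio k))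
    have h1 : ¬ G ⊆ closure C := fun h => absurd hCc (not_le.2 (hno C
      ⟨hC.trans diff_subset, h⟩ (Set.disjoint_left.2 fun y hy => (hC hy).2)))
    obtain ⟨y, hy, hycl⟩ := not_subset.1 h1
    have h2 := hΔ (G ∩ (closure C)ᶜ) (hG.inter isClosed_closure.isOpen_compl) ⟨y, hy, hycl⟩
    have h3 : ¬ (G ∩ (closure C)ᶜ ⊆ S) := fun h =>
      absurd (h2.trans (mk_le_mk_of_subset h)) (not_le.2 hS)
    obtain ⟨x, hx, hxS⟩ := not_subset.1 h3
    exact ⟨x, ⟨hx.1, hxS⟩, hx.2⟩)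
  have hleft : ∀ a, f a ∉ closure (f '' Iio a) := fun a => (hf a).2
  have hinj : Function.Injective f := by
    intro a b hab
    by_contra hne
    rcases lt_or_gt_of_ne hne with h | h
    · exact hleft b (hab ▸ subset_closure ⟨a, h, rfl⟩)
    · exact hleft a (hab ▸ subset_closure ⟨b, h, rfl⟩)
  obtain ⟨A, hAu, hAd⟩ := almost_disjoint.{u}
  let st : (Order.succ (ℵ₁ : Cardinal.{u})).ord.ToType → Set W1.{u} :=
    fun i => {a | ∀ γ, f a ∈ closure (f '' (A i ∩ Ioi γ))}
  have hst : ∀ i, (A i \ st i).Countable := fun i => star_large hs f hleft (A i)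
  let I : W1.{u} → Set (Order.succ (ℵ₁ : Cardinal.{u})).ord.ToType := fun α => {i | α ∈ st i}
  let Z0 : Set W1.{u} := {α | ℵ₁ < #(I α)}
  let K0 : Set (Order.succ (ℵ₁ : Cardinal.{u})).ord.ToType := {i | st i ⊆ Z0}
  have hK0 : #(K0ᶜ : Set _) ≤ ℵ₁ := by
    have hsub : K0ᶜ ⊆ ⋃ α : (Z0ᶜ : Set W1.{u}), I α := by
      intro i hi
      obtain ⟨α, hα, hαZ⟩ := not_subset.1 hi
      exact mem_iUnion.2 ⟨⟨α, hαZ⟩, hα⟩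
    refine (mk_le_mk_of_subset hsub).trans ((mk_iUnion_le _).trans
      (mul_le_of_le aleph0_lt_aleph_one.le ?_ ?_))
    · exact (mk_set_le _).trans (mk_ord_toType _).le
    · exact ciSup_le' fun α => not_lt.1 α.2
  have hK0n : K0.Nonempty := by
    by_contra hne
    rw [not_nonempty_iff_eq_empty] at hne
    rw [hne, compl_empty, mk_univ, mk_ord_toType] at hK0
    exact absurd hK0 (not_le.2 (Order.lt_succ _))
  have hZ0n : Z0.Nonempty := by
    obtain ⟨i, hi⟩ := hK0n
    have : ¬ A i ⊆ A i \ st i := fun h => hAu i ((hst i).mono h)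
    obtain ⟨a, ha, ha'⟩ := not_subset.1 this
    refine ⟨a, hi ?_⟩
    by_contra h
    exact ha' ⟨ha, h⟩
  have hemb : Nonempty ((Z0 × W1.{u}) ↪ W1.{u}) := by
    rw [← Cardinal.le_def, mk_prod, lift_id, lift_id]
    refine mul_le_of_le ?_ (mk_set_le _) le_rfl
    rw [mk_ord_toType]; exact aleph0_lt_aleph_one.le
  obtain ⟨e⟩ := hemb
  have : Nonempty W1.{u} := ⟨hZ0n.some⟩
  have : Nonempty Z0 := hZ0n.to_subtype
  let s := Function.invFun e
  have hse : ∀ p, s (e p) = p := Function.leftInverse_invFun e.injective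
  obtain ⟨ix, hix⟩ := exists_rec (K := W1.{u}) K0
    (fun j C y => ((s j).1 : W1.{u}) ∈ st y ∧ y ∉ C) (by
      intro j C hC hk
      have hCc : #C ≤ ℵ₁ := (hk.trans (le_aleph0_iff_set_countable.2 (W1_Iio j))).trans
        aleph0_lt_aleph_one.le
      have h1 : ¬ I (s j).1 ⊆ K0ᶜ ∪ C := by
        intro h
        have h2 : ℵ₁ < #(I (s j).1) := (s j).1.2
        refine absurd ((mk_le_mk_of_subset h).trans ((mk_union_le _ _).trans
          (add_le_of_le aleph0_lt_aleph_one.le hK0 hCc))) (not_le.2 h2)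
      obtain ⟨y, hy, hy'⟩ := not_subset.1 h1
      exact ⟨y, by_contra fun h => hy' (Or.inl h), hy, fun h => hy' (Or.inr h)⟩)
  let A' : W1.{u} → Set W1.{u} := fun j =>
    (A (ix j) ∩ st (ix j)) \ ⋃ j' ∈ Iio j, A (ix j')
  have hA'cl : ∀ j, f (s j).1 ∈ closure (f '' A' j) := by
    intro j
    have hc : (A (ix j) \ A' j).Countable := by
      refine ((hst (ix j)).union ((W1_Iio j).biUnion (t := fun j' _ => A (ix j) ∩ A (ix j'))
        fun j' hj' => ?_)).mono ?_
      · refine hAd _ _ fun h => (hix j).2.2 ⟨j', hj', h.symm⟩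
      · rintro a ⟨ha, ha'⟩
        by_cases h1 : a ∈ st (ix j)
        · right
          have h2 : a ∈ ⋃ j' ∈ Iio j, A (ix j') := by_contra fun h => ha' ⟨⟨ha, h1⟩, h⟩
          obtain ⟨j', hj', h3⟩ := mem_iUnion₂.1 h2
          exact mem_iUnion₂.2 ⟨j', hj', ha, h3⟩
        · exact Or.inl ⟨ha, h1⟩
    obtain ⟨γ, hγ⟩ := W1_bdd hc
    refine closure_mono (image_mono ?_) ((hix j).2.1 γ)
    rintro a ⟨ha, hag⟩
    by_contra hn
    exact absurd (hγ a ⟨ha, hn⟩) (not_le.2 hag)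
  have hA'd : ∀ i j, i < j → Disjoint (A' i) (A' j) := by
    intro i j hij
    rw [Set.disjoint_left]
    intro a ha hb
    exact hb.2 (mem_iUnion₂.2 ⟨i, hij, ha.1.1⟩)
  have hA'd' : ∀ i j, i ≠ j → Disjoint (A' i) (A' j) := by
    intro i j hij
    rcases lt_or_gt_of_ne hij with h | h
    · exact hA'd i j h
    · exact (hA'd j i h).symm
  refine ⟨f '' Z0, ?_, hZ0n.image f, fun k => ⋃ j ∈ {j | (s j).2 = k}, f '' A' j, ?_, ?_⟩
  · rintro _ ⟨a, -, rfl⟩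
    exact (hf a).1.1
  · intro k
    constructor
    · refine iUnion₂_subset fun j _ => image_mono ?_
      intro a ha
      exact (hix j).1 ha.1.2
    · rintro _ ⟨α, hα, rfl⟩
      have h1 := hA'cl (e (⟨α, hα⟩, k))
      rw [hse] at h1
      refine closure_mono ?_ h1
      exact subset_iUnion₂_of_subset (e (⟨α, hα⟩, k)) (by simp [hse]) subset_rfl
  · intro k l hkl
    simp only [Function.onFun, disjoint_iUnion_left, disjoint_iUnion_right]
    intro i hi j hj
    refine (disjoint_image_iff hinj).2 (hA'd' _ _ ?_)
    rintro rfl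
    exact hkl (Eq.trans (Eq.symm hj) hi)

theorem Rs.split {ι : Type u} [Infinite ι] {Y A : Set X} (h : Rs ι Y) (hA : A ⊆ Y) :
    (∃ Y' ⊆ Y \ A, Y'.Nonempty ∧ Rs ι Y') ∨ (Rs ι A ∧ Y ⊆ closure A) := by
  obtain ⟨D, hD, hd⟩ := h
  have hφ : Nonempty (ι × ι ≃ ι) := by
    rw [← Cardinal.eq, mk_prod, lift_id]
    exact mul_eq_self (aleph0_le_mk ι)
  obtain ⟨φ⟩ := hφ
  by_cases hc : ∀ k, Y ⊆ closure (⋃ j, D (φ (k, j)) ∩ A)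
  · right
    have h1 : ∀ k, (⋃ j, D (φ (k, j)) ∩ A) ⊆ A := fun k => iUnion_subset fun j => inter_subset_right
    refine ⟨⟨fun k => ⋃ j, D (φ (k, j)) ∩ A, fun k => ⟨h1 k, hA.trans (hc k)⟩, ?_⟩, ?_⟩
    · intro k l hkl
      simp only [Function.onFun, disjoint_iUnion_left, disjoint_iUnion_right]
      intro i j
      refine (hd ?_).mono inter_subset_left inter_subset_left
      intro h
      exact hkl (congrArg Prod.fst (φ.injective h))
    · obtain ⟨k⟩ : Nonempty ι := inferInstance
      exact (hc k).trans (closure_mono (h1 k))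
  · left
    push Not at hc
    obtain ⟨k, hk⟩ := hc
    obtain ⟨y, hy, hycl⟩ := not_subset.1 hk
    set V := (closure (⋃ j, D (φ (k, j)) ∩ A))ᶜ with hV
    have hVo : IsOpen V := isClosed_closure.isOpen_compl
    have hsub : ∀ j, V ∩ D (φ (k, j)) ⊆ ⋃ j, V ∩ D (φ (k, j)) :=
      fun j => subset_iUnion (fun j => V ∩ D (φ (k, j))) j
    have hVY : (⋃ j, V ∩ D (φ (k, j))) ⊆ V ∩ Y :=
      iUnion_subset fun j => inter_subset_inter_right _ (hD _).1
    have hcl : ∀ j, V ∩ Y ⊆ closure (V ∩ D (φ (k, j))) := fun j =>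
      (inter_subset_inter_right _ (hD _).2).trans hVo.inter_closure
    refine ⟨⋃ j, V ∩ D (φ (k, j)), ?_, ?_, fun j => V ∩ D (φ (k, j)),
      fun j => ⟨hsub j, hVY.trans (hcl j)⟩, ?_⟩
    · refine iUnion_subset fun j x hx => ⟨(hD _).1 hx.2, fun hxA => hx.1 ?_⟩
      exact subset_closure (mem_iUnion.2 ⟨j, hx.2, hxA⟩)
    · obtain ⟨j⟩ : Nonempty ι := inferInstance
      have : (V ∩ D (φ (k, j))).Nonempty := closure_nonempty_iff.1 ⟨y, hcl j ⟨hycl, hy⟩⟩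
      exact this.mono (hsub j)
    · intro i j hij
      refine (hd ?_).mono inter_subset_right inter_subset_right
      intro h
      exact hij (congrArg Prod.snd (φ.injective h))

theorem br_step (ι : ℕ → Type u) [∀ n, Infinite (ι n)]
    (hm : ∀ m n, m ≤ n → #(ι m) ≤ #(ι n)) (m : ℕ) (Y : Set X) (hY : ∀ n, Rs (ι n) Y) :
    ∃ A B : Set X, A ⊆ Y ∧ B ⊆ Y ∧ Disjoint A B ∧ Y ⊆ closure A ∧ Y ⊆ closure B ∧
      Rs (ι m) A ∧ ∀ n, Rs (ι n) B := by
  refine patch (X := X) (fun Y => ∃ A B : Set X, A ⊆ Y ∧ B ⊆ Y ∧ Disjoint A B ∧ Y ⊆ closure A ∧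
    Y ⊆ closure B ∧ Rs (ι m) A ∧ ∀ n, Rs (ι n) B) ?_ ?_ Y ?_
  · intro J W hW hd
    choose A B hA hB hAB hAc hBc hAr hBr using hW
    refine ⟨⋃ a, A a, ⋃ a, B a, iUnion_mono hA, iUnion_mono hB, ?_,
      iUnion_subset fun a => (hAc a).trans (closure_mono (subset_iUnion A a)),
      iUnion_subset fun a => (hBc a).trans (closure_mono (subset_iUnion B a)),
      Rs.union hAr fun a b hab => (hd hab).mono (hA a) (hA b),
      fun n => Rs.union (fun a => hBr a n) fun a b hab => (hd hab).mono (hB a) (hB b)⟩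
    simp only [disjoint_iUnion_left, disjoint_iUnion_right]
    intro a b
    by_cases hab : a = b
    · subst hab; exact hAB _
    · first
        | exact (hd hab).mono (hA _) (hB _)
        | exact (hd (Ne.symm hab)).mono (hA _) (hB _)
  · rintro W Z ⟨A, B, hA, hB, hAB, hAc, hBc, hAr, hBr⟩ h1 h2
    exact ⟨A, B, hA.trans h1, hB.trans h1, hAB,
      h2.trans (closure_minimal hAc isClosed_closure),
      h2.trans (closure_minimal hBc isClosed_closure), hAr, hBr⟩
  intro V hV hVn
  have hY1 : ∀ n, Rs (ι n) (V ∩ Y) := fun n => (hY n).open_inter hV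
  set Y1 := V ∩ Y with hY1def
  -- halve
  obtain ⟨D, hD, hd⟩ := hY1 m
  have hφ : Nonempty (ι m ⊕ ι m ≃ ι m) := by
    rw [← Cardinal.eq, mk_sum, lift_id]
    exact add_eq_self (aleph0_le_mk _)
  obtain ⟨φ⟩ := hφ
  let A0 : Set X := ⋃ i, D (φ (Sum.inl i))
  let B1 : Set X := ⋃ i, D (φ (Sum.inr i))
  have hA0 : A0 ⊆ Y1 := iUnion_subset fun i => (hD _).1
  have hB1 : B1 ⊆ Y1 \ A0 := by
    refine iUnion_subset fun i x hx => ⟨(hD _).1 hx, fun hx2 => ?_⟩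
    obtain ⟨j, hj⟩ := mem_iUnion.1 hx2
    refine Set.disjoint_left.1 (hd ?_) hx hj
    intro h
    have := φ.injective h
    simp at this
  have i0 : ι m := Classical.arbitrary _
  have hA0r : Rs (ι m) A0 := ⟨fun i => D (φ (Sum.inl i)), fun i =>
    ⟨subset_iUnion (fun i => D (φ (Sum.inl i))) i, hA0.trans (hD _).2⟩, fun i j hij => hd fun h =>
      hij (Sum.inl.inj (φ.injective h))⟩
  have hA0c : Y1 ⊆ closure A0 := (hD (φ (Sum.inl i0))).2.trans
    (closure_mono (subset_iUnion (fun i => D (φ (Sum.inl i))) i0))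
  have hB1c : Y1 ⊆ closure B1 := (hD (φ (Sum.inr i0))).2.trans
    (closure_mono (subset_iUnion (fun i => D (φ (Sum.inr i))) i0))
  have hB1r : Rs (ι m) B1 := ⟨fun i => D (φ (Sum.inr i)), fun i =>
    ⟨subset_iUnion (fun i => D (φ (Sum.inr i))) i, (hB1.trans diff_subset).trans (hD _).2⟩,
      fun i j hij => hd fun h => hij (Sum.inr.inj (φ.injective h))⟩
  by_cases hc : ∀ n V', IsOpen V' → (V' ∩ A0).Nonempty → ∃ Z ⊆ V' ∩ A0, Z.Nonempty ∧ Rs (ι n) Z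
  · exact ⟨Y1, subset_rfl, hVn, B1, A0, hB1.trans diff_subset, hA0,
      Set.disjoint_left.2 fun x hx hx2 => (hB1 hx).2 hx2, hB1c, hA0c, hB1r,
      fun n => Rs.patch A0 (hc n)⟩
  push Not at hc
  obtain ⟨n, V', hV', hVA, hbad⟩ := hc
  have hcl : ∀ C : Set X, Y1 ⊆ closure C → V' ∩ Y1 ⊆ closure (V' ∩ C) := fun C h =>
    (inter_subset_inter_right _ h).trans hV'.inter_closure
  refine ⟨V' ∩ Y1, inter_subset_right, hVA.mono (inter_subset_inter_right _ hA0),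
    V' ∩ A0, V' ∩ (Y1 \ A0), inter_subset_inter_right _ hA0,
    inter_subset_inter_right _ diff_subset, ?_, hcl _ hA0c,
    hcl _ (hB1c.trans (closure_mono hB1)), hA0r.open_inter hV', fun k => ?_⟩
  · exact Set.disjoint_left.2 fun x hx hx2 => hx2.2.2 hx.2
  · have hkn : Rs (ι (max k n)) (V' ∩ (Y1 \ A0)) := by
      rcases ((hY1 (max k n)).open_inter hV').split
        (inter_subset_inter_right V' (diff_subset (s := Y1) (t := A0))) with h | h
      · obtain ⟨Z, hZ, hZn, hZr⟩ := h
        refine absurd (hZr.mono (hm _ _ (le_max_right k n))) (hbad Z ?_ hZn)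
        intro x hx
        have := hZ hx
        exact ⟨this.1.1, by_contra fun h => this.2 ⟨this.1.1, this.1.2, h⟩⟩
      · exact h.1
    exact hkn.mono (hm _ _ (le_max_left k n))

theorem br (ι : ℕ → Type u) [∀ n, Infinite (ι n)]
    (hm : ∀ m n, m ≤ n → #(ι m) ≤ #(ι n)) (Y : Set X) (hY : ∀ n, Rs (ι n) Y) :
    Rs (Σ n, ι n) Y := by
  choose A B hA hB hAB hAc hBc hAr hBr using
    fun (m : ℕ) (Z : {Z : Set X // ∀ n, Rs (ι n) Z}) => br_step ι hm m Z.1 Z.2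
  let Bn : ℕ → {Z : Set X // ∀ n, Rs (ι n) Z} := fun n =>
    Nat.rec ⟨Y, hY⟩ (fun k Z => ⟨B k Z, hBr k Z⟩) n
  have hBs : ∀ n, (Bn (n + 1)).1 = B n (Bn n) := fun n => rfl
  have hanti : Antitone fun n => (Bn n).1 := antitone_nat_of_succ_le fun n => by
    rw [hBs]; exact hB n (Bn n)
  have hBY : ∀ n, (Bn n).1 ⊆ Y := fun n => hanti (Nat.zero_le n)
  have hBd : ∀ n, Y ⊆ closure (Bn n).1 := by
    intro n
    induction n with
    | zero => exact subset_closure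
    | succ n ih =>
      rw [hBs]
      exact ih.trans (closure_minimal (hBc n (Bn n)) isClosed_closure)
  have hdis : ∀ i j, i < j → Disjoint (A i (Bn i)) (A j (Bn j)) := by
    intro i j hij
    refine (hAB i (Bn i)).mono_right ((hA j (Bn j)).trans ?_)
    rw [← hBs]
    exact hanti hij
  choose D hD hd using fun n => hAr n (Bn n)
  refine ⟨fun p => D p.1 p.2, fun p => ⟨(hD _ _).1.trans ((hA _ _).trans (hBY _)), ?_⟩, ?_⟩
  · exact (hBd p.1).trans (closure_minimal ((hAc p.1 (Bn p.1)).trans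
      (closure_minimal (hD p.1 p.2).2 isClosed_closure)) isClosed_closure)
  · rintro ⟨n, i⟩ ⟨k, j⟩ hne
    rcases lt_trichotomy n k with h | h | h
    · exact (hdis _ _ h).mono (hD _ _).1 (hD _ _).1
    · subst h
      exact hd n fun h => hne (congrArg (Sigma.mk n) h)
    · exact ((hdis _ _ h).mono (hD _ _).1 (hD _ _).1).symm

theorem Cfw_succ {ν : Cardinal.{u}} (hν : ℵ₀ ≤ ν) : Cfw (Order.succ ν) := by
  intro c hc
  rw [Order.lt_succ_iff]
  refine (sum_le_sum c (fun _ => ν) fun n => Order.lt_succ_iff.1 (hc n)).trans ?_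
  rw [sum_const]
  simpa using mul_le_of_le hν hν le_rfl

theorem main (hs : ∀ D : Set X, DiscreteTopology ↥D → D.Countable) {κ : Cardinal.{u}}
    (hκ : ℵ₀ < κ) (hΔ : ∀ G : Set X, IsOpen G → G.Nonempty → κ ≤ #G) :
    ∃ ι : Type u, #ι = κ ∧ Rs ι (univ : Set X) := by
  have hκ1 : ℵ₁ ≤ κ := by rw [← succ_aleph0]; exact Order.succ_le_of_lt hκ
  rcases hκ1.eq_or_lt with h | h
  · subst h
    refine ⟨W1.{u}, mk_ord_toType _, Rs.patch _ fun V hV hVn => ?_⟩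
    rw [inter_univ] at hVn ⊢
    exact method2 hs hΔ V hV hVn
  refine ⟨κ.out, mk_out κ, ?_⟩
  have key : ∀ μ, μ ≤ κ → ℵ₁ < μ → Cfw μ → Rs μ.out (univ : Set X) := by
    intro μ h1 h2 h3
    refine Rs.patch _ fun V hV hVn => ?_
    rw [inter_univ] at hVn ⊢
    exact method1 hs h2 h3 (fun G hG hGn => h1.trans (hΔ G hG hGn)) _ (mk_out μ) V hV hVn
  by_cases hcf : Cfw κ
  · exact key κ le_rfl h hcf
  simp only [Cfw, not_forall, not_lt] at hcf
  obtain ⟨c, hc, hsum⟩ := hcf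
  let d : ℕ → Cardinal.{u} := fun n => Nat.rec (max ℵ₁ (c 0)) (fun k x => max x (c (k + 1))) n
  have hds : ∀ n, d (n + 1) = max (d n) (c (n + 1)) := fun n => rfl
  have hdm : Monotone d := monotone_nat_of_le_succ fun n => by rw [hds]; exact le_max_left _ _
  have hd1 : ∀ n, ℵ₁ ≤ d n := fun n => (le_max_left _ _).trans (hdm (Nat.zero_le n))
  have hdc : ∀ n, c n ≤ d n := by
    rintro (_ | n)
    · exact le_max_right _ _
    · exact le_max_right _ _
  have hdκ : ∀ n, d n < κ := by
    intro n
    induction n with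
    | zero => exact max_lt h (hc 0)
    | succ n ih => rw [hds]; exact max_lt ih (hc _)
  let ι : ℕ → Type u := fun n => (Order.succ (d n)).out
  have hι : ∀ n, #(ι n) = Order.succ (d n) := fun n => mk_out _
  have : ∀ n, Infinite (ι n) := fun n => by
    rw [infinite_iff, hι]
    exact (aleph0_lt_aleph_one.le.trans (hd1 n)).trans (Order.le_succ _)
  have := br ι (fun m n hmn => by rw [hι, hι]; exact Order.succ_le_succ (hdm hmn)) (univ : Set X)
    (fun n => key _ (Order.succ_le_of_lt (hdκ n)) ((hd1 n).trans_lt (Order.lt_succ _))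
      (Cfw_succ (aleph0_lt_aleph_one.le.trans (hd1 n))))
  refine this.mono ?_
  rw [mk_out, mk_sigma]
  refine hsum.trans (sum_le_sum _ _ fun n => ?_)
  rw [hι]
  exact (hdc n).trans (Order.le_succ _)

end

end Spread

/-- A space of countable spread and uncountable dispersion character is
maximally resolvable. -/
theorem stmt8 {X : Type u} [TopologicalSpace X]
    (hs : ∀ D : Set X, DiscreteTopology ↥D → D.Countable)
    (hΔ : ℵ₀ < dispersion X) :
    Resolvable X (dispersion X) := by
  obtain ⟨ι, hι, D, hD, hd⟩ := Spread.main hs hΔ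
    (fun G hG hGn => csInf_le' ⟨G, hG, hGn, rfl⟩)
  exact ⟨ι, D, hι, fun i x => (hD i).2 (mem_univ x), hd⟩
end

section
/- Let λ be a singular cardinal of countable cofinality. If a topological space X is μ-resolvable for every cardinal μ < λ, then X is λ-resolvable. -/
universe u

open Cardinal Set

/-- `S` contains `ι` many pairwise disjoint sets dense in `U`. -/
def Res {X : Type u} [TopologicalSpace X] (S U : Set X) (ι : Type u) : Prop :=
  ∃ D : ι → Set X, (∀ i, D i ⊆ S) ∧
    (∀ i, ∀ V : Set X, IsOpen V → V.Nonempty → V ⊆ U → (V ∩ D i).Nonempty) ∧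
    ∀ i j x, x ∈ D i → x ∈ D j → i = j

/-- almost `lam`-resolvable -/
def ARes {X : Type u} [TopologicalSpace X] (lam : Cardinal.{u}) (S U : Set X) : Prop :=
  ∀ ι : Type u, #ι < lam → Res S U ι

section
variable {X : Type u} [TopologicalSpace X]

theorem Res.mono {S T U V : Set X} {ι κ : Type u} (h : Res S U ι) (hS : S ∩ V ⊆ T)
    (hV : V ⊆ U) (hc : #κ ≤ #ι) : Res T V κ := by
  obtain ⟨D, h1, h2, h3⟩ := h
  obtain ⟨f⟩ := hc
  refine ⟨fun k => D (f k) ∩ V, fun k x hx => hS ⟨h1 _ hx.1, hx.2⟩, ?_, ?_⟩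
  · intro k W hW hne hWV
    obtain ⟨x, hx, hx'⟩ := h2 (f k) W hW hne (hWV.trans hV)
    exact ⟨x, hx, hx', hWV hx⟩
  · intro i j x hi hj
    exact f.injective (h3 _ _ x hi.1 hj.1)

theorem Res.glue_s10 {S W : Set X} {ι : Type u}
    (h : ∀ U : Set X, IsOpen U → U.Nonempty → U ⊆ W →
      ∃ V : Set X, IsOpen V ∧ V.Nonempty ∧ V ⊆ U ∧ Res S V ι) : Res S W ι := by
  classical
  let G := {V : Set X // IsOpen V ∧ Res S V ι}
  have hG : ∀ v : G, Res S v.1 ι := fun v => v.2.2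
  choose D h1 h2 h3 using hG
  let r : G → G → Prop := WellOrderingRel
  refine ⟨fun i => {x | ∃ v : G, x ∈ v.1 ∧ (∀ w : G, r w v → x ∉ w.1) ∧ x ∈ D v i}, ?_, ?_, ?_⟩
  · rintro i x ⟨v, -, -, hx⟩
    exact h1 _ _ hx
  · intro i U hU hne hUW
    obtain ⟨V, hV, hVne, hVU, hR⟩ := h U hU hne hUW
    have hwf : WellFounded r := IsWellFounded.wf
    obtain ⟨v, hv, hmin⟩ := hwf.has_min {v : G | (v.1 ∩ U).Nonempty}
      ⟨⟨V, hV, hR⟩, by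
        obtain ⟨x, hx⟩ := hVne
        exact ⟨x, hx, hVU hx⟩⟩
    obtain ⟨x, hx, hxD⟩ := h2 v i (v.1 ∩ U) (v.2.1.inter hU) hv inter_subset_left
    exact ⟨x, hx.2, v, hx.1, fun w hw hxw => hmin w ⟨x, hxw, hx.2⟩ hw, hxD⟩
  · rintro i j x ⟨v, hv, hv', hi⟩ ⟨w, hw, hw', hj⟩
    have : v = w := by
      rcases trichotomous_of r v w with h | h | h
      · exact absurd hv (hw' v h)
      · exact h
      · exact absurd hw (hv' w h)
    subst this
    exact h3 _ _ _ _ hi hj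

theorem Res.split {S A B U : Set X} {ι : Type u} (hι : ℵ₀ ≤ #ι) (hS : S ⊆ A ∪ B)
    (h : Res S U ι) :
    (∃ V : Set X, IsOpen V ∧ V.Nonempty ∧ V ⊆ U ∧ Res A V ι) ∨ Res B U ι := by
  have h' : Res S U (ι × ι) := h.mono inter_subset_left subset_rfl (by
    simp [Cardinal.mul_eq_self hι])
  obtain ⟨D, h1, h2, h3⟩ := h'
  by_cases hc : ∃ i, ∃ V : Set X, IsOpen V ∧ V.Nonempty ∧ V ⊆ U ∧
      ∀ j, ∀ W : Set X, IsOpen W → W.Nonempty → W ⊆ V → (W ∩ (D (i, j) ∩ A)).Nonempty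
  · left
    obtain ⟨i, V, hV, hne, hVU, hD⟩ := hc
    refine ⟨V, hV, hne, hVU, fun j => D (i, j) ∩ A, fun j => inter_subset_right, hD, ?_⟩
    intro j k x hj hk
    exact congrArg Prod.snd (h3 _ _ x hj.1 hk.1)
  · right
    push Not at hc
    refine ⟨fun i => (⋃ j, D (i, j)) ∩ B, fun i => inter_subset_right, ?_, ?_⟩
    · intro i V hV hne hVU
      obtain ⟨j, W, hW, hWne, hWV, hemp⟩ := hc i V hV hne hVU
      obtain ⟨x, hxW, hxD⟩ := h2 (i, j) W hW hWne (hWV.trans hVU)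
      refine ⟨x, hWV hxW, mem_iUnion.2 ⟨j, hxD⟩, ?_⟩
      rcases hS (h1 _ hxD) with ha | hb
      · exact absurd (show x ∈ W ∩ (D (i, j) ∩ A) from ⟨hxW, hxD, ha⟩) (by rw [hemp]; simp)
      · exact hb
    · rintro i k x ⟨hi, -⟩ ⟨hk, -⟩
      obtain ⟨j, hj⟩ := mem_iUnion.1 hi
      obtain ⟨l, hl⟩ := mem_iUnion.1 hk
      exact congrArg Prod.fst (h3 _ _ x hj hl)

theorem ARes.mono {lam : Cardinal.{u}} {S T U V : Set X} (h : ARes lam S U) (hS : S ∩ V ⊆ T)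
    (hV : V ⊆ U) : ARes lam T V :=
  fun ι hι => (h ι hι).mono hS hV le_rfl

theorem ARes.split {lam : Cardinal.{u}} (hlam : ℵ₀ < lam) {S A B W : Set X} (hW : IsOpen W)
    (hne : W.Nonempty) (hS : S ⊆ A ∪ B) (h : ARes lam S W) :
    ∃ V : Set X, IsOpen V ∧ V.Nonempty ∧ V ⊆ W ∧ (ARes lam A V ∨ ARes lam B V) := by
  by_cases hA : ARes lam A W
  · exact ⟨W, hW, hne, subset_rfl, Or.inl hA⟩
  · unfold ARes at hA
    push Not at hA
    obtain ⟨ν, hν, hR⟩ := hA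
    have : ¬ ∀ U : Set X, IsOpen U → U.Nonempty → U ⊆ W →
      ∃ V : Set X, IsOpen V ∧ V.Nonempty ∧ V ⊆ U ∧ Res A V ν := fun h => hR (Res.glue_s10 h)
    push Not at this
    obtain ⟨U, hU, hUne, hUW, hUV⟩ := this
    refine ⟨U, hU, hUne, hUW, Or.inr ?_⟩
    intro ι hι
    let κ : Type u := (max ℵ₀ (max #ι #ν)).out
    have hκ : #κ = max ℵ₀ (max #ι #ν) := Cardinal.mk_out _
    have hκl : #κ < lam := by rw [hκ]; exact max_lt hlam (max_lt hι hν)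
    have h0 : ℵ₀ ≤ #κ := by rw [hκ]; exact le_max_left _ _
    have h1 : #ι ≤ #κ := by rw [hκ]; exact (le_max_left _ _).trans (le_max_right _ _)
    have h2 : #ν ≤ #κ := by rw [hκ]; exact (le_max_right _ _).trans (le_max_right _ _)
    rcases Res.split h0 hS ((h κ hκl).mono inter_subset_left hUW le_rfl) with
      ⟨V, hV, hVne, hVU, hr⟩ | hr
    · exact absurd (hr.mono inter_subset_left subset_rfl h2) (hUV V hV hVne hVU)
    · exact hr.mono inter_subset_left subset_rfl h1

theorem ARes.step {lam : Cardinal.{u}} (hlam : ℵ₀ < lam) {S : Set X}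
    (h : ARes lam S univ) (μ : Type u) (hμ : #μ < lam) :
    ∃ A B : Set X, A ⊆ S ∧ B ⊆ S ∧ Disjoint A B ∧ Res A univ μ ∧ ARes lam B univ := by
  have hsum : #(μ ⊕ μ) < lam := by
    simp only [mk_sum, lift_id]
    exact Cardinal.add_lt_of_lt hlam.le hμ hμ
  obtain ⟨D, h1, h2, h3⟩ := h (μ ⊕ μ) hsum
  let A0 : Set X := ⋃ i, D (Sum.inl i)
  let A1 : Set X := S \ A0
  have hA0S : A0 ⊆ S := iUnion_subset fun i => h1 _
  have hR0 : Res A0 univ μ :=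
    ⟨fun i => D (Sum.inl i), fun i => subset_iUnion (fun i => D (Sum.inl i)) i,
      fun i => h2 _, fun i j x hi hj => Sum.inl_injective (h3 _ _ x hi hj)⟩
  have hR1 : Res A1 univ μ := by
    refine ⟨fun i => D (Sum.inr i), fun i x hx => ⟨h1 _ hx, fun hx0 => ?_⟩,
      fun i => h2 _, fun i j x hi hj => Sum.inr_injective (h3 _ _ x hi hj)⟩
    obtain ⟨j, hj⟩ := mem_iUnion.1 hx0
    exact absurd (h3 _ _ x hx hj) (by simp)
  let O : Set X := ⋃₀ {V | IsOpen V ∧ ARes lam A0 V}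
  have hO : IsOpen O := isOpen_sUnion fun V hV => hV.1
  have hd : ∀ U : Set X, IsOpen U → ¬ (U ∩ O).Nonempty → ∀ x ∈ U, x ∉ closure O := by
    intro U hU hn x hx hxc
    exact hn (mem_closure_iff.1 hxc U hU hx)
  refine ⟨(A1 ∩ O) ∪ (A0 \ closure O), (A0 ∩ O) ∪ (A1 \ closure O), ?_, ?_, ?_, ?_, ?_⟩
  · rintro x (hx | hx)
    · exact hx.1.1
    · exact hA0S hx.1
  · rintro x (hx | hx)
    · exact hA0S hx.1
    · exact hx.1.1
  · rw [Set.disjoint_left]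
    rintro x (hx | hx) (hy | hy)
    · exact hx.1.2 hy.1
    · exact hy.2 (subset_closure hx.2)
    · exact hx.2 (subset_closure hy.2)
    · exact hy.1.2 hx.1
  · apply Res.glue_s10
    intro U hU hne _
    by_cases hc : (U ∩ O).Nonempty
    · exact ⟨U ∩ O, hU.inter hO, hc, inter_subset_left,
        hR1.mono (fun x hx => Or.inl ⟨hx.1, hx.2.2⟩) (subset_univ _) le_rfl⟩
    · exact ⟨U, hU, hne, subset_rfl,
        hR0.mono (fun x hx => Or.inr ⟨hx.1, hd U hU hc x hx.2⟩) (subset_univ _) le_rfl⟩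
  · intro ι hι
    apply Res.glue_s10
    intro U hU hne _
    by_cases hc : (U ∩ O).Nonempty
    · obtain ⟨x, hxU, V, ⟨hV, hVA⟩, hxV⟩ := hc
      refine ⟨U ∩ V, hU.inter hV, ⟨x, hxU, hxV⟩, inter_subset_left, 
        (hVA ι hι).mono (fun y hy => Or.inl ⟨hy.1, V, ⟨hV, hVA⟩, hy.2.2⟩) inter_subset_right le_rfl⟩
    · obtain ⟨V, hV, hVne, hVU, hh | hh⟩ := ARes.split hlam (A := A0) (B := A1) hU hne
        (fun x hx => by by_cases hx0 : x ∈ A0; exacts [Or.inl hx0, Or.inr ⟨hx, hx0⟩])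
        (h.mono (V := U) inter_subset_left (subset_univ _))
      · obtain ⟨x, hx⟩ := hVne
        exact absurd ⟨x, hVU hx, V, ⟨hV, hh⟩, hx⟩ hc
      · exact ⟨V, hV, hVne, hVU, (hh ι hι).mono
          (fun y hy => Or.inr ⟨hy.1, hd U hU hc y (hVU hy.2)⟩) subset_rfl le_rfl⟩

theorem exists_seq (lam : Cardinal.{u}) (hlam : ℵ₀ < lam) (hcof : lam.ord.cof = ℵ₀) :
    ∃ μ : ℕ → Type u, (∀ n, #(μ n) < lam) ∧ lam ≤ #(Σ n : ULift.{u} ℕ, μ n.down) := by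
  obtain ⟨ι, f, hf, hι⟩ := Ordinal.exists_lsub_cof lam.ord
  rw [hcof] at hι
  have he : Nonempty (ULift.{u} ℕ ≃ ι) := Cardinal.eq.1 (by rw [hι]; simp)
  obtain ⟨e⟩ := he
  have hlt : ∀ i, (f i).card < lam := fun i => by
    rw [← Cardinal.lt_ord, ← hf]
    exact Ordinal.lt_lsub f i
  refine ⟨fun n => (f (e ⟨n⟩)).card.out, fun n => by simpa using hlt _, ?_⟩
  by_contra hcon
  push Not at hcon
  set c := #(Σ n : ULift.{u} ℕ, (f (e ⟨n.down⟩)).card.out) with hc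
  have hle : ∀ i, (f i).card ≤ c := by
    intro i
    rw [← Cardinal.mk_out (f i).card, ← e.apply_symm_apply i]
    exact Cardinal.mk_le_of_injective (f := fun x => (⟨e.symm i, x⟩ :
      Σ n : ULift.{u} ℕ, (f (e ⟨n.down⟩)).card.out)) (fun x y hxy => eq_of_heq (Sigma.mk.inj hxy).2)
  have hsucc : Order.succ c < lam := by
    refine lt_of_le_of_ne (Order.succ_le_of_lt hcon) fun heq => ?_
    have hc0 : ℵ₀ ≤ c := by
      by_contra hn
      push Not at hn
      have : Order.succ c ≤ ℵ₀ := Order.succ_le_of_lt hn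
      rw [heq] at this
      exact absurd hlam this.not_gt
    have hreg := (Cardinal.isRegular_succ hc0).cof_ord
    rw [heq, hcof] at hreg
    exact hlam.ne hreg
  have := Cardinal.ord_lt_ord.2 hsucc
  rw [← hf, Ordinal.lt_lsub_iff] at this
  obtain ⟨i, hi⟩ := this
  have h1 := Cardinal.ord_le.1 hi
  exact absurd (Order.lt_succ c) (h1.trans (hle i)).not_gt

end

/-- Bhaskara Rao: if `cf(λ) = ω` (with `λ` singular, hence uncountable) and `X` is
`μ`-resolvable for all `μ < λ`, then `X` is `λ`-resolvable. -/
theorem stmt10 {X : Type u} [TopologicalSpace X] (lam : Cardinal.{u})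
    (hlam : ℵ₀ < lam) (hcof : lam.ord.cof = ℵ₀)
    (h : ∀ μ < lam, Resolvable X μ) :
    Resolvable X lam := by
  obtain ⟨μ, hμ, hsum⟩ := exists_seq lam hlam hcof
  have h0 : ARes lam (univ : Set X) univ := by
    intro ι hι
    obtain ⟨κ, D, hκ, h1, h2⟩ := h _ hι
    have : Res (univ : Set X) univ κ := by
      refine ⟨D, fun i => subset_univ _, fun i V hV hne _ => (h1 i).inter_open_nonempty V hV hne, ?_⟩
      intro i j x hi hj
      by_contra hij
      exact Set.disjoint_left.1 (h2 hij) hi hj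
    exact this.mono inter_subset_left subset_rfl hκ.ge
  let T := {S : Set X // ARes lam S univ}
  have hstep : ∀ (n : ℕ) (S : T), ∃ (A : Set X) (B : T), A ⊆ S.1 ∧ B.1 ⊆ S.1 ∧ Disjoint A B.1 ∧
      Res A univ (μ n) := by
    intro n S
    obtain ⟨A, B, h1, h2, h3, h4, h5⟩ := ARes.step hlam S.2 (μ n) (hμ n)
    exact ⟨A, ⟨B, h5⟩, h1, h2, h3, h4⟩
  choose A B hA hB hAB hR using hstep
  let s : ℕ → T := fun n => Nat.rec ⟨univ, h0⟩ (fun n S => B n S) n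
  have hs : ∀ n, s (n + 1) = B n (s n) := fun n => rfl
  have hanti : Antitone fun n => (s n).1 := antitone_nat_of_succ_le fun n => by
    rw [hs]; exact hB _ _
  have hdis : ∀ m n, m < n → ∀ x, x ∈ A m (s m) → x ∉ A n (s n) := by
    intro m n hmn x hx hx'
    have : x ∈ (s (m + 1)).1 := hanti (Nat.succ_le_of_lt hmn) (hA _ _ hx')
    rw [hs] at this
    exact Set.disjoint_left.1 (hAB m (s m)) hx this
  have hR' : ∀ n, Res (A n (s n)) univ (μ n) := fun n => hR n (s n)
  choose D h1 h2 h3 using hR'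
  have hfin : Res (univ : Set X) univ (Σ n : ULift.{u} ℕ, μ n.down) := by
    refine ⟨fun p => D p.1.down p.2, fun _ => subset_univ _, fun p => h2 _ _, ?_⟩
    rintro ⟨⟨m⟩, i⟩ ⟨⟨n⟩, j⟩ x hi hj
    have hi' := h1 _ _ hi
    have hj' := h1 _ _ hj
    rcases lt_trichotomy m n with hlt | rfl | hlt
    · exact absurd hj' (hdis _ _ hlt _ hi')
    · have hij : i = j := h3 m i j x hi hj
      rw [hij]
    · exact absurd hi' (hdis _ _ hlt _ hj')
  obtain ⟨E, -, e2, e3⟩ := hfin.mono (κ := lam.out) inter_subset_left subset_rfl (by simpa using hsum)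
  refine ⟨lam.out, E, mk_out _, fun i => ?_, fun i j hij => ?_⟩
  · rw [dense_iff_inter_open]
    exact fun U hU hne => e2 i U hU hne (subset_univ _)
  · exact Set.disjoint_left.2 fun x hi hj => hij (e3 _ _ x hi hj)
end

section
/- Let X be a topological space and λ a singular cardinal with ĉ(X) ≤ cf(λ) < λ ≤ Δ(X). If every dense subspace S ⊆ X with Δ(S) ≥ λ is μ-resolvable for all μ < λ, then X is λ-resolvable. -/
universe u

open Cardinal Set

/-- `ĉ(X)`: the smallest uncountable cardinal such that `X` has no pairwise disjoint
family of nonempty open sets of that size. -/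
noncomputable def hatCellularity (X : Type u) [TopologicalSpace X] : Cardinal.{u} :=
  sInf {κ | ℵ₀ < κ ∧ ∀ U : Set (Set X), (∀ V ∈ U, IsOpen V ∧ V.Nonempty) →
    U.PairwiseDisjoint id → #U ≠ κ}

theorem card_iUnion_lt_aux {α ι : Type u} {c : Cardinal.{u}} (hc : ℵ₀ ≤ c) (hι : #ι < c.ord.cof)
    (f : ι → Set α) (hf : ∀ i, #(f i) < c) : #(⋃ i, f i) < c := by
  refine (Cardinal.mk_iUnion_le f).trans_lt (Cardinal.mul_lt_of_lt hc ?_ ?_)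
  · exact hι.trans_le (Ordinal.cof_ord_le c)
  · exact Cardinal.iSup_lt_of_lt_cof_ord hι hf

theorem exists_disj_rec {I : Type u} [LinearOrder I] [WellFoundedLT I] {α : Type u}
    (P : I → Set α → Prop) (small' : Set α → Prop)
    (hsm : ∀ (i : I) (f : I → Set α), (∀ j < i, P j (f j)) → small' (⋃ j : Iio i, f j))
    (step : ∀ i B, small' B → ∃ A, P i A ∧ Disjoint A B) :
    ∃ f : I → Set α, (∀ i, P i (f i)) ∧ Pairwise (Function.onFun Disjoint f) := by
  classical
  let F : I → Set α → Set α := fun i B => if hB : small' B then (step i B hB).choose else ∅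
  have hF : ∀ i B, small' B → P i (F i B) ∧ Disjoint (F i B) B := by
    intro i B hB
    simp only [F, dif_pos hB]
    exact (step i B hB).choose_spec
  let f : I → Set α := (wellFounded_lt (α := I)).fix
    (fun i g => F i (⋃ j : Iio i, g j.1 j.2))
  have hf : ∀ i, f i = F i (⋃ j : Iio i, f j) := fun i =>
    (wellFounded_lt (α := I)).fix_eq (fun i g => F i (⋃ j : Iio i, g j.1 j.2)) i
  have hP : ∀ i, P i (f i) := by
    intro i
    induction i using WellFoundedLT.induction with
    | ind i ih =>
      rw [hf i]
      exact (hF i _ (hsm i f ih)).1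
  have hD : ∀ i j, j < i → Disjoint (f i) (f j) := by
    intro i j hji
    rw [hf i]
    exact (hF i _ (hsm i f (fun j _ => hP j))).2.mono_right
      (subset_iUnion (fun j : Iio i => f j) ⟨j, hji⟩)
  refine ⟨f, hP, ?_⟩
  intro i j hij
  rcases lt_or_gt_of_ne hij with h | h
  · exact (hD j i h).symm
  · exact hD i j h

/-- nonempty open subset -/
def NO {X : Type u} [TopologicalSpace X] (O G : Set X) : Prop :=
  IsOpen O ∧ O.Nonempty ∧ O ⊆ G

def BigIn {X : Type u} [TopologicalSpace X] (E H : Set X) (c : Cardinal.{u}) : Prop :=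
  ∀ O, NO O H → c ≤ #(E ∩ O : Set X)

theorem NO.trans {X : Type u} [TopologicalSpace X] {O G H : Set X} (h : NO O G) (h' : G ⊆ H) :
    NO O H := ⟨h.1, h.2.1, h.2.2.trans h'⟩

theorem exists_cell {X : Type u} [TopologicalSpace X] (Q : Set X → Prop) (G : Set X)
    (hQ : ∀ O, NO O G → ∃ O', NO O' O ∧ Q O') :
    ∃ T : Set (Set X), (∀ t ∈ T, NO t G ∧ Q t) ∧ T.PairwiseDisjoint id ∧
      ∀ O, NO O G → ∃ t ∈ T, (O ∩ t).Nonempty := by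
  obtain ⟨T, hT⟩ := zorn_subset {T : Set (Set X) | (∀ t ∈ T, NO t G ∧ Q t) ∧
      T.PairwiseDisjoint id} (by
    intro c hc hch
    refine ⟨⋃₀ c, ⟨?_, ?_⟩, fun s hs => subset_sUnion_of_mem hs⟩
    · rintro t ⟨s, hs, ht⟩
      exact (hc hs).1 t ht
    · exact (pairwiseDisjoint_sUnion hch.directedOn).2 (fun s hs => (hc hs).2))
  refine ⟨T, hT.prop.1, hT.prop.2, ?_⟩
  intro O hO
  by_contra hcon
  push Not at hcon
  obtain ⟨O', hO', hq⟩ := hQ O hO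
  have hins : insert O' T ∈ {T : Set (Set X) | (∀ t ∈ T, NO t G ∧ Q t) ∧
      T.PairwiseDisjoint id} := by
    refine ⟨?_, ?_⟩
    · rintro t (rfl | ht)
      · exact ⟨hO'.trans hO.2.2, hq⟩
      · exact hT.prop.1 t ht
    · refine hT.prop.2.insert ?_
      intro t ht _
      have := hcon t ht
      exact (disjoint_iff_inter_eq_empty.2 this).mono_left hO'.2.2
  have hmem : O' ∈ T := hT.le_of_ge hins (subset_insert _ _) (mem_insert _ _)
  have := hcon O' hmem
  rw [inter_eq_self_of_subset_right hO'.2.2] at this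
  exact hO'.2.1.ne_empty this

theorem cell_lt {X : Type u} [TopologicalSpace X] {κ : Cardinal.{u}} (h1 : hatCellularity X ≤ κ) :
    ℵ₀ < κ ∧ ∀ T : Set (Set X), (∀ t ∈ T, NO t univ) → T.PairwiseDisjoint id → #T < κ := by
  have hne : {κ : Cardinal.{u} | ℵ₀ < κ ∧ ∀ U : Set (Set X), (∀ V ∈ U, IsOpen V ∧ V.Nonempty) →
    U.PairwiseDisjoint id → #U ≠ κ}.Nonempty := by
    refine ⟨Order.succ (max ℵ₀ #(Set X)), ?_, ?_⟩
    · exact (le_max_left _ _).trans_lt (Order.lt_succ _)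
    · intro U _ _
      exact (((mk_set_le U).trans (le_max_right _ _)).trans_lt (Order.lt_succ _)).ne
  have hm := csInf_mem hne
  change ℵ₀ < hatCellularity X ∧ ∀ U : Set (Set X), (∀ V ∈ U, IsOpen V ∧ V.Nonempty) →
    U.PairwiseDisjoint id → #U ≠ hatCellularity X at hm
  refine ⟨hm.1.trans_le h1, ?_⟩
  intro T hT hd
  by_contra hcon
  obtain ⟨p, hp, hpc⟩ := le_mk_iff_exists_subset.1 (h1.trans (not_lt.1 hcon))
  exact hm.2 p (fun V hV => ⟨(hT V (hp hV)).1, (hT V (hp hV)).2.1⟩) (hd.subset hp) hpc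

theorem exists_seq_s14 {lam : Cardinal.{u}} (h0 : ℵ₀ < lam.ord.cof) (h2 : lam.ord.cof < lam)
    {I : Type u} (hI : #I = lam.ord.cof) :
    ∃ l : I → Cardinal.{u}, (∀ i, l i < lam ∧ lam.ord.cof < l i ∧ (l i).IsRegular) ∧
      ∀ ν < lam, ∃ i, ν < l i := by
  obtain ⟨ι, f, hf, hι⟩ := Ordinal.exists_lsub_cof lam.ord
  obtain ⟨e⟩ := Cardinal.eq.1 (hI.trans hι.symm)
  have hlim : Order.IsSuccLimit lam := by
    refine IsSingular.isSuccLimit (IsSingular.of_not_isRegular (h0.trans h2).le ?_)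
    intro hr
    rw [hr.cof_ord] at h2
    exact lt_irrefl _ h2
  refine ⟨fun i => Order.succ (max lam.ord.cof (f (e i)).card), fun i => ⟨?_, ?_, ?_⟩, ?_⟩
  · refine hlim.succ_lt (max_lt h2 ?_)
    have := Ordinal.lt_lsub f (e i)
    rw [hf] at this
    exact lt_ord.1 this
  · exact (le_max_left _ _).trans_lt (Order.lt_succ _)
  · exact isRegular_succ (h0.le.trans (le_max_left _ _))
  · intro ν hν
    have : ν.ord < Ordinal.lsub f := by rw [hf]; exact ord_lt_ord.2 hν
    obtain ⟨i, hi⟩ := Ordinal.lt_lsub_iff.1 this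
    refine ⟨e.symm i, ?_⟩
    have := Ordinal.card_le_card hi
    rw [card_ord] at this
    simp only [Equiv.apply_symm_apply]
    exact this.trans_lt ((le_max_right _ _).trans_lt (Order.lt_succ _))

def Won {X : Type u} [TopologicalSpace X] (I : Type u) (lam : Cardinal.{u}) (H : Set X) : Prop :=
  ∃ E : I → Set X, Pairwise (Function.onFun Disjoint E) ∧ ∀ i, BigIn (E i) H lam

theorem won_univ {X : Type u} [TopologicalSpace X] {I : Type u} {lam : Cardinal.{u}}
    (hQ : ∀ O : Set X, NO O univ → ∃ O', NO O' O ∧ Won I lam O') : Won I lam (univ : Set X) := by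
  obtain ⟨T, hT, hd, hm⟩ := exists_cell (Won I lam) univ hQ
  have hw : ∀ t : T, Won I lam t.1 := fun t => (hT t t.2).2
  choose E hE1 hE2 using hw
  refine ⟨fun i => ⋃ t : T, E t i ∩ t, ?_, ?_⟩
  · intro i j hij
    refine disjoint_left.2 ?_
    intro x hx hy
    obtain ⟨t, ht1, ht2⟩ := mem_iUnion.1 hx
    obtain ⟨s, hs1, hs2⟩ := mem_iUnion.1 hy
    have : s = t := by
      by_contra hne
      exact disjoint_left.1 (hd s.2 t.2 (fun h => hne (Subtype.ext h))) hs2 ht2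
    subst this
    exact disjoint_left.1 (hE1 s hij) ht1 hs1
  · intro i O hO
    obtain ⟨t, ht, hne⟩ := hm O hO
    refine (hE2 ⟨t, ht⟩ i (O ∩ t) ⟨hO.1.inter (hT t ht).1.1, hne, inter_subset_right⟩).trans ?_
    refine mk_le_mk_of_subset ?_
    rintro x ⟨h1, h2, h3⟩
    exact ⟨mem_iUnion.2 ⟨⟨t, ht⟩, h1, h3⟩, h2⟩

theorem diff_ge {X : Type u} {lam : Cardinal.{u}} (hl : ℵ₀ ≤ lam) {B G : Set X} (hB : #B < lam)
    (hG : lam ≤ #G) : lam ≤ #(Bᶜ ∩ G : Set X) := by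
  by_contra hcon
  have : #G ≤ #(B ∪ (Bᶜ ∩ G) : Set X) := mk_le_mk_of_subset (by
    intro x hx
    by_cases hxB : x ∈ B
    · exact Or.inl hxB
    · exact Or.inr ⟨hxB, hx⟩)
  exact absurd (hG.trans (this.trans (mk_union_le _ _))) (not_le.2 (add_lt_of_lt hl hB (not_le.1 hcon)))

theorem resolve {X : Type u} [TopologicalSpace X] {lam : Cardinal.{u}} (hl : ℵ₀ ≤ lam)
    (h3 : lam ≤ dispersion X)
    (h : ∀ S : Set X, Dense S → lam ≤ dispersion ↥S → ∀ μ < lam, Resolvable ↥S μ)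
    {S : Set X} (hS : BigIn S univ lam) {μ : Cardinal.{u}} (hμ : μ < lam) :
    ∃ (ι : Type u) (D : ι → Set X), #ι = μ ∧ (∀ i, Dense (D i)) ∧
      Pairwise (Function.onFun Disjoint D) ∧ ∀ i, D i ⊆ S := by
  have hpos : (0 : Cardinal.{u}) < lam := aleph0_pos.trans_le hl
  have hdense : Dense S := by
    rw [dense_iff_inter_open]
    intro U hU hne
    have := hS U ⟨hU, hne, subset_univ _⟩
    rw [inter_comm]
    by_contra hc
    rw [not_nonempty_iff_eq_empty] at hc
    rw [hc, mk_emptyCollection] at this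
    exact absurd hpos (not_lt.2 this)
  have hXne : Nonempty X := by
    by_contra hc
    have : dispersion X = 0 := by
      unfold dispersion
      have : {c | ∃ G : Set X, IsOpen G ∧ G.Nonempty ∧ #G = c} = ∅ := by
        ext c
        simp only [mem_setOf_eq, mem_empty_iff_false, iff_false]
        rintro ⟨G, -, ⟨x, -⟩, -⟩
        exact hc ⟨x⟩
      rw [this, sInf_empty]
    rw [this] at h3
    exact absurd hpos (not_lt.2 h3)
  have hdisp : lam ≤ dispersion ↥S := by
    refine le_csInf ?_ ?_
    · obtain ⟨x, hx⟩ := hdense.nonempty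
      exact ⟨_, univ, isOpen_univ, ⟨⟨x, hx⟩, trivial⟩, rfl⟩
    · rintro c ⟨G, hG, ⟨x, hx⟩, rfl⟩
      obtain ⟨U, hU, rfl⟩ := isOpen_induced_iff.1 hG
      refine (hS U ⟨hU, ⟨x, hx⟩, subset_univ _⟩).trans ?_
      rw [← mk_image_eq (s := Subtype.val ⁻¹' U) (Subtype.val_injective (p := (· ∈ S))),
        Subtype.image_preimage_coe]
  obtain ⟨ι, D, hι, hD, hd⟩ := h S hdense hdisp μ hμ
  refine ⟨ι, fun i => Subtype.val '' D i, hι, ?_, ?_, ?_⟩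
  · intro i
    exact hdense.denseRange_val.dense_image continuous_subtype_val (hD i)
  · intro i j hij
    exact (disjoint_image_iff Subtype.val_injective).2 (hd hij)
  · rintro i _ ⟨x, -, rfl⟩
    exact x.2

theorem small_dense {X : Type u} [TopologicalSpace X] {lam : Cardinal.{u}} (hl : ℵ₀ ≤ lam)
    (hc : ∀ T : Set (Set X), (∀ t ∈ T, NO t univ) → T.PairwiseDisjoint id → #T < lam.ord.cof)
    {D G : Set X} (hD : Dense D)
    (hQ : ∀ O, NO O G → ∃ O', NO O' O ∧ #(D ∩ O' : Set X) < lam) :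
    ∃ A, A ⊆ D ∧ #A < lam ∧ ∀ O, NO O G → (A ∩ O).Nonempty := by
  obtain ⟨T, hT, hd, hm⟩ := exists_cell (fun O' => #(D ∩ O' : Set X) < lam) G hQ
  refine ⟨⋃ t : T, D ∩ t, iUnion_subset fun t => inter_subset_left, ?_, ?_⟩
  · exact card_iUnion_lt_aux hl (hc T (fun t ht => (hT t ht).1.trans (subset_univ _)) hd) _
      (fun t => (hT t t.2).2)
  · intro O hO
    obtain ⟨t, ht, hne⟩ := hm O hO
    obtain ⟨x, hx, hxD⟩ := dense_iff_inter_open.1 hD _ (hO.1.inter (hT t ht).1.1) hne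
    exact ⟨x, mem_iUnion.2 ⟨⟨t, ht⟩, hxD, hx.2⟩, hx.1⟩

theorem getA {X : Type u} [TopologicalSpace X] {lam : Cardinal.{u}}
    (h0 : ℵ₀ < lam.ord.cof) (h2 : lam.ord.cof < lam)
    (hc : ∀ T : Set (Set X), (∀ t ∈ T, NO t univ) → T.PairwiseDisjoint id → #T < lam.ord.cof)
    {I : Type u} [LinearOrder I] [WellFoundedLT I] (hI : #I = lam.ord.cof)
    (hseg : ∀ i : I, #(Iio i) < lam.ord.cof)
    {l : I → Cardinal.{u}} (hl : ∀ i, l i < lam ∧ lam.ord.cof < l i ∧ (l i).IsRegular)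
    (hl' : ∀ ν < lam, ∃ i, ν < l i)
    {G : Set X} (hG : ∀ O, NO O G → ¬ Won I lam O) (b : I)
    {ι : Type u} {D : ι → Set X} (hι : #ι = l b) (hD : ∀ i, Dense (D i))
    (hdis : Pairwise (Function.onFun Disjoint D)) :
    ∃ A, A ⊆ ⋃ i, D i ∧ #A < lam ∧ BigIn A G (l b) := by
  have hlinf : ℵ₀ ≤ lam := (h0.trans h2).le
  obtain ⟨hb1, hb2, hb3⟩ := hl b
  have hbinf : ℵ₀ ≤ l b := hb3.1
  let N : Set X → Set ι := fun H => {ξ | ∃ O, NO O H ∧ BigIn (D ξ) O lam}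
  -- every nonempty open subset contains a bounded one
  have hbdd : ∀ H, NO H G → ∃ O, NO O H ∧ #(N O) < l b := by
    intro H hH
    by_contra hcon
    push Not at hcon
    refine hG H hH ?_
    have hstep : ∀ (i : I) (K : Set ι), #K < l b → ∃ g : Set ι,
        (#g < lam.ord.cof ∧ ∀ O, NO O H → ∃ ξ ∈ g, ∃ O', NO O' O ∧ BigIn (D ξ) O' lam) ∧
        Disjoint g K := by
      intro _ K hK
      obtain ⟨T, hT, hd, hm⟩ := exists_cell (fun O => ∃ ξ, ξ ∉ K ∧ BigIn (D ξ) O lam) H (by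
        intro O hO
        have h1 := hcon O hO
        have : ¬ N O ⊆ K := fun hs => absurd (h1.trans (mk_le_mk_of_subset hs)) (not_le.2 hK)
        obtain ⟨ξ, ⟨O', hO', hbig⟩, hξ⟩ := not_subset.1 this
        exact ⟨O', hO', ξ, hξ, hbig⟩)
      have hw : ∀ t : T, ∃ ξ, ξ ∉ K ∧ BigIn (D ξ) t.1 lam := fun t => (hT t t.2).2
      choose x hx1 hx2 using hw
      refine ⟨range x, ⟨?_, ?_⟩, ?_⟩
      · exact mk_range_le.trans_lt
          (hc T (fun t ht => (hT t ht).1.trans (subset_univ _)) hd)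
      · intro O hO
        obtain ⟨t, ht, hne⟩ := hm O hO
        refine ⟨x ⟨t, ht⟩, mem_range_self _, O ∩ t,
          ⟨hO.1.inter (hT t ht).1.1, hne, inter_subset_left⟩, ?_⟩
        intro O' hO'
        exact hx2 ⟨t, ht⟩ O' (hO'.trans inter_subset_right)
      · rw [disjoint_left]
        rintro _ ⟨t, rfl⟩
        exact hx1 t
    obtain ⟨g, hg, hgd⟩ := exists_disj_rec _ (fun K : Set ι => #K < l b) (by
      intro i f hf
      refine card_iUnion_lt_aux hbinf ?_ _ ?_
      · rw [hb3.cof_ord]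
        exact (hseg i).trans hb2
      · rintro ⟨j, hj⟩
        exact (hf j hj).1.trans hb2) hstep
    refine ⟨fun i => ⋃ ξ : g i, D ξ, ?_, ?_⟩
    · intro i j hij
      refine disjoint_left.2 ?_
      intro x hx hy
      obtain ⟨s, hs⟩ := mem_iUnion.1 hx
      obtain ⟨t, ht⟩ := mem_iUnion.1 hy
      have hne : s.1 ≠ t.1 := fun e => disjoint_left.1 (hgd hij) s.2 (e ▸ t.2)
      exact disjoint_left.1 (hdis hne) hs ht
    · intro i O hO
      obtain ⟨ξ, hξ, O', hO', hbig⟩ := (hg i).2 O hO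
      refine (hbig O' ⟨hO'.1, hO'.2.1, subset_rfl⟩).trans (mk_le_mk_of_subset ?_)
      rintro x ⟨hx1, hx2⟩
      exact ⟨mem_iUnion.2 ⟨⟨ξ, hξ⟩, hx1⟩, hO'.2.2 hx2⟩
  have hNG : #(N G) < l b := by
    obtain ⟨T, hT, hd, hm⟩ := exists_cell (fun O => #(N O) < l b) G hbdd
    have hU : #(⋃ t : T, N t) < l b := by
      refine card_iUnion_lt_aux hbinf ?_ _ (fun t => (hT t t.2).2)
      rw [hb3.cof_ord]
      exact (hc T (fun t ht => (hT t ht).1.trans (subset_univ _)) hd).trans hb2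
    refine (mk_le_mk_of_subset ?_).trans_lt hU
    rintro ξ ⟨O, hO, hbig⟩
    obtain ⟨t, ht, hne⟩ := hm O hO
    refine mem_iUnion.2 ⟨⟨t, ht⟩, O ∩ t,
      ⟨hO.1.inter (hT t ht).1.1, hne, inter_subset_right⟩, ?_⟩
    intro O' hO'
    exact hbig O' (hO'.trans inter_subset_left)
  have : Infinite ι := by rw [Cardinal.infinite_iff, hι]; exact hbinf
  have hR : #((N G)ᶜ : Set ι) = l b := by
    rw [mk_compl_of_infinite _ (by rw [hι]; exact hNG), hι]
  have hA : ∀ ξ : ((N G)ᶜ : Set ι), ∃ A, A ⊆ D ξ ∧ #A < lam ∧ ∀ O, NO O G → (A ∩ O).Nonempty := by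
    rintro ⟨ξ, hξ⟩
    refine small_dense hlinf hc (hD ξ) ?_
    intro O hO
    by_contra hcon
    push Not at hcon
    exact hξ ⟨O, hO, fun O' hO' => hcon O' hO'⟩
  choose A hA1 hA2 hA3 using hA
  choose f hf using fun ξ => hl' _ (hA2 ξ)
  obtain ⟨i, hi⟩ := infinite_pigeonhole_card f (l b) hR.ge hbinf
    (by rw [hb3.cof_ord, hI]; exact hb2)
  refine ⟨⋃ ξ : f ⁻¹' {i}, A ξ, ?_, ?_, ?_⟩
  · intro x hx
    obtain ⟨ξ, hξ⟩ := mem_iUnion.1 hx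
    exact mem_iUnion.2 ⟨_, hA1 _ hξ⟩
  · refine (mk_iUnion_le _).trans_lt (mul_lt_of_lt hlinf ?_ ?_)
    · exact ((mk_set_le _).trans hR.le).trans_lt hb1
    · refine lt_of_le_of_lt (ciSup_le' ?_) (hl i).1
      rintro ⟨ξ, rfl⟩
      exact (hf ξ).le
  · intro O hO
    refine hi.trans ?_
    choose p hp using fun ξ => hA3 ξ O hO
    refine mk_le_of_injective (f := fun ξ : f ⁻¹' {i} =>
      (⟨p ξ, mem_iUnion.2 ⟨ξ, (hp ξ).1⟩, (hp ξ).2⟩ : ((⋃ ξ : f ⁻¹' {i}, A ξ) ∩ O : Set X))) ?_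
    intro ξ η he
    have he' : p ξ = p η := congrArg Subtype.val he
    by_contra hne
    have : ξ.1.1 ≠ η.1.1 := fun e => hne (Subtype.ext (Subtype.ext e))
    exact disjoint_left.1 (hdis this) (hA1 _ (hp ξ).1) (he' ▸ hA1 _ (hp η).1)

/-- If `λ` is singular, `ĉ(X) ≤ cf(λ) < λ ≤ Δ(X)`, and every dense subspace `S` with
`Δ(S) ≥ λ` is `(<λ)`-resolvable, then `X` is `λ`-resolvable. -/
theorem stmt14 {X : Type u} [TopologicalSpace X] (lam : Cardinal.{u})
    (h1 : hatCellularity X ≤ lam.ord.cof) (h2 : lam.ord.cof < lam)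
    (h3 : lam ≤ dispersion X)
    (h : ∀ S : Set X, Dense S → lam ≤ dispersion ↥S → ∀ μ < lam, Resolvable ↥S μ) :
    Resolvable X lam := by
  obtain ⟨h0, hc⟩ := cell_lt h1
  have hlinf : ℵ₀ ≤ lam := (h0.trans h2).le
  let I : Type u := lam.ord.cof.ord.ToType
  have hI : #I = lam.ord.cof := mk_ord_toType _
  have hseg : ∀ i : I, #(Iio i) < lam.ord.cof := fun i => mk_Iio_toType_ord_lt i
  obtain ⟨l, hl, hl'⟩ := exists_seq_s14 h0 h2 hI
  have hX : BigIn (univ : Set X) univ lam := by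
    intro O hO
    rw [univ_inter]
    exact h3.trans (csInf_le' ⟨O, hO.1, hO.2.1, rfl⟩)
  have hwon : Won I lam (univ : Set X) := by
    refine won_univ ?_
    intro G hGo
    by_contra hcon
    push Not at hcon
    refine hcon G ⟨hGo.1, hGo.2.1, subset_rfl⟩ ?_
    have hII : #(I × I) = #I := by
      rw [mk_prod, lift_id, mul_eq_self]
      rw [hI]; exact h0.le
    obtain ⟨e⟩ := Cardinal.eq.1 hII
    obtain ⟨A, hA, hAd⟩ := exists_disj_rec
      (fun (i : I) (A : Set X) => #A < lam ∧ BigIn A G (l (e.symm i).2))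
      (fun B => #B < lam) (by
        intro i f hf
        refine card_iUnion_lt_aux hlinf (hseg i) _ ?_
        rintro ⟨j, hj⟩
        exact (hf j hj).1) (by
        intro i B hB
        obtain ⟨ι, D, hι, hD, hdis, hDB⟩ := resolve hlinf h3 h (S := Bᶜ) (fun O hO =>
          diff_ge hlinf hB (by simpa using hX O hO)) (hl (e.symm i).2).1
        obtain ⟨A, hA1, hA2, hA3⟩ := getA h0 h2 hc hI hseg hl hl' hcon (e.symm i).2 hι hD hdis
        refine ⟨A, ⟨hA2, hA3⟩, ?_⟩
        exact disjoint_left.2 fun x hx => iUnion_subset hDB (hA1 hx))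
    refine ⟨fun a => ⋃ b, A (e (a, b)), ?_, ?_⟩
    · intro a a' haa
      refine disjoint_left.2 ?_
      intro x hx hy
      obtain ⟨s, hs⟩ := mem_iUnion.1 hx
      obtain ⟨t, ht⟩ := mem_iUnion.1 hy
      have hne : e (a, s) ≠ e (a', t) := fun he => haa (congrArg Prod.fst (e.injective he))
      exact disjoint_left.1 (hAd hne) hs ht
    · intro a O hO
      refine le_of_forall_lt fun ν hν => ?_
      obtain ⟨b, hb⟩ := hl' _ hν
      refine hb.trans_le (le_trans ?_ (mk_le_mk_of_subset
        (inter_subset_inter_left O (subset_iUnion (fun b => A (e (a, b))) b))))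
      have := (hA (e (a, b))).2 O hO
      simpa using this
  obtain ⟨E, hE1, hE2⟩ := hwon
  choose ι D hι hD hdis hDE using fun i => resolve hlinf h3 h (hE2 i) (hl i).1
  have hbig : lam ≤ #(Σ i, ι i) := by
    refine le_of_forall_lt fun ν hν => ?_
    obtain ⟨i, hi⟩ := hl' _ hν
    rw [← hι i] at hi
    exact hi.trans_le (mk_le_of_injective (f := fun x : ι i => (⟨i, x⟩ : Σ i, ι i))
      sigma_mk_injective)
  have hbig' : lam ≤ #(univ : Set (Σ i, ι i)) := by rwa [mk_univ]
  obtain ⟨J, -, hJ⟩ := le_mk_iff_exists_subset.1 hbig'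
  refine ⟨J, fun p => D p.1.1 p.1.2, hJ, fun p => hD _ _, ?_⟩
  rintro ⟨⟨i, x⟩, hp⟩ ⟨⟨j, y⟩, hq⟩ hne
  by_cases hij : i = j
  · subst hij
    exact hdis i (fun hxy => hne (by subst hxy; rfl))
  · exact (hE1 hij).mono (hDE i x) (hDE j y)
end

section
/- Every regular (T_3) topological space X satisfying Δ(X) > ê(X) — in particular every crowded countably compact T_3 space — is ω-resolvable. -/
universe u

open Cardinal Set

/-- `ê(X)`: the smallest infinite cardinal such that `X` has no closed discrete
subspace of that size. -/
noncomputable def hatExtent (X : Type u) [TopologicalSpace X] : Cardinal.{u} :=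
  sInf {κ | ℵ₀ ≤ κ ∧ ∀ D : Set X, IsClosed D → DiscreteTopology ↥D → #D ≠ κ}

namespace OmegaResProof

/-- `S` has countably many pairwise disjoint dense subsets. -/
def OR {X : Type u} [TopologicalSpace X] (S : Set X) : Prop :=
  ∃ D : ℕ → Set X, (∀ n, D n ⊆ S) ∧ (∀ n, S ⊆ closure (D n)) ∧
    Pairwise (Function.onFun Disjoint D)

theorem resolvable_of_OR {X : Type u} [TopologicalSpace X]
    (h : ∀ O : Set X, IsOpen O → O.Nonempty → ∃ S : Set X, S ⊆ O ∧ S.Nonempty ∧ OR S) :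
    Resolvable X ℵ₀ := by
  let P : Set (ℕ → Set X) := {D | (∀ n m, D n ⊆ closure (D m)) ∧
    Pairwise (Function.onFun Disjoint D)}
  obtain ⟨D, hD⟩ : ∃ D, Maximal (· ∈ P) D := by
    apply zorn_le₀
    intro c hc hchain
    refine ⟨fun n => ⋃ D ∈ c, D n, ⟨?_, ?_⟩, ?_⟩
    · intro n m x hx
      simp only [mem_iUnion] at hx
      obtain ⟨D, hDc, hx⟩ := hx
      exact closure_mono (subset_biUnion_of_mem (u := fun D : ℕ → Set X => D m) hDc)
        ((hc hDc).1 n m hx)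
    · intro n m hnm
      rw [Function.onFun, Set.disjoint_left]
      intro x hx hy
      simp only [mem_iUnion] at hx hy
      obtain ⟨D, hDc, hx⟩ := hx
      obtain ⟨E, hEc, hy⟩ := hy
      rcases hchain.total hDc hEc with hle | hle
      · exact Set.disjoint_left.1 ((hc hEc).2 hnm) (hle n hx) hy
      · exact Set.disjoint_left.1 ((hc hDc).2 hnm) hx (hle m hy)
    · intro D hDc n
      exact subset_biUnion_of_mem (u := fun D : ℕ → Set X => D n) hDc
  have hcl : ∀ n m, closure (D n) ⊆ closure (D m) := fun n m =>
    closure_minimal (hD.1.1 n m) isClosed_closure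
  have hdense : ∀ n, Dense (D n) := by
    intro n
    by_contra hn
    obtain ⟨x, hx⟩ : ∃ x, x ∉ closure (D n) := by
      by_contra hh
      push Not at hh
      exact hn hh
    obtain ⟨S, hSO, ⟨s, hs⟩, E, hE1, hE2, hE3⟩ :=
      h (closure (D n))ᶜ isClosed_closure.isOpen_compl ⟨x, hx⟩
    have hdis : ∀ i j, ∀ y ∈ D i, y ∉ E j := by
      intro i j y hy hy'
      exact hSO (hE1 j hy') (hD.1.1 i n hy)
    have hmem : (fun i => D i ∪ E i) ∈ P := by
      refine ⟨?_, ?_⟩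
      · intro i j
        rw [closure_union]
        exact union_subset_union (hD.1.1 i j) ((hE1 i).trans (hE2 j))
      · intro i j hij
        rw [Function.onFun, Set.disjoint_left]
        rintro y (hy | hy) (hy' | hy')
        · exact Set.disjoint_left.1 (hD.1.2 hij) hy hy'
        · exact hdis _ _ _ hy hy'
        · exact hdis _ _ _ hy' hy
        · exact Set.disjoint_left.1 (hE3 hij) hy hy'
    have hle := hD.2 hmem (fun i => subset_union_left) n
    obtain ⟨e, he⟩ : (E n).Nonempty := closure_nonempty_iff.1 ⟨s, hE2 n hs⟩
    exact hdis n n e (hle (Or.inr he)) he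
  refine ⟨ULift.{u} ℕ, fun i => D i.down, by simp, fun i => hdense _, ?_⟩
  intro i j hij
  exact hD.1.2 (fun hh => hij (ULift.ext _ _ hh))

theorem subset_closure_of {X : Type u} [TopologicalSpace X] {O Y : Set X} (hO : IsOpen O)
    (h : ∀ O' : Set X, O' ⊆ O → IsOpen O' → O'.Nonempty → (Y ∩ O').Nonempty) :
    O ⊆ closure Y := by
  intro x hx
  rw [mem_closure_iff]
  intro o ho hxo
  obtain ⟨y, hy, hyo, -⟩ := h (o ∩ O) inter_subset_right (ho.inter hO) ⟨x, hxo, hx⟩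
  exact ⟨y, hyo, hy⟩

theorem inter_nonempty_of {X : Type u} [TopologicalSpace X] {O O' Y : Set X}
    (h : O ⊆ closure Y) (hsub : O' ⊆ O) (hO' : IsOpen O') (hne : O'.Nonempty) :
    (Y ∩ O').Nonempty := by
  obtain ⟨x, hx⟩ := hne
  obtain ⟨y, hy, hy'⟩ := mem_closure_iff.1 (h (hsub hx)) O' hO' hx
  exact ⟨y, hy', hy⟩

theorem small_biUnion {X : Type u} {κ : Cardinal.{u}} (hκ : ℵ₀ ≤ κ) {Z : Set X}
    (hZ : #Z ≤ κ) {f : X → Set X} (hf : ∀ z ∈ Z, #(f z) ≤ κ) :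
    #(⋃ z ∈ Z, f z : Set X) ≤ κ := by
  rw [biUnion_eq_iUnion]
  calc #(⋃ z : Z, f z : Set X) ≤ Cardinal.sum (fun z : Z => #(f z)) := Cardinal.mk_iUnion_le_sum_mk
    _ ≤ Cardinal.sum (fun _ : Z => κ) := Cardinal.sum_le_sum _ _ (fun z => hf z z.2)
    _ = #Z * κ := by simp
    _ ≤ κ * κ := mul_le_mul_left hZ κ
    _ = κ := Cardinal.mul_eq_self hκ

theorem small_union {X : Type u} {κ : Cardinal.{u}} (hκ : ℵ₀ ≤ κ) {A B : Set X}
    (hA : #A ≤ κ) (hB : #B ≤ κ) : #(A ∪ B : Set X) ≤ κ :=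
  (Cardinal.mk_union_le A B).trans (Cardinal.add_le_of_le hκ hA hB)

theorem small_iUnion_nat {X : Type u} {κ : Cardinal.{u}} (hκ : ℵ₀ ≤ κ) {f : ℕ → Set X}
    (hf : ∀ n, #(f n) ≤ κ) : #(⋃ n, f n : Set X) ≤ κ := by
  have e : (⋃ n, f n : Set X) = ⋃ n : ULift.{u} ℕ, f n.down := by
    ext x; simp [ULift.exists]
  rw [e]
  calc #(⋃ n : ULift.{u} ℕ, f n.down : Set X)
      ≤ Cardinal.sum (fun n : ULift.{u} ℕ => #(f n.down)) := Cardinal.mk_iUnion_le_sum_mk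
    _ ≤ Cardinal.sum (fun _ : ULift.{u} ℕ => κ) := Cardinal.sum_le_sum _ _ (fun z => hf _)
    _ = ℵ₀ * κ := by simp
    _ ≤ κ * κ := mul_le_mul_left hκ κ
    _ = κ := Cardinal.mul_eq_self hκ

theorem seq_exists {X : Type u} {κ : Cardinal.{u}} (hκ : ℵ₀ ≤ κ) (R : Set X → Set X → Prop)
    (h : ∀ M : Set X, #M ≤ κ → ∃ T : Set X, #T ≤ κ ∧ Disjoint T M ∧ R M T) :
    ∃ A U : ℕ → Set X, (∀ n, R (U n) (A n)) ∧ (∀ m n, m < n → A m ⊆ U n) ∧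
      Pairwise (Function.onFun Disjoint A) := by
  choose! f hf1 hf2 hf3 using h
  let U : ℕ → Set X := fun n => Nat.rec ∅ (fun _ s => s ∪ f s) n
  have hU : ∀ n, U (n + 1) = U n ∪ f (U n) := fun n => rfl
  have hsm : ∀ n, #(↥(U n)) ≤ κ := by
    intro n
    induction n with
    | zero => change #(∅ : Set X) ≤ κ; simp
    | succ n ih => rw [hU]; exact small_union hκ ih (hf1 _ ih)
  have hmono : Monotone U := monotone_nat_of_le_succ (fun n => by rw [hU]; exact subset_union_left)
  have hAU : ∀ m n, m < n → f (U m) ⊆ U n := by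
    intro m n hmn
    refine Subset.trans ?_ (hmono hmn)
    change f (U m) ⊆ U (m + 1)
    rw [hU]; exact subset_union_right
  refine ⟨fun n => f (U n), U, fun n => hf3 _ (hsm n), hAU, ?_⟩
  intro m n hmn
  rcases lt_or_gt_of_ne hmn with hlt | hlt
  · exact ((hf2 _ (hsm n)).mono_right (hAU m n hlt)).symm
  · exact (hf2 _ (hsm m)).mono_right (hAU n m hlt)

/-- points that are limits of small subsets of `Y`, arbitrarily far. -/
def G {X : Type u} [TopologicalSpace X] (κ : Cardinal.{u}) (Y : Set X) : Set X :=
  {x | ∀ B : Set X, #B ≤ κ → ∃ A : Set X, #A ≤ κ ∧ A ⊆ Y ∧ Disjoint A B ∧ x ∈ closure A}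

theorem G_many {X : Type u} [TopologicalSpace X] {κ : Cardinal.{u}} (hκ : ℵ₀ ≤ κ)
    {Y Z B : Set X} (hZ : #Z ≤ κ) (hZY : Z ⊆ G κ Y) (hB : #B ≤ κ) :
    ∃ A : Set X, #A ≤ κ ∧ A ⊆ Y ∧ Disjoint A B ∧ Z ⊆ closure A := by
  have : ∀ z ∈ Z, ∃ A : Set X, #A ≤ κ ∧ A ⊆ Y ∧ Disjoint A B ∧ z ∈ closure A :=
    fun z hz => hZY hz B hB
  choose! f h1 h2 h3 h4 using this
  refine ⟨⋃ z ∈ Z, f z, small_biUnion hκ hZ h1, iUnion₂_subset h2, ?_, ?_⟩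
  · simp only [disjoint_iUnion_left]; exact h3
  · intro z hz
    exact closure_mono (subset_biUnion_of_mem (u := f) hz) (h4 z hz)

theorem G_closed {X : Type u} [TopologicalSpace X] {κ : Cardinal.{u}} (hκ : ℵ₀ ≤ κ)
    {Y A : Set X} (hA : #A ≤ κ) (hAY : A ⊆ G κ Y) : closure A ⊆ G κ Y := by
  intro x hx B hB
  obtain ⟨C, h1, h2, h3, h4⟩ := G_many hκ hA hAY hB
  exact ⟨C, h1, h2, h3, closure_minimal h4 isClosed_closure hx⟩

theorem G_mono {X : Type u} [TopologicalSpace X] {κ : Cardinal.{u}} {Y Z : Set X}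
    (h : Y ⊆ Z) : G κ Y ⊆ G κ Z := by
  intro x hx B hB
  obtain ⟨A, h1, h2, h3, h4⟩ := hx B hB
  exact ⟨A, h1, h2.trans h, h3, h4⟩

theorem G_local {X : Type u} [TopologicalSpace X] {κ : Cardinal.{u}} {Y W : Set X}
    (hW : IsOpen W) {x : X} (hxW : x ∈ W) (hx : x ∈ G κ Y) : x ∈ G κ (W ∩ Y) := by
  intro B hB
  obtain ⟨A, h1, h2, h3, h4⟩ := hx B hB
  refine ⟨W ∩ A, (Cardinal.mk_le_mk_of_subset inter_subset_right).trans h1,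
    inter_subset_inter_right _ h2, h3.mono_left inter_subset_right, ?_⟩
  exact hW.inter_closure ⟨hxW, h4⟩

theorem OR_of_selfgood {X : Type u} [TopologicalSpace X] {κ : Cardinal.{u}} (hκ : ℵ₀ ≤ κ)
    {Y : Set X} (hY : Y ⊆ G κ Y) (hne : Y.Nonempty) :
    ∃ S : Set X, S ⊆ Y ∧ S.Nonempty ∧ OR S := by
  obtain ⟨y0, hy0⟩ := hne
  obtain ⟨A, U, hR, hAU, hdis⟩ := seq_exists hκ
    (fun M T : Set X => T ⊆ Y ∧ M ∩ Y ⊆ closure T ∧ y0 ∈ closure T) (by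
      intro M hM
      have hs : #((M ∩ Y) ∪ {y0} : Set X) ≤ κ := by
        apply small_union hκ
        · exact (Cardinal.mk_le_mk_of_subset inter_subset_left).trans hM
        · simpa using (Cardinal.one_le_aleph0.trans hκ)
      obtain ⟨T, h1, h2, h3, h4⟩ := G_many hκ hs (Y := Y) (by
        rintro z (hz | hz)
        · exact hY hz.2
        · rw [mem_singleton_iff] at hz; subst hz; exact hY hy0) hM
      exact ⟨T, h1, h3, h2, fun z hz => h4 (Or.inl hz), h4 (Or.inr rfl)⟩)
  have hcl : ∀ m n, m < n → A m ⊆ closure (A n) := fun m n hmn x hx =>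
    (hR n).2.1 ⟨hAU m n hmn hx, (hR m).1 hx⟩
  refine ⟨⋃ n, A n, iUnion_subset fun n => (hR n).1, ?_, ?_⟩
  · obtain ⟨a, ha⟩ := closure_nonempty_iff.1 ⟨y0, (hR 0).2.2⟩
    exact ⟨a, mem_iUnion.2 ⟨0, ha⟩⟩
  · refine ⟨fun i => ⋃ j, A (Nat.pair i j), ?_, ?_, ?_⟩
    · intro i
      exact iUnion_subset fun j => subset_iUnion A _
    · intro i
      refine iUnion_subset fun m => ?_
      have hlt : m < Nat.pair i (m + 1) := Nat.right_le_pair i (m + 1)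
      exact (hcl m _ hlt).trans (closure_mono (subset_iUnion (fun j => A (Nat.pair i j)) (m + 1)))
    · intro i j hij
      simp only [Function.onFun, disjoint_iUnion_left, disjoint_iUnion_right]
      intro a b
      apply hdis
      intro hh
      exact hij (Nat.pair_eq_pair.1 hh).1

theorem exists_acc {X : Type u} [TopologicalSpace X] {κ : Cardinal.{u}}
    (hcd : ∀ D : Set X, IsClosed D → DiscreteTopology ↥D → #D ≠ κ) {A : Set X} (hA : #A = κ) :
    ∃ y, y ∈ closure (A \ {y}) := by
  by_contra hh
  push Not at hh
  refine hcd A ?_ ?_ hA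
  · refine isClosed_of_closure_subset fun y hy => ?_
    by_contra hyA
    apply hh y
    rwa [diff_singleton_eq_self hyA]
  · rw [discreteTopology_subtype_iff]
    intro x hx
    have := hh x
    rw [mem_closure_iff_nhdsWithin_neBot, Filter.not_neBot] at this
    rw [← this, nhdsWithin, nhdsWithin, inf_assoc, Filter.inf_principal]
    congr 2
    ext z; simp [and_comm]

/-- `B`-closure of a point together with `M`. -/
def clo {X : Type u} (B : X → Set X) (M : Set X) (x : X) : ℕ → Set X
  | 0 => {x} ∪ M
  | n + 1 => clo B M x n ∪ ⋃ y ∈ clo B M x n, B y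

theorem exists_rank {X : Type u} {κ : Cardinal.{u}} (hκ : ℵ₀ ≤ κ) [LinearOrder X]
    [WellFoundedLT X] (B : X → Set X) (hB : ∀ x, #(B x) ≤ κ) (M : Set X) (hM : #M ≤ κ) :
    ∃ r : X → X, (∀ x, #(r ⁻¹' {x}) ≤ κ) ∧ (∀ y z, r y < r z → z ∉ B y) ∧
      (∀ m ∈ M, ∀ y, ¬ r y < r m) := by
  let C : X → Set X := fun x => ⋃ n, clo B M x n
  have hC : ∀ x, #(C x) ≤ κ := by
    intro x
    apply small_iUnion_nat hκ
    intro n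
    induction n with
    | zero =>
      apply small_union hκ _ hM
      simpa using (Cardinal.one_le_aleph0.trans hκ)
    | succ n ih => exact small_union hκ ih (small_biUnion hκ ih (fun z _ => hB z))
  have hCx : ∀ x, x ∈ C x := fun x => mem_iUnion.2 ⟨0, Or.inl rfl⟩
  have hCM : ∀ x, M ⊆ C x := fun x m hm => mem_iUnion.2 ⟨0, Or.inr hm⟩
  have hCB : ∀ x y, y ∈ C x → B y ⊆ C x := by
    intro x y hy z hz
    obtain ⟨n, hn⟩ := mem_iUnion.1 hy
    exact mem_iUnion.2 ⟨n + 1, Or.inr (mem_biUnion hn hz)⟩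
  have wf : WellFounded ((· < ·) : X → X → Prop) := wellFounded_lt
  let r : X → X := fun y => wf.min {x | y ∈ C x} ⟨y, hCx y⟩
  have hr : ∀ y, y ∈ C (r y) := fun y => wf.min_mem {x | y ∈ C x} ⟨y, hCx y⟩
  have hr' : ∀ y x, y ∈ C x → ¬ x < r y := fun y x hx => wf.not_lt_min {x | y ∈ C x} hx
  refine ⟨r, ?_, ?_, ?_⟩
  · intro x
    refine (Cardinal.mk_le_mk_of_subset ?_).trans (hC x)
    intro y hy
    have hy' : r y = x := hy
    rw [← hy']; exact hr y
  · intro y z hyz hz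
    exact hr' z (r y) (hCB _ _ (hr y) hz) hyz
  · intro m hm y
    exact hr' m _ (hCM _ hm)

theorem exists_inj_subset {X : Type u} {κ : Cardinal.{u}} (hκ : ℵ₀ ≤ κ) (r : X → X)
    (hr : ∀ x, #(r ⁻¹' {x}) ≤ κ) {Y : Set X} (hY : κ < #Y) :
    ∃ A ⊆ Y, #A = κ ∧ InjOn r A := by
  have him : κ ≤ #(r '' Y) := by
    by_contra hlt
    push Not at hlt
    apply hY.not_ge
    refine (Cardinal.mk_le_mk_of_subset ?_).trans
      (small_biUnion hκ hlt.le (f := fun x => r ⁻¹' {x}) (fun z _ => hr z))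
    intro y hy
    exact mem_biUnion (mem_image_of_mem r hy) rfl
  obtain ⟨I, hI, hIκ⟩ := Cardinal.le_mk_iff_exists_subset.1 him
  obtain ⟨A, hAY, hbij⟩ := (surjOn_image r Y).mono (Subset.refl _) hI |>.exists_bijOn_subset
  refine ⟨A, hAY, ?_, hbij.injOn⟩
  rw [← hIκ, ← hbij.image_eq, Cardinal.mk_image_eq_of_injOn _ _ hbij.injOn]

/-- the left separated part -/
def E {X : Type u} [TopologicalSpace X] [LinearOrder X] (r : X → X) (Y : Set X) : Set X :=
  {y | y ∈ Y ∧ y ∉ closure {x | x ∈ Y ∧ r x < r y}}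

/-- the iterated remainders -/
def QQ {X : Type u} [TopologicalSpace X] [LinearOrder X] (r : X → X) (Y : Set X) : ℕ → Set X
  | 0 => Y
  | n + 1 => QQ r Y n \ E r (QQ r Y n)

theorem core {X : Type u} [TopologicalSpace X] [T3Space X] {κ : Cardinal.{u}} (hκ : ℵ₀ ≤ κ)
    (hcd : ∀ D : Set X, IsClosed D → DiscreteTopology ↥D → #D ≠ κ)
    {V Q : Set X} (hV : IsOpen V) (hVne : V.Nonempty)
    (ha : ∀ O ⊆ V, IsOpen O → O.Nonempty → κ < #(Q ∩ O : Set X))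
    (hb : ∀ A ⊆ Q, #A ≤ κ → closure A ∩ V ⊆ Q)
    (hc : ∀ y ∈ V, ∃ B : Set X, #B ≤ κ ∧ ∀ A ⊆ Q, #A ≤ κ → Disjoint A B → y ∉ closure A) :
    ∃ S : Set X, S ⊆ V ∧ S.Nonempty ∧ OR S := by
  by_contra hno
  -- Step 5
  obtain ⟨O₁, hO₁V, hO₁, hO₁ne, M, hM, hOM⟩ : ∃ O₁ ⊆ V, IsOpen O₁ ∧ O₁.Nonempty ∧
      ∃ M : Set X, #M ≤ κ ∧ ∀ O ⊆ O₁, IsOpen O → O.Nonempty → ∀ T ⊆ Q, Disjoint T M →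
        T ⊆ O → O ⊆ closure T → ¬ #T ≤ κ := by
    by_contra hcon
    push Not at hcon
    obtain ⟨O₀, hO₀V, hO₀, hO₀ne, T₀, -, -, -, hT₀cl, hT₀⟩ :=
      hcon V Subset.rfl hV hVne ∅ (by simp)
    obtain ⟨A, U, hR, -, hdis⟩ := seq_exists hκ
      (fun M T : Set X => T ⊆ O₀ ∧ O₀ ⊆ closure T) (by
        intro M hM
        let P : X → Prop := fun t => ∃ O ⊆ O₀, IsOpen O ∧ t ∈ O ∧ ∃ T ⊆ O,
          Disjoint T M ∧ O ⊆ closure T ∧ #T ≤ κ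
        have hP : ∀ t ∈ {t | t ∈ T₀ ∧ P t}, P t := fun t ht => ht.2
        choose! W hW1 hW2 hW3 T hT1 hT2 hT3 hT4 using hP
        refine ⟨⋃ t ∈ {t | t ∈ T₀ ∧ P t}, T t, ?_, ?_, ?_, ?_⟩
        · exact small_biUnion hκ ((Cardinal.mk_le_mk_of_subset (fun t ht => ht.1)).trans hT₀) hT4
        · simp only [disjoint_iUnion_left]; exact hT2
        · exact iUnion₂_subset fun t ht => (hT1 t ht).trans (hW1 t ht)
        · apply subset_closure_of hO₀
          intro O hOO hO hOne
          obtain ⟨O', hO'O, hO', hO'ne, T', -, hT'M, hT'O, hT'cl, hT'⟩ :=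
            hcon O (hOO.trans hO₀V) hO hOne M hM
          obtain ⟨t, htT, htO⟩ := inter_nonempty_of hT₀cl (hO'O.trans hOO) hO' hO'ne
          have htP : t ∈ {t | t ∈ T₀ ∧ P t} :=
            ⟨htT, O', hO'O.trans hOO, hO', htO, T', hT'O, hT'M, hT'cl, hT'⟩
          obtain ⟨s, hs, hs'⟩ := mem_closure_iff.1 (hT3 t htP (hW3 t htP)) O hO (hO'O htO)
          exact ⟨s, mem_biUnion htP hs', hs⟩)
    exact hno ⟨O₀, hO₀V, hO₀ne, A, fun n => (hR n).1, fun n => (hR n).2, hdis⟩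
  -- Step 6
  obtain ⟨_, _⟩ := exists_wellOrder X
  choose! B hB1 hB2 using hc
  let B' : X → Set X := fun y => {z | y ∈ V ∧ z ∈ B y}
  have hB' : ∀ y, #(B' y) ≤ κ := by
    intro y
    by_cases hy : y ∈ V
    · exact (Cardinal.mk_le_mk_of_subset (fun z hz => hz.2)).trans (hB1 y hy)
    · have : B' y = ∅ := by ext z; simp [B', hy]
      rw [this]; simp
  obtain ⟨r, hr1, hr2, hr3⟩ := exists_rank hκ B' hB' M hM
  let Y : Set X := {y | y ∈ Q ∧ y ∈ O₁ ∧ y ∉ M}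
  have hanti : ∀ k j, j ≤ k → QQ r Y k ⊆ QQ r Y j := by
    intro k j hjk
    induction hjk with
    | refl => exact Subset.rfl
    | step _ ih => exact Subset.trans diff_subset ih
  have hsub : ∀ k, QQ r Y k ⊆ Y := fun k => hanti k 0 (Nat.zero_le k)
  have hbig : ∀ k, O₁ ⊆ closure (QQ r Y k) → ∀ O ⊆ O₁, IsOpen O → O.Nonempty →
      κ < #(QQ r Y k ∩ O : Set X) := by
    intro k hk O hOO hO hOne
    rw [← not_le]
    apply hOM O hOO hO hOne
    · exact fun x hx => (hsub k hx.1).1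
    · rw [Set.disjoint_left]
      exact fun x hx => (hsub k hx.1).2.2
    · exact inter_subset_right
    · apply subset_closure_of hO
      intro O' h1 h2 h3
      obtain ⟨x, hx, hx'⟩ := inter_nonempty_of hk (h1.trans hOO) h2 h3
      exact ⟨x, ⟨hx, h1 hx'⟩, hx'⟩
  have hdense : ∀ k, O₁ ⊆ closure (QQ r Y k) := by
    intro k
    induction k with
    | zero =>
      apply subset_closure_of hO₁
      intro O hOO hO hOne
      have h1 := ha O (hOO.trans hO₁V) hO hOne
      by_contra hemp
      apply h1.not_ge
      refine (Cardinal.mk_le_mk_of_subset ?_).trans hM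
      intro x hx
      by_contra hxM
      exact hemp ⟨x, ⟨hx.1, hOO hx.2, hxM⟩, hx.2⟩
    | succ k ih =>
      apply subset_closure_of hO₁
      intro O hOO hO hOne
      obtain ⟨p, hp⟩ := hOne
      obtain ⟨F, hF, hFc, hFO⟩ := exists_mem_nhds_isClosed_subset (hO.mem_nhds hp)
      have hbk := hbig k ih (interior F) (interior_subset.trans (hFO.trans hOO)) isOpen_interior
        ⟨p, mem_interior_iff_mem_nhds.2 hF⟩
      obtain ⟨A, hAY, hAκ, hinj⟩ := exists_inj_subset hκ r hr1 hbk
      obtain ⟨y, hy⟩ := exists_acc hcd hAκ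
      have hAQ : A ⊆ Q := fun x hx => (hsub k (hAY hx).1).1
      have hyF : y ∈ F := by
        have : closure (A \ {y}) ⊆ F :=
          closure_minimal (fun x hx => interior_subset (hAY hx.1).2) hFc
        exact this hy
      have hyO : y ∈ O := hFO hyF
      have hyV : y ∈ V := hO₁V (hOO hyO)
      have hyQ : y ∈ Q := hb A hAQ hAκ.le ⟨closure_mono diff_subset hy, hyV⟩
      have hycl : y ∈ closure {x | x ∈ QQ r Y k ∧ r x < r y} := by
        have hcov : A \ {y} ⊆ {x | x ∈ QQ r Y k ∧ r x < r y} ∪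
            ({x | x ∈ A ∧ r y < r x} ∪ {x | x ∈ A ∧ r x = r y ∧ x ≠ y}) := by
          intro x hx
          rcases lt_trichotomy (r x) (r y) with h | h | h
          · exact Or.inl ⟨(hAY hx.1).1, h⟩
          · exact Or.inr (Or.inr ⟨hx.1, h, hx.2⟩)
          · exact Or.inr (Or.inl ⟨hx.1, h⟩)
        have h2 := closure_mono hcov hy
        rw [closure_union, closure_union] at h2
        rcases h2 with h2 | h2 | h2
        · exact h2
        · exfalso
          refine hB2 y hyV {x | x ∈ A ∧ r y < r x} (fun x hx => hAQ hx.1)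
            ((Cardinal.mk_le_mk_of_subset (fun x hx => hx.1)).trans hAκ.le) ?_ h2
          rw [Set.disjoint_left]
          intro x hx hxB
          exact hr2 y x hx.2 ⟨hyV, hxB⟩
        · exfalso
          have hss : {x | x ∈ A ∧ r x = r y ∧ x ≠ y}.Subsingleton := by
            intro x hx x' hx'
            exact hinj hx.1 hx'.1 (hx.2.1.trans hx'.2.1.symm)
          rw [hss.isClosed.closure_eq] at h2
          exact h2.2.2 rfl
      have hyM : y ∉ M := by
        intro hyM
        obtain ⟨x, -, hx⟩ := closure_nonempty_iff.1 ⟨y, hycl⟩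
        exact hr3 y hyM x hx
      have hmem : ∀ j, j ≤ k + 1 → y ∈ QQ r Y j := by
        intro j
        induction j with
        | zero => exact fun _ => ⟨hyQ, hOO hyO, hyM⟩
        | succ j ihj =>
          intro hj
          refine ⟨ihj (by omega), fun hE : y ∈ E r (QQ r Y j) => hE.2 ?_⟩
          refine closure_mono ?_ hycl
          intro x hx
          exact ⟨hanti k j (by omega) hx.1, hx.2⟩
      exact ⟨y, hmem _ le_rfl, hyO⟩
  refine hno ⟨O₁, hO₁V, hO₁ne, fun k => E r (QQ r Y k), ?_, ?_, ?_⟩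
  · exact fun k x hx => (hsub k hx.1).2.1
  · intro k
    apply subset_closure_of hO₁
    intro O hOO hO hOne
    have hne := inter_nonempty_of (hdense k) hOO hO hOne
    obtain ⟨y, hy, hmin⟩ := WellFounded.has_min (InvImage.wf r (wellFounded_lt (α := X))) _ hne
    refine ⟨y, ⟨hy.1, fun hycl => ?_⟩, hy.2⟩
    obtain ⟨x, hxO, hx⟩ := mem_closure_iff.1 hycl O hO hy.2
    exact hmin x ⟨hx.1, hxO⟩ hx.2
  · have key : ∀ m n, m < n → Disjoint (E r (QQ r Y m)) (E r (QQ r Y n)) := by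
      intro m n hmn
      rw [Set.disjoint_left]
      intro x hx hx'
      exact (hanti n (m + 1) hmn hx'.1).2 hx
    intro m n hmn
    rcases lt_or_gt_of_ne hmn with h | h
    · exact key m n h
    · exact (key n m h).symm

/-- iterates of `G` -/
def XX {X : Type u} [TopologicalSpace X] (κ : Cardinal.{u}) : ℕ → Set X
  | 0 => univ
  | n + 1 => G κ (XX κ n)

theorem main {X : Type u} [TopologicalSpace X] [T3Space X] {κ : Cardinal.{u}} (hκ : ℵ₀ ≤ κ)
    (hcd : ∀ D : Set X, IsClosed D → DiscreteTopology ↥D → #D ≠ κ)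
    (hΔ : ∀ O : Set X, IsOpen O → O.Nonempty → κ < #O)
    (O₀ : Set X) (hO₀ : IsOpen O₀) (hO₀ne : O₀.Nonempty) :
    ∃ S : Set X, S ⊆ O₀ ∧ S.Nonempty ∧ OR S := by
  by_contra hno
  have hstep : ∀ k, XX (X := X) κ (k + 1) ⊆ XX κ k := by
    intro k
    induction k with
    | zero => exact subset_univ _
    | succ k ih => exact G_mono ih
  have hanti : Antitone (XX (X := X) κ) := antitone_nat_of_succ_le hstep
  have hex : ∃ k, ¬ O₀ ⊆ closure (XX κ k) := by
    by_contra hall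
    push Not at hall
    refine hno ⟨O₀, Subset.rfl, hO₀ne, fun k => (XX κ k \ XX κ (k + 1)) ∩ O₀,
      fun k => inter_subset_right, ?_, ?_⟩
    · intro k
      apply subset_closure_of hO₀
      intro W hWO hW hWne
      by_contra hemp
      have hsub : W ∩ XX κ k ⊆ G κ (W ∩ XX κ k) := by
        intro x hx
        apply G_local hW hx.1
        by_contra hxG
        exact hemp ⟨x, ⟨⟨hx.2, hxG⟩, hWO hx.1⟩, hx.1⟩
      have hne := inter_nonempty_of (hall k) hWO hW hWne
      rw [inter_comm] at hne
      obtain ⟨S, h1, h2, h3⟩ := OR_of_selfgood hκ hsub hne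
      exact hno ⟨S, fun x hx => hWO (h1 hx).1, h2, h3⟩
    · have key : ∀ m n, m < n → Disjoint ((XX κ m \ XX κ (m + 1)) ∩ O₀)
          ((XX κ n \ XX κ (n + 1)) ∩ O₀) := by
        intro m n hmn
        rw [Set.disjoint_left]
        intro x hx hx'
        exact hx.1.2 (hanti hmn hx'.1.1)
      intro m n hmn
      rcases lt_or_gt_of_ne hmn with h | h
      · exact key m n h
      · exact (key n m h).symm
  obtain ⟨k, hk, hk'⟩ : ∃ k, O₀ ⊆ closure (XX κ k) ∧ ¬ O₀ ⊆ closure (XX κ (k + 1)) := by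
    by_contra hcon
    push Not at hcon
    obtain ⟨k, hk⟩ := hex
    apply hk
    clear hk
    induction k with
    | zero => simp [XX]
    | succ k ih => exact hcon k ih
  obtain ⟨x, hxO, hx⟩ := not_subset.1 hk'
  let V : Set X := O₀ ∩ (closure (XX κ (k + 1)))ᶜ
  have hV : IsOpen V := hO₀.inter isClosed_closure.isOpen_compl
  have hVO : V ⊆ O₀ := inter_subset_left
  have hclosed : ∀ A ⊆ XX (X := X) κ k, #A ≤ κ → closure A ⊆ XX κ k := by
    intro A hA hAs
    cases k with
    | zero => exact subset_univ _
    | succ j => exact G_closed hκ hAs hA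
  have hbig : ∀ O ⊆ V, IsOpen O → O.Nonempty → κ < #(XX κ k ∩ O : Set X) := by
    intro O hOV hO hOne
    cases k with
    | zero => simpa [XX] using hΔ O hO hOne
    | succ j =>
      by_contra hle
      rw [not_lt] at hle
      obtain ⟨A, U, hR, -, hdis⟩ := seq_exists hκ
        (fun M T : Set X => XX κ (j + 1) ∩ O ⊆ closure T) (by
          intro M hM
          obtain ⟨T, h1, -, h3, h4⟩ := G_many hκ hle (Y := XX κ j) inter_subset_left hM
          exact ⟨T, h1, h3, h4⟩)
      refine hno ⟨O, hOV.trans hVO, hOne, fun n => A n ∩ O, fun n => inter_subset_right, ?_, ?_⟩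
      · intro n
        apply subset_closure_of hO
        intro O' h1 h2 h3
        obtain ⟨z, hz, hz'⟩ := inter_nonempty_of hk ((h1.trans hOV).trans hVO) h2 h3
        obtain ⟨a, ha, ha'⟩ := mem_closure_iff.1 (hR n ⟨hz, h1 hz'⟩) O' h2 hz'
        exact ⟨a, ⟨ha', h1 ha⟩, ha⟩
      · intro m n hmn
        exact (hdis hmn).mono inter_subset_left inter_subset_left
  obtain ⟨S, h1, h2, h3⟩ := core hκ hcd (V := V) (Q := XX κ k) hV ⟨x, hxO, hx⟩ hbig
    (fun A hA hAs y hy => hclosed A hA hAs hy.1) (by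
      intro y hy
      by_contra hcon
      push Not at hcon
      apply hy.2
      apply subset_closure
      intro B hB
      obtain ⟨A, hA1, hA2, hA3, hA4⟩ := hcon B hB
      exact ⟨A, hA2, hA1, hA3, hA4⟩)
  exact hno ⟨S, h1.trans hVO, h2, h3⟩

end OmegaResProof

/-- A `T₃` space with `Δ(X) > ê(X)` is `ω`-resolvable. -/
theorem stmt18 {X : Type u} [TopologicalSpace X] [T3Space X]
    (h : hatExtent X < dispersion X) :
    Resolvable X ℵ₀ := by
  have hne : {κ : Cardinal.{u} | ℵ₀ ≤ κ ∧ ∀ D : Set X, IsClosed D → DiscreteTopology ↥D →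
      #D ≠ κ}.Nonempty := by
    refine ⟨Order.succ (max ℵ₀ #X), (le_max_left _ _).trans (Order.le_succ _), ?_⟩
    intro D _ _ hD
    have h1 : #D ≤ #X := Cardinal.mk_set_le D
    have h2 : max ℵ₀ #X < #D := by rw [hD]; exact Order.lt_succ _
    exact absurd ((le_max_right _ _).trans_lt h2) h1.not_gt
  obtain ⟨hκ, hcd⟩ := csInf_mem hne
  apply OmegaResProof.resolvable_of_OR
  intro O hO hOne
  refine OmegaResProof.main hκ hcd ?_ O hO hOne
  intro O' hO' hne'
  exact h.trans_le (csInf_le' ⟨O', hO', hne', rfl⟩)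
end

section
/- If X is a crowded countably compact Hausdorff space in which the regular closed subsets form a π-network, then X is ω₁-resolvable. -/
universe u

open Cardinal Set

open Topology Filter

/-- `L` is left-separated with respect to the rank function `ρ`. -/
def LS {Y : Type*} {W : Type*} [TopologicalSpace Y] [LinearOrder W] (ρ : Y → W) (L : Set Y) :
    Prop :=
  ∀ x ∈ L, ∃ U : Set Y, IsOpen U ∧ x ∈ U ∧ ∀ y ∈ L, y ∈ U → ρ x ≤ ρ y

lemma greedy {Y : Type*} {W : Type*} [LinearOrder W] [WellFoundedLT W]
    (ρ : Y → W) (A : Set Y) (O : Y → Set Y) :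
    ∃ D : Set Y, ∀ y, y ∈ D ↔ (y ∈ A ∧ ∀ z, ρ z < ρ y → z ∈ D → y ∉ O z) := by
  have wf : WellFounded (fun a b : Y => ρ a < ρ b) := InvImage.wf ρ wellFounded_lt
  let P : Y → Prop := wf.fix (fun y rec => y ∈ A ∧ ∀ z, ∀ h : ρ z < ρ y, rec z h → y ∉ O z)
  refine ⟨{y | P y}, fun y => ?_⟩
  have := wf.fix_eq (C := fun _ => Prop)
    (fun y rec => y ∈ A ∧ ∀ z, ∀ h : ρ z < ρ y, rec z h → y ∉ O z) y
  exact iff_of_eq this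

lemma chain_cover {Y : Type*} {W : Type*} {ι : Type*} [TopologicalSpace Y] [T1Space Y]
    [CountablyCompactSpace Y]
    [LinearOrder W] [WellFoundedLT W] (ρ : Y → W) (hρ : Function.Injective ρ)
    (L : ℕ → Set Y) (hL : ∀ n, LS ρ (L n)) (hcov : ∀ y, ∃ n, y ∈ L n)
    [LinearOrder ι] [WellFoundedLT ι] [Nonempty ι] (U : ι → Set Y) (hU : ∀ i, IsOpen (U i))
    (hmono : Monotone U) (hUc : ∀ y, ∃ i, y ∈ U i) : ∃ i, ∀ y, y ∈ U i := by
  classical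
  -- minimal index
  have hmin : ∀ y, ∃ i, y ∈ U i ∧ ∀ j, y ∈ U j → i ≤ j := by
    intro y
    obtain ⟨i, hi, hi2⟩ := (wellFounded_lt (α := ι)).has_min {i | y ∈ U i} (hUc y)
    exact ⟨i, hi, fun j hj => not_lt.1 (hi2 j hj)⟩
  choose a ha ha2 using hmin
  have hN : ∀ n y, ∃ N : Set Y, IsOpen N ∧ y ∈ N ∧ (y ∈ L n → ∀ z ∈ L n, z ∈ N → ρ y ≤ ρ z) := by
    intro n y
    by_cases hy : y ∈ L n
    · obtain ⟨N, h1, h2, h3⟩ := hL n y hy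
      exact ⟨N, h1, h2, fun _ => h3⟩
    · exact ⟨Set.univ, isOpen_univ, mem_univ _, fun h => absurd h hy⟩
  choose N hNo hNm hNs using hN
  let O : ℕ → Y → Set Y := fun n y => N n y ∩ U (a y)
  have hOo : ∀ n y, IsOpen (O n y) := fun n y => (hNo n y).inter (hU _)
  have hOm : ∀ n y, y ∈ O n y := fun n y => ⟨hNm n y, ha y⟩
  have hD : ∀ n (H : Set Y), ∃ D : Set Y, D ⊆ L n ∩ H ∧
      (∀ y ∈ L n, y ∈ H → ∃ z ∈ D, y ∈ O n z) ∧ ∀ y ∈ D, ∀ z ∈ D, z ∈ O n y → z = y := by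
    intro n H
    obtain ⟨D, hD⟩ := greedy ρ (L n ∩ H) (O n)
    refine ⟨D, fun y hy => ((hD y).1 hy).1, ?_, ?_⟩
    · intro y hyL hyH
      by_cases hy : y ∈ D
      · exact ⟨y, hy, hOm n y⟩
      · by_contra hcon
        push Not at hcon
        exact hy ((hD y).2 ⟨⟨hyL, hyH⟩, fun z _ hz => hcon z hz⟩)
    · intro y hy z hz hzO
      rcases lt_trichotomy (ρ z) (ρ y) with h | h | h
      · exact absurd (hNs n y ((hD y).1 hy).1.1 z ((hD z).1 hz).1.1 hzO.1) (not_le.2 h)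
      · exact hρ h
      · exact absurd hzO (((hD z).1 hz).2 y h hy)
  choose D hDs hDc hDd using hD
  obtain ⟨H, hH0, hHs⟩ : ∃ H : ℕ → Set Y, H 0 = Set.univ ∧
      ∀ n, H (n+1) = H n \ ⋃ y ∈ D n (H n), O n y :=
    ⟨fun n => Nat.rec Set.univ (fun n H => H \ ⋃ y ∈ D n H, O n y) n, rfl, fun n => rfl⟩
  have hHcl : ∀ n, IsClosed (H n) := by
    intro n
    induction n with
    | zero => rw [hH0]; exact isClosed_univ
    | succ n ih =>
      rw [hHs]
      exact ih.sdiff (isOpen_biUnion fun y _ => hOo n y)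
  have hHanti : Antitone H := antitone_nat_of_succ_le fun n => by
    rw [hHs]; exact sdiff_subset
  have hend : ∃ n, H n = ∅ := by
    obtain ⟨n, hn⟩ := (CountablyCompactSpace.isCountablyCompact_univ (E := Y)).elim_directed_cover
      (fun n => (H n)ᶜ) (fun n => (hHcl n).isOpen_compl) (by
        intro y _
        obtain ⟨n, hn⟩ := hcov y
        refine mem_iUnion.2 ⟨n+1, ?_⟩
        intro hy
        rw [hHs] at hy
        obtain ⟨z, hz, hyz⟩ := hDc n (H n) y hn hy.1
        exact hy.2 (mem_biUnion hz hyz))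
      (directed_of_isDirected_le fun m n h => compl_subset_compl.2 (hHanti h))
    exact ⟨n, eq_empty_of_forall_notMem fun y hy => hn (mem_univ y) hy⟩
  obtain ⟨n, hn⟩ := hend
  have step : ∀ k, (∃ i, H (k+1) ⊆ U i) → ∃ i, H k ⊆ U i := by
    rintro k ⟨i, hi⟩
    have hfin : (D k (H k) \ U i).Finite := by
      by_contra hinf
      obtain ⟨z, -, hz⟩ := (CountablyCompactSpace.isCountablyCompact_univ
        (E := Y)).exists_accPt_of_infinite (subset_univ _) hinf
      rw [accPt_iff_nhds] at hz
      by_cases hzi : z ∈ U i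
      · obtain ⟨y, hy, -⟩ := hz _ ((hU i).mem_nhds hzi)
        exact hy.2.2 hy.1
      by_cases hzk : z ∈ H k
      · have : z ∈ ⋃ y ∈ D k (H k), O k y := by
          by_contra hcon
          exact hzi (hi (by rw [hHs]; exact ⟨hzk, hcon⟩))
        simp only [mem_iUnion] at this
        obtain ⟨y, hy, hzy⟩ := this
        by_cases hyz : z = y
        · obtain ⟨w, hw, hwz⟩ := hz _ ((hOo k y).mem_nhds hzy)
          exact hwz ((hDd k _ y hy w hw.2.1 hw.1).trans hyz.symm)
        · obtain ⟨w, hw, hwz⟩ := hz _ (((hOo k y).inter (isOpen_compl_singleton (x := y))).mem_nhds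
            ⟨hzy, hyz⟩)
          exact hw.1.2 (hDd k _ y hy w hw.2.1 hw.1.1)
      · obtain ⟨y, hy, -⟩ := hz _ ((hHcl k).isOpen_compl.mem_nhds hzk)
        exact hy.1 (hDs k _ hy.2.1).2
    obtain ⟨j, hj⟩ : ∃ j, ∀ y ∈ D k (H k) \ U i, a y ≤ j := by
      obtain ⟨j, hj⟩ := (hfin.image a).bddAbove
      exact ⟨j, fun y hy => hj (mem_image_of_mem a hy)⟩
    refine ⟨max i j, fun y hy => ?_⟩
    by_cases hy1 : y ∈ H (k+1)
    · exact hmono (le_max_left _ _) (hi hy1)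
    · rw [hHs] at hy1
      have : y ∈ ⋃ y ∈ D k (H k), O k y := by
        by_contra hcon
        exact hy1 ⟨hy, hcon⟩
      simp only [mem_iUnion] at this
      obtain ⟨z, hz, hyz⟩ := this
      refine hmono ?_ hyz.2
      by_cases hzi : z ∈ U i
      · exact (ha2 z i hzi).trans (le_max_left _ _)
      · exact (hj z ⟨hz, hzi⟩).trans (le_max_right _ _)
  have all : ∀ m, (∃ i, H m ⊆ U i) → ∃ i, H 0 ⊆ U i := by
    intro m
    induction m with
    | zero => exact id
    | succ m ih => exact fun h => ih (step m h)
  obtain ⟨i, hi⟩ := all n ⟨Classical.arbitrary ι, by rw [hn]; exact empty_subset _⟩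
  exact ⟨i, fun y => hi (hH0 ▸ mem_univ y)⟩

lemma compact_of_LS {Y : Type*} {W : Type*} [TopologicalSpace Y] [T1Space Y]
    [CountablyCompactSpace Y]
    [LinearOrder W] [WellFoundedLT W] (ρ : Y → W) (hρ : Function.Injective ρ)
    (L : ℕ → Set Y) (hL : ∀ n, LS ρ (L n)) (hcov : ∀ y, ∃ n, y ∈ L n) : CompactSpace Y := by
  classical
  refine ⟨isCompact_of_finite_subcover fun {ι} V hV hVc => ?_⟩
  let _ : LinearOrder ι := linearOrderOfSTO (WellOrderingRel (α := ι))
  have : WellFoundedLT ι := ⟨(WellOrderingRel.isWellOrder (α := ι)).wf⟩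
  by_contra hno
  push Not at hno
  -- nothing of the form initial segment + finite set covers
  have key : ∀ i : ι, ∀ t : Finset ι, ¬ (∀ y, (∃ j < i, y ∈ V j) ∨ ∃ j ∈ t, y ∈ V j) := by
    intro i
    induction i using WellFoundedLT.induction with
    | ind i ih =>
      intro t hcon
      by_cases hne : Nonempty (Iio i)
      · obtain ⟨k, hk⟩ := chain_cover ρ hρ L hL hcov (ι := Iio i)
          (fun k => {y | (∃ j ≤ k.1, y ∈ V j) ∨ ∃ j ∈ t, y ∈ V j})
          (fun k => by
            have : {y | (∃ j ≤ k.1, y ∈ V j) ∨ ∃ j ∈ t, y ∈ V j} =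
              (⋃ j ≤ k.1, V j) ∪ ⋃ j ∈ t, V j := by ext y; simp
            rw [this]
            exact (isOpen_biUnion fun j _ => hV j).union (isOpen_biUnion fun j _ => hV j))
          (by
            rintro k l hkl y (⟨j, hj, hy⟩ | h)
            · exact Or.inl ⟨j, hj.trans hkl, hy⟩
            · exact Or.inr h)
          (by
            intro y
            rcases hcon y with ⟨j, hj, hy⟩ | h
            · exact ⟨⟨j, hj⟩, Or.inl ⟨j, le_rfl, hy⟩⟩
            · exact ⟨Classical.arbitrary _, Or.inr h⟩)
        refine ih k.1 k.2 (insert k.1 t) fun y => ?_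
        rcases hk y with ⟨j, hj, hy⟩ | ⟨j, hj, hy⟩
        · rcases hj.lt_or_eq with h | h
          · exact Or.inl ⟨j, h, hy⟩
          · exact Or.inr ⟨j, by simp [h], hy⟩
        · exact Or.inr ⟨j, by simp [hj], hy⟩
      · refine hno t fun y _ => ?_
        rcases hcon y with ⟨j, hj, hy⟩ | ⟨j, hj, hy⟩
        · exact absurd ⟨⟨j, hj⟩⟩ hne
        · exact mem_biUnion hj hy
  by_cases hne : Nonempty ι
  · obtain ⟨k, hk⟩ := chain_cover ρ hρ L hL hcov (ι := ι)
      (fun k => {y | ∃ j ≤ k, y ∈ V j})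
      (fun k => by
        have : {y | ∃ j ≤ k, y ∈ V j} = (⋃ j ≤ k, V j) := by ext y; simp
        rw [this]
        exact (isOpen_biUnion fun j _ => hV j))
      (by
        rintro k l hkl y ⟨j, hj, hy⟩
        exact ⟨j, hj.trans hkl, hy⟩)
      (by
        intro y
        obtain ⟨j, hj⟩ := mem_iUnion.1 (hVc (mem_univ y))
        exact ⟨j, j, le_rfl, hj⟩)
    refine key k {k} fun y => ?_
    obtain ⟨j, hj, hy⟩ := hk y
    rcases hj.lt_or_eq with h | h
    · exact Or.inl ⟨j, h, hy⟩
    · exact Or.inr ⟨j, by simp [h], hy⟩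
  · refine hno ∅ fun y hy => ?_
    obtain ⟨j, hj⟩ := mem_iUnion.1 (hVc hy)
    exact absurd ⟨j⟩ hne

lemma meagre_step {Y : Type*} {W : Type*} [TopologicalSpace Y] [LinearOrder W]
    (ρ : Y → W) (B : ℕ → Set Y) (hBn : ∀ n, (B n).Nonempty)
    (hBπ : ∀ U : Set Y, IsOpen U → U.Nonempty → ∃ n, B n ⊆ U) (hBo : ∀ n, IsOpen (B n))
    (M : Set Y) (hM : LS ρ M) (h : ∀ x ∈ M, IsMeagre {y ∈ M | ρ y ≤ ρ x}) : IsMeagre M := by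
  have h1 : IsMeagre (M \ interior (closure M)) := by
    apply IsNowhereDense.isMeagre
    rw [isNowhereDense_iff_disjoint]
    rw [Set.disjoint_left]
    intro y hy hy2
    exact hy.2 (interior_mono (closure_mono sdiff_subset) hy2)
  have hz : ∀ n, ∃ S : Set Y, IsMeagre S ∧ ((B n ∩ M).Nonempty →
      ∃ z ∈ B n ∩ M, S = {y ∈ M | ρ y ≤ ρ z}) := by
    intro n
    by_cases hne : (B n ∩ M).Nonempty
    · obtain ⟨z, hz⟩ := hne
      exact ⟨_, h z hz.2, fun _ => ⟨z, hz, rfl⟩⟩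
    · exact ⟨∅, IsMeagre.empty, fun h => absurd h hne⟩
  choose S hS hS2 using hz
  refine IsMeagre.mono ?_ (h1.union (isMeagre_iUnion hS))
  intro y hy
  by_cases hyi : y ∈ interior (closure M)
  · right
    obtain ⟨U, hUo, hyU, hU⟩ := hM y hy
    obtain ⟨n, hn⟩ := hBπ (U ∩ interior (closure M)) (hUo.inter isOpen_interior) ⟨y, hyU, hyi⟩
    obtain ⟨b, hb⟩ := hBn n
    have hne : (B n ∩ M).Nonempty :=
      mem_closure_iff.1 (interior_subset (hn hb).2) _ (hBo n) hb
    obtain ⟨z, hz, hSz⟩ := hS2 n hne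
    refine mem_iUnion.2 ⟨n, ?_⟩
    rw [hSz]
    exact ⟨hy, hU z hz.2 (hn hz.1).1⟩
  · exact Or.inl ⟨hy, hyi⟩

lemma LS.mono {Y : Type*} {W : Type*} [TopologicalSpace Y] [LinearOrder W]
    {ρ : Y → W} {M L : Set Y} (hL : LS ρ L) (h : M ⊆ L) : LS ρ M := by
  intro x hx
  obtain ⟨U, h1, h2, h3⟩ := hL x (h hx)
  exact ⟨U, h1, h2, fun y hy => h3 y (h hy)⟩

lemma meagre_of_LS {Y : Type*} {W : Type*} [TopologicalSpace Y] [T1Space Y] [LinearOrder W]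
    [WellFoundedLT W] (ρ : Y → W) (hρ : Function.Injective ρ)
    (hcr : ∀ x : Y, ¬ IsOpen ({x} : Set Y)) (B : ℕ → Set Y) (hBn : ∀ n, (B n).Nonempty)
    (hBπ : ∀ U : Set Y, IsOpen U → U.Nonempty → ∃ n, B n ⊆ U) (hBo : ∀ n, IsOpen (B n))
    (M : Set Y) (hM : LS ρ M) : IsMeagre M := by
  have key : ∀ w : W, IsMeagre {y ∈ M | ρ y ≤ w} := by
    intro w
    induction w using WellFoundedLT.induction with
    | ind w ih =>
      have h1 : IsMeagre {y ∈ M | ρ y < w} := by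
        refine meagre_step ρ B hBn hBπ hBo _ (hM.mono (sep_subset _ _)) fun x hx => ?_
        refine IsMeagre.mono ?_ (ih (ρ x) hx.2)
        intro y hy
        exact ⟨hy.1.1, hy.2⟩
      have h2 : IsMeagre {y | ρ y = w} := by
        apply IsNowhereDense.isMeagre
        by_cases hx : ∃ x, ρ x = w
        · obtain ⟨x, hx⟩ := hx
          have : {y | ρ y = w} = {x} := by
            ext y
            exact ⟨fun h => hρ (h.trans hx.symm), fun h => by rw [mem_singleton_iff.1 h]; exact hx⟩
          rw [this, (isClosed_singleton (x := x)).isNowhereDense_iff]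
          by_contra hne
          rcases subset_singleton_iff_eq.1 (interior_subset (s := ({x} : Set Y))) with h | h
          · exact hne h
          · exact hcr x (interior_eq_iff_isOpen.1 h)
        · have : {y | ρ y = w} = ∅ := eq_empty_of_forall_notMem fun y hy => hx ⟨y, hy⟩
          rw [this]
          exact isNowhereDense_empty
      refine (h1.union h2).mono ?_
      intro y hy
      rcases hy.2.lt_or_eq with h | h
      · exact Or.inl ⟨hy.1, h⟩
      · exact Or.inr h
  exact meagre_step ρ B hBn hBπ hBo M hM fun x _ => key (ρ x)

lemma no_pibase {Y : Type*} {W : Type*} [TopologicalSpace Y] [T2Space Y] [CompactSpace Y]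
    [Nonempty Y] [LinearOrder W]
    [WellFoundedLT W] (ρ : Y → W) (hρ : Function.Injective ρ)
    (hcr : ∀ x : Y, ¬ IsOpen ({x} : Set Y)) (B : ℕ → Set Y) (hBn : ∀ n, (B n).Nonempty)
    (hBπ : ∀ U : Set Y, IsOpen U → U.Nonempty → ∃ n, B n ⊆ U) (hBo : ∀ n, IsOpen (B n))
    (L : ℕ → Set Y) (hL : ∀ n, LS ρ (L n)) (hcov : ∀ y, ∃ n, y ∈ L n) : False := by
  have h : IsMeagre (⋃ n, L n) :=
    isMeagre_iUnion fun n => meagre_of_LS ρ hρ hcr B hBn hBπ hBo _ (hL n)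
  have h2 : (⋃ n, L n) = Set.univ := eq_univ_of_forall fun y => mem_iUnion.2 (hcov y)
  rw [h2] at h
  exact not_isMeagre_of_isOpen isOpen_univ univ_nonempty h

lemma LS.preimage {Y Z : Type*} {W : Type*} [TopologicalSpace Y] [TopologicalSpace Z]
    [LinearOrder W] {ρ : Y → W} {L : Set Y} (hL : LS ρ L) {p : Z → Y} (hp : Continuous p) :
    LS (ρ ∘ p) (p ⁻¹' L) := by
  intro x hx
  obtain ⟨U, h1, h2, h3⟩ := hL (p x) hx
  exact ⟨p ⁻¹' U, h1.preimage hp, h2, fun y hy hyU => h3 (p y) hy hyU⟩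

lemma cantor_not_isolated (a : ℕ → Bool) : ¬ IsOpen ({a} : Set (ℕ → Bool)) := by
  intro h
  rw [isOpen_pi_iff] at h
  obtain ⟨I, u, hu, hI⟩ := h a rfl
  obtain ⟨n, hn⟩ := Infinite.exists_notMem_finset I
  have : Function.update a n (!a n) ∈ ({a} : Set (ℕ → Bool)) := by
    apply hI
    intro i hi
    have : i ≠ n := fun h => hn (h ▸ hi)
    rw [Function.update_of_ne this]
    exact (hu i hi).2
  have h2 := congrFun (mem_singleton_iff.1 this) n
  simp at h2

lemma irreducible_case {Y : Type*} {W : Type*} [TopologicalSpace Y] [T2Space Y] [CompactSpace Y]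
    [LinearOrder W] [WellFoundedLT W] (ρ : Y → W) (hρ : Function.Injective ρ)
    (f : Y → (ℕ → Bool)) (hf : Continuous f) (hfs : Function.Surjective f)
    (L : ℕ → Set Y) (hL : ∀ n, LS ρ (L n)) (hcov : ∀ y, ∃ n, y ∈ L n) : False := by
  obtain ⟨E, hEc, hEs, hEi⟩ := exists_compact_surjective_zorn_subset
    (X := fun y => (ULift.up (f y) : ULift (ℕ → Bool)))
    (continuous_uliftUp.comp hf) (ULift.up_surjective.comp hfs)
  let g : E → (ℕ → Bool) := fun x => f x
  have hg : Continuous g := hf.comp continuous_subtype_val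
  have hgs : Function.Surjective g := by
    intro a
    have : ULift.up a ∈ (fun y => (ULift.up (f y) : ULift (ℕ → Bool))) '' E := by
      rw [hEs]; trivial
    obtain ⟨x, hx, hxa⟩ := this
    exact ⟨⟨x, hx⟩, ULift.up_injective hxa⟩
  have hgi : ∀ U : Set E, IsOpen U → U.Nonempty →
      ∃ V : Set (ℕ → Bool), IsOpen V ∧ V.Nonempty ∧ g ⁻¹' V ⊆ U := by
    intro U hU hne
    have h1 : Uᶜ ≠ Set.univ := fun h => by
      obtain ⟨x, hx⟩ := hne
      have : x ∈ Uᶜ := by rw [h]; trivial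
      exact this hx
    have h2 := hEi Uᶜ h1 hU.isClosed_compl
    have h2' : g '' Uᶜ ≠ Set.univ := by
      intro hall
      apply h2
      refine eq_univ_of_forall ?_
      rintro ⟨c⟩
      obtain ⟨x, hx, hxc⟩ : c ∈ g '' Uᶜ := by rw [hall]; trivial
      exact ⟨x, hx, congrArg ULift.up hxc⟩
    refine ⟨(g '' Uᶜ)ᶜ, (hU.isClosed_compl.isCompact.image hg).isClosed.isOpen_compl,
      nonempty_compl.2 h2', ?_⟩
    intro x hx
    by_contra hxU
    exact hx ⟨x, hxU, rfl⟩
  have hcr : ∀ x : E, ¬ IsOpen ({x} : Set E) := by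
    intro x hx
    obtain ⟨V, hV, ⟨b, hb⟩, hVs⟩ := hgi _ hx (singleton_nonempty x)
    have : V = {g x} := by
      have h3 : ∀ c ∈ V, c = g x := by
        intro c hc
        obtain ⟨y, rfl⟩ := hgs c
        rw [mem_singleton_iff.1 (hVs hc)]
      ext c
      refine ⟨fun hc => h3 c hc, fun hc => ?_⟩
      rw [mem_singleton_iff.1 hc, ← h3 b hb]
      exact hb
    exact cantor_not_isolated (g x) (this ▸ hV)
  obtain ⟨b, hbc, hbe, hbb⟩ := TopologicalSpace.exists_countable_basis (ℕ → Bool)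
  have hbne : b.Nonempty := by
    obtain ⟨v, hv, -⟩ := hbb.exists_subset_of_mem_open (mem_univ (fun _ => true)) isOpen_univ
    exact ⟨v, hv⟩
  obtain ⟨B, hB⟩ := hbc.exists_eq_range hbne
  have hBb : ∀ n, B n ∈ b := fun n => by rw [hB]; exact mem_range_self n
  have : Nonempty E := ⟨(hgs (fun _ => true)).choose⟩
  refine no_pibase (Y := E) (ρ ∘ (Subtype.val : E → Y)) (hρ.comp Subtype.val_injective) hcr
    (fun n => g ⁻¹' B n) ?_ ?_ ?_ (fun n => Subtype.val ⁻¹' L n)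
    (fun n => (hL n).preimage continuous_subtype_val) (fun y => hcov y.1)
  · intro n
    obtain ⟨c, hc⟩ : (B n).Nonempty := nonempty_iff_ne_empty.2 fun h => hbe (h ▸ hBb n)
    obtain ⟨y, rfl⟩ := hgs c
    exact ⟨y, hc⟩
  · intro U hU hne
    obtain ⟨V, hV, ⟨c, hc⟩, hVs⟩ := hgi U hU hne
    obtain ⟨v, hv, -, hvV⟩ := hbb.exists_subset_of_mem_open hc hV
    rw [hB] at hv
    obtain ⟨n, rfl⟩ := hv
    exact ⟨n, (preimage_mono hvV).trans hVs⟩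
  · intro n
    exact (hbb.isOpen (hBb n)).preimage hg

lemma split_open {Y : Type*} [TopologicalSpace Y] [T2Space Y] [CompactSpace Y]
    (hcr : ∀ x : Y, ¬ IsOpen ({x} : Set Y)) (V : Set Y) (hV : IsOpen V) (hne : V.Nonempty) :
    ∃ T : Bool → Set Y, (∀ b, IsOpen (T b) ∧ (T b).Nonempty ∧ closure (T b) ⊆ V) ∧
      Disjoint (closure (T true)) (closure (T false)) := by
  obtain ⟨x, hx⟩ := hne
  obtain ⟨y, hy, hyx⟩ : ∃ y ∈ V, y ≠ x := by
    by_contra hcon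
    push Not at hcon
    apply hcr x
    have : V = {x} := by
      ext z
      exact ⟨fun h => hcon z h, fun h => by rw [mem_singleton_iff.1 h]; exact hx⟩
    exact this ▸ hV
  obtain ⟨u, hxu, huo, v, hyv, hvo, huv⟩ := exists_open_nhds_disjoint_closure hyx
  have sh : ∀ z ∈ V, ∃ s : Set Y, IsOpen s ∧ z ∈ s ∧ closure s ⊆ V := by
    intro z hz
    obtain ⟨t, ht, htc, htV⟩ := exists_mem_nhds_isClosed_subset (hV.mem_nhds hz)
    exact ⟨interior t, isOpen_interior, mem_interior_iff_mem_nhds.2 ht,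
      (closure_minimal interior_subset htc).trans htV⟩
  obtain ⟨s, hso, hys, hsV⟩ := sh y hy
  obtain ⟨t, hto, hxt, htV⟩ := sh x hx
  refine ⟨fun b => if b then s ∩ u else t ∩ v, ?_, ?_⟩
  · intro b
    cases b
    · simp only [Bool.false_eq_true, if_false]
      exact ⟨hto.inter hvo, ⟨x, hxt, hyv⟩, (closure_mono inter_subset_left).trans htV⟩
    · simp only [if_true]
      exact ⟨hso.inter huo, ⟨y, hys, hxu⟩, (closure_mono inter_subset_left).trans hsV⟩
  · simp only [if_true, Bool.false_eq_true, if_false]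
    exact huv.mono (closure_mono inter_subset_right) (closure_mono inter_subset_right)

lemma compact_case {Y : Type*} {W : Type*} [TopologicalSpace Y] [T2Space Y] [CompactSpace Y]
    [Nonempty Y] [LinearOrder W] [WellFoundedLT W] (ρ : Y → W) (hρ : Function.Injective ρ)
    (hcr : ∀ x : Y, ¬ IsOpen ({x} : Set Y))
    (L : ℕ → Set Y) (hL : ∀ n, LS ρ (L n)) (hcov : ∀ y, ∃ n, y ∈ L n) : False := by
  classical
  let P := {V : Set Y // IsOpen V ∧ V.Nonempty}
  have hsp : ∀ V : P, ∃ T : Bool → P, (∀ b, closure (T b).1 ⊆ V.1) ∧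
      Disjoint (closure (T true).1) (closure (T false).1) := by
    intro V
    obtain ⟨T, hT, hd⟩ := split_open hcr V.1 V.2.1 V.2.2
    exact ⟨fun b => ⟨T b, (hT b).1, (hT b).2.1⟩, fun b => (hT b).2.2, hd⟩
  choose T hT hTd using hsp
  obtain ⟨V, hVc⟩ : ∃ V : List Bool → P, ∀ b l, V (b :: l) = T (V l) b :=
    ⟨fun l => List.rec ⟨Set.univ, isOpen_univ, univ_nonempty⟩ (fun b _ Q => T Q b) l,
      fun b l => rfl⟩
  let C : List Bool → Set Y := fun l => closure (V l).1
  have hCc : ∀ l, IsClosed (C l) := fun l => isClosed_closure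
  have hCs : ∀ b l, C (b :: l) ⊆ C l := fun b l => by
    change closure (V (b :: l)).1 ⊆ _
    rw [hVc]
    exact (hT (V l) b).trans subset_closure
  have hCd : ∀ b c l y, y ∈ C (b :: l) → y ∈ C (c :: l) → b = c := by
    intro b c l y hb hc
    change y ∈ closure (V (b :: l)).1 at hb
    change y ∈ closure (V (c :: l)).1 at hc
    rw [hVc] at hb hc
    have := fun h1 : y ∈ closure (T (V l) true).1 => Set.disjoint_left.1 (hTd (V l)) h1
    cases b <;> cases c
    · rfl
    · exact absurd hb (this hc)
    · exact absurd hc (this hb)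
    · rfl
  let K : Set (Y × (ℕ → Bool)) := {p | ∀ n, p.1 ∈ C (PiNat.res p.2 n)}
  have hres : ∀ l : List Bool, IsOpen {a : ℕ → Bool | PiNat.res a l.length = l} := by
    intro l
    induction l with
    | nil => simp
    | cons b l ih =>
      have : {a : ℕ → Bool | PiNat.res a (b :: l).length = b :: l} =
          {a | a l.length = b} ∩ {a | PiNat.res a l.length = l} := by
        ext a
        simp [PiNat.res_succ]
      rw [this]
      refine IsOpen.inter ?_ ih
      have hc : Continuous (fun a : ℕ → Bool => a l.length) := continuous_apply l.length
      exact (isOpen_discrete ({b} : Set Bool)).preimage hc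
  have hK : IsClosed K := by
    have : K = ⋂ l : List Bool,
        (Prod.fst ⁻¹' C l) ∪ (Prod.snd ⁻¹' {a : ℕ → Bool | PiNat.res a l.length = l})ᶜ := by
      ext p
      simp only [mem_iInter]
      constructor
      · intro hp l
        by_cases h : PiNat.res p.2 l.length = l
        · left
          have := hp l.length
          rw [h] at this
          exact this
        · exact Or.inr h
      · intro hp n
        rcases hp (PiNat.res p.2 n) with h | h
        · exact h
        · exact absurd (by simp [PiNat.res_length]) h
    rw [this]
    exact isClosed_iInter fun l => ((hCc l).preimage continuous_fst).union
      ((hres l).preimage continuous_snd).isClosed_compl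
  have : CompactSpace K := isCompact_iff_compactSpace.1 hK.isCompact
  have hinj : Function.Injective (fun p : K => p.1.1) := by
    rintro ⟨⟨y, a⟩, ha⟩ ⟨⟨z, b⟩, hb⟩ h
    have h' : y = z := h
    subst h'
    have : PiNat.res a = PiNat.res b := by
      funext n
      induction n with
      | zero => rfl
      | succ n ih =>
        have h1 := ha (n+1)
        have h2 := hb (n+1)
        simp only [PiNat.res_succ] at h1 h2 ⊢
        rw [ih] at h1
        rw [ih, hCd _ _ _ _ h1 h2]
    have := PiNat.res_injective this
    subst this
    rfl
  refine irreducible_case (Y := K) (ρ ∘ fun p : K => p.1.1) (hρ.comp hinj)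
    (fun p => p.1.2) (by fun_prop) ?_ (fun n => (fun p : K => p.1.1) ⁻¹' L n)
    (fun n => (hL n).preimage (by fun_prop)) (fun p => hcov p.1.1)
  intro a
  have := IsCompact.nonempty_iInter_of_sequence_nonempty_isCompact_isClosed
    (fun n => C (PiNat.res a n)) (fun n => by
      rw [PiNat.res_succ]; exact hCs _ _)
    (fun n => (V (PiNat.res a n)).2.2.closure) (hCc _).isCompact (fun n => hCc _)
  obtain ⟨y, hy⟩ := this
  exact ⟨⟨⟨y, a⟩, fun n => mem_iInter.1 hy n⟩, rfl⟩

theorem not_covered {X : Type u} {W : Type*} [TopologicalSpace X] [T2Space X]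
    [LinearOrder W] [WellFoundedLT W] (ρ : X → W) (hρ : Function.Injective ρ)
    (hcrowded : ∀ x : X, ¬ IsOpen ({x} : Set X))
    (hcc : CountablyCompactSpace X)
    (hπ : ∀ V : Set X, IsOpen V → V.Nonempty →
      ∃ F : Set X, F.Nonempty ∧ F = closure (interior F) ∧ F ⊆ V)
    (V : Set X) (hV : IsOpen V) (hne : V.Nonempty)
    (L : ℕ → Set X) (hL : ∀ n, LS ρ (L n)) (hcov : ∀ y ∈ V, ∃ n, y ∈ L n) : False := by
  obtain ⟨F, hFne, hF, hFV⟩ := hπ V hV hne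
  have hFc : IsClosed F := by rw [hF]; exact isClosed_closure
  have : CountablyCompactSpace F :=
    isCountablyCompact_iff_countablyCompactSpace.1 hFc.isCountablyCompact
  have : Nonempty F := hFne.to_subtype
  have hρ' : Function.Injective (ρ ∘ (Subtype.val : F → X)) := hρ.comp Subtype.val_injective
  have hL' : ∀ n, LS (ρ ∘ (Subtype.val : F → X)) (Subtype.val ⁻¹' L n) :=
    fun n => (hL n).preimage continuous_subtype_val
  have hcov' : ∀ y : F, ∃ n, y ∈ (Subtype.val : F → X) ⁻¹' L n := fun y => hcov y.1 (hFV y.2)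
  have : CompactSpace F := compact_of_LS _ hρ' _ hL' hcov'
  refine compact_case _ hρ' ?_ _ hL' hcov'
  rintro ⟨x, hx⟩ hxo
  obtain ⟨U, hU, hUx⟩ := isOpen_induced_iff.1 hxo
  have hxU : x ∈ U := by
    have : (⟨x, hx⟩ : F) ∈ (Subtype.val : F → X) ⁻¹' U := by rw [hUx]; rfl
    exact this
  have huniq : ∀ z ∈ U, z ∈ F → z = x := by
    intro z hz hzF
    have : (⟨z, hzF⟩ : F) ∈ (Subtype.val : F → X) ⁻¹' U := hz
    rw [hUx] at this
    exact congrArg Subtype.val (mem_singleton_iff.1 this)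
  have hx' : x ∈ closure (interior F) := hF ▸ hx
  obtain ⟨z, hzU, hzF⟩ := mem_closure_iff.1 hx' U hU hxU
  have hzx := huniq z hzU (interior_subset hzF)
  apply hcrowded x
  have : ({x} : Set X) = U ∩ interior F := by
    ext w
    constructor
    · intro hw
      rw [mem_singleton_iff.1 hw, ← hzx]
      exact ⟨hzU, hzF⟩
    · intro hw
      exact huniq w hw.1 (interior_subset hw.2)
  rw [this]
  exact hU.inter isOpen_interior

/-- A crowded, countably compact Hausdorff space whose regular closed subsets
form a `π`-network is `ω₁`-resolvable. -/
theorem stmt19 {X : Type u} [TopologicalSpace X] [T2Space X]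
    (hcrowded : ∀ x : X, ¬ IsOpen ({x} : Set X))
    (hcc : ∀ U : ℕ → Set X, (∀ n, IsOpen (U n)) → ⋃ n, U n = Set.univ →
      ∃ t : Finset ℕ, ⋃ n ∈ t, U n = Set.univ)
    (hπ : ∀ V : Set X, IsOpen V → V.Nonempty →
      ∃ F : Set X, F.Nonempty ∧ F = closure (interior F) ∧ F ⊆ V) :
    Resolvable X (Cardinal.aleph 1) := by
  classical
  have hcc' : CountablyCompactSpace X := by
    refine ⟨isCountablyCompact_iff_countable_open_cover.2 fun U hU hc => ?_⟩
    obtain ⟨t, ht⟩ := hcc U hU (univ_subset_iff.1 hc)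
    exact ⟨t, ht.ge⟩
  let ρ : X → Ordinal.{u} := Ordinal.typein (WellOrderingRel (α := X))
  have hρ : Function.Injective ρ := Ordinal.typein_injective _
  let ι : Type u := (Cardinal.aleph 1 : Cardinal.{u}).ord.ToType
  let dl : Set X → Set X := fun Y => {x ∈ Y | x ∉ closure {y ∈ Y | ρ y < ρ x}}
  have dlLS : ∀ Y, LS ρ (dl Y) := by
    intro Y x hx
    refine ⟨(closure {y ∈ Y | ρ y < ρ x})ᶜ, isClosed_closure.isOpen_compl, hx.2, ?_⟩
    intro y hy hyU
    by_contra hlt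
    exact hyU (subset_closure ⟨hy.1, not_le.1 hlt⟩)
  have dlD : ∀ Y, Dense Y → Dense (dl Y) := by
    intro Y hY
    rw [dense_iff_inter_open] at hY ⊢
    intro U hU hne
    obtain ⟨x, hx, hmin⟩ := (InvImage.wf ρ wellFounded_lt).has_min (U ∩ Y) (hY U hU hne)
    refine ⟨x, hx.1, hx.2, fun hcl => ?_⟩
    obtain ⟨y, hyU, hy⟩ := mem_closure_iff.1 hcl U hU hx.1
    exact hmin y ⟨hyU, hy.1⟩ hy.2
  have wf : WellFounded (fun a b : ι => a < b) := wellFounded_lt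
  let D : ι → Set X := wf.fix (fun i rec => dl {x | ∀ j, ∀ h : j < i, x ∉ rec j h})
  have hDeq : ∀ i, D i = dl {x | ∀ j, j < i → x ∉ D j} := fun i =>
    wf.fix_eq (C := fun _ => Set X) (fun i rec => dl {x | ∀ j, ∀ h : j < i, x ∉ rec j h}) i
  have hDLS : ∀ i, LS ρ (D i) := fun i => by rw [hDeq]; exact dlLS _
  have hlt : ∀ i j, j < i → Disjoint (D j) (D i) := by
    intro i j hij
    rw [Set.disjoint_left]
    intro x hxj hxi
    rw [hDeq i] at hxi
    exact hxi.1 j hij hxj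
  refine ⟨ι, D, by simp [ι], ?_, ?_⟩
  · intro i
    rw [hDeq]
    apply dlD
    rw [dense_iff_inter_open]
    intro V hV hne
    by_contra hcon
    have hcount : (Iio i).Countable := by
      rw [← Cardinal.le_aleph0_iff_set_countable]
      exact Order.lt_succ_iff.1
        ((Cardinal.mk_Iio_toType_ord_lt i).trans_eq Cardinal.succ_aleph0.symm)
    obtain ⟨L, hLr⟩ := ((hcount.image D).insert ∅).exists_eq_range (insert_nonempty _ _)
    refine not_covered ρ hρ hcrowded hcc' hπ V hV hne L ?_ ?_
    · intro n
      have : L n ∈ insert ∅ (D '' Iio i) := by rw [hLr]; exact mem_range_self n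
      rcases this with h | ⟨j, -, h⟩
      · rw [h]; intro x hx; exact absurd hx (notMem_empty x)
      · rw [← h]; exact hDLS j
    · intro y hy
      have : ∃ j, j < i ∧ y ∈ D j := by
        by_contra hno
        push Not at hno
        exact hcon ⟨y, hy, hno⟩
      obtain ⟨j, hj, hyj⟩ := this
      have : D j ∈ insert ∅ (D '' Iio i) := Or.inr ⟨j, hj, rfl⟩
      rw [hLr] at this
      obtain ⟨n, hn⟩ := this
      exact ⟨n, hn ▸ hyj⟩
  · intro i j hij
    rcases lt_or_gt_of_ne hij with h | h
    · exact hlt j i h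
    · exact (hlt i j h).symm
end
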